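/- Let m be a nonzero integer. Uniformly for real X ≥ 2 and integers q with 1 ≤ q ≤ X and gcd(m,q) = 1, one has M₂[m](X,q) = (C/2)·Γ_an(m)·Γ_ar(m)·∏_{p∣q}(1+2p^{-1})^{-1}·X^{1/2}q^{1/2} + O_m(d(q)·X^{1/3}q^{2/3} + X^{23/15}q^{-13/15}(log X)^{15}), where d(q) is the number of divisors of q and the implied constant depends at most on m. -/

import Mathlib

open scoped BigOperators

/-- The singular constant `C(q) = (6/π²)·∏_{p∣q}(1−p^{-2})^{-1}`. -/
noncomputable def Cq (q : ℕ) : ℝ :=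
  (6 / Real.pi ^ 2) * ∏ p ∈ q.primeFactors, (1 - ((p : ℝ))⁻¹ ^ 2)⁻¹

/-- The error term `E(X,q,a)`. -/
noncomputable def Eterm (X : ℝ) (q a : ℕ) : ℝ :=
  (∑ n ∈ (Finset.Icc 1 ⌊X⌋₊).filter (fun n => n % q = a % q),
    ((ArithmeticFunction.moebius n : ℤ) : ℝ) ^ 2) - Cq q * X / q

/-- The correlation sum `M₂[m](X,q) = Σ*_{a mod q} E(X,q,a)·E(X,q,ma)`. -/
noncomputable def M2corr (m : ℤ) (X : ℝ) (q : ℕ) : ℝ :=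
  ∑ a ∈ (Finset.range q).filter (fun a => Nat.Coprime a q),
    Eterm X q a * Eterm X q ((m * a % (q : ℤ)).toNat)

/-- The constant `C = (ζ(3/2)/π)·∏_p (p³−3p+2)/p³`. -/
noncomputable def Cmain : ℝ :=
  ((riemannZeta (3 / 2)).re / Real.pi) *
    ∏' p : Nat.Primes, ((((p : ℕ) : ℝ) ^ 3 - 3 * ((p : ℕ) : ℝ) + 2) / ((p : ℕ) : ℝ) ^ 3)

/-- The analytic factor `Γ_an(m)`. -/
noncomputable def GammaAn (m : ℤ) : ℝ :=
  if 0 < m then (Real.sqrt m + 1 - Real.sqrt ((m : ℝ) - 1)) / m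
  else (Real.sqrt (1 - (m : ℝ)) - Real.sqrt (-(m : ℝ)) - 1) / (-(m : ℝ))

/-- The arithmetic factor `Γ_ar(m)`. -/
noncomputable def GammaAr (m : ℤ) : ℝ :=
  (∏ p ∈ m.natAbs.primeFactors.filter (fun p : ℕ => ((p : ℤ)) ^ 2 ∣ m),
      (-(((p : ℝ) ^ 2 - 1) / ((p : ℝ) + 2)))) *
  ∏ p ∈ m.natAbs.primeFactors.filter (fun p : ℕ => ¬ ((p : ℤ)) ^ 2 ∣ m),
      (1 + ((p : ℝ) + (p : ℝ) ^ ((1 : ℝ)/2) + 1) /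
        ((p : ℝ) ^ ((3 : ℝ)/2) + (p : ℝ) ^ ((1 : ℝ)/2) + 1))⁻¹

section
/-- the periodic function `{x}(1-{x})` -/
noncomputable def bet (x : ℝ) : ℝ := Int.fract x * (1 - Int.fract x)

lemma bet_eq_round (x : ℝ) : bet x = |x - round x| * (1 - |x - round x|) := by
  rw [abs_sub_round_eq_min, bet]
  rcases le_total (Int.fract x) (1 - Int.fract x) with h | h
  · rw [min_eq_left h]
  · rw [min_eq_right h]; ring

lemma bet_nonneg (x : ℝ) : 0 ≤ bet x :=
  mul_nonneg (Int.fract_nonneg x) (by linarith [Int.fract_lt_one x])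

lemma bet_le (x : ℝ) : bet x ≤ 1 / 4 := by
  rw [bet]; nlinarith [sq_nonneg (Int.fract x - 1 / 2)]

lemma bet_lip (x y : ℝ) : |bet x - bet y| ≤ |x - y| := by
  rw [bet_eq_round, bet_eq_round]
  have hx := abs_sub_round x
  have hy := abs_sub_round y
  have h1 : |x - round x| ≤ |x - y| + |y - round y| := by
    refine (round_le x (round y)).trans ?_
    have := abs_add_le (x - y) (y - round y)
    simpa using this
  have h2 : |y - round y| ≤ |x - y| + |x - round x| := by
    refine (round_le y (round x)).trans ?_
    have := abs_add_le (y - x) (x - round x)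
    rw [abs_sub_comm y x] at this
    simpa using this
  have a0 := abs_nonneg (x - round x)
  have b0 := abs_nonneg (y - round y)
  generalize |x - round x| = a at *
  generalize |y - round y| = b at *
  have : a * (1 - a) - b * (1 - b) = (a - b) * (1 - a - b) := by ring
  rw [this, abs_mul]
  have h3 : |a - b| ≤ |x - y| := abs_le.mpr ⟨by linarith, by linarith⟩
  have h4 : |1 - a - b| ≤ 1 := abs_le.mpr ⟨by linarith, by linarith⟩
  calc |a - b| * |1 - a - b| ≤ |x - y| * 1 := mul_le_mul h3 h4 (abs_nonneg _) (abs_nonneg _)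
    _ = _ := mul_one _

lemma bet_zero : bet 0 = 0 := by simp [bet]

lemma bet_le_abs (x : ℝ) : bet x ≤ |x| := by
  have := bet_lip x 0
  rw [bet_zero] at this
  simpa [abs_of_nonneg (bet_nonneg x)] using this

lemma bet_neg (x : ℝ) : bet (-x) = bet x := by
  by_cases h : Int.fract x = 0
  · have : Int.fract (-x) = 0 := Int.fract_neg_eq_zero.mpr h
    simp [bet, h, this]
  · rw [bet, bet, Int.fract_neg h]; ring

lemma bet_abs (x : ℝ) : bet |x| = bet x := by
  rcases abs_choice x with h | h <;> rw [h]
  exact bet_neg x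

lemma bet_continuous : Continuous bet := by
  have : LipschitzWith 1 bet := LipschitzWith.of_dist_le_mul (fun x y => by
    simpa [Real.dist_eq] using bet_lip x y)
  exact this.continuous

lemma bet_hasDerivAt (x : ℝ) (hx : ∀ n : ℤ, x ≠ n) :
    HasDerivAt bet (1 - 2 * Int.fract x) x := by
  have h1 : HasDerivAt (fun y : ℝ => (y - ⌊x⌋) * (1 - (y - ⌊x⌋))) (1 - 2 * Int.fract x) x := by
    have h := ((hasDerivAt_id x).sub_const (⌊x⌋ : ℝ))
    have h2 := h.mul ((hasDerivAt_const x (1 : ℝ)).sub h)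
    refine h2.congr_deriv ?_
    have : Int.fract x = x - ⌊x⌋ := rfl
    rw [this]; simp; ring
  refine h1.congr_of_eventuallyEq ?_
  have hlt : (⌊x⌋ : ℝ) < x := lt_of_le_of_ne (Int.floor_le x) (fun h => hx _ h.symm)
  filter_upwards [Ioo_mem_nhds hlt (Int.lt_floor_add_one x)] with y hy
  have : ⌊y⌋ = ⌊x⌋ := Int.floor_eq_iff.mpr ⟨hy.1.le, hy.2⟩
  simp only [bet, Int.fract, this]

/-- integral of the fractional part along a line -/
lemma integral_fract_line (c X L : ℝ) (m : ℤ) (hm : m ≠ 0) (hL : 0 < L) :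
    ∫ t in (0:ℝ)..X, Int.fract ((c - m * t) / L) =
      X / 2 + L / (2 * m) * (bet ((c - m * X) / L) - bet (c / L)) := by
  have hm' : (m : ℝ) ≠ 0 := by exact_mod_cast hm
  set f : ℝ → ℝ := fun t => t / 2 + L / (2 * m) * bet ((c - m * t) / L) with hf
  set S : Set ℝ := Set.range (fun n : ℤ => (c - L * n) / m) with hS
  have hcont : Continuous f := by
    have := bet_continuous
    fun_prop
  have hint : ∀ a b : ℝ, IntervalIntegrable (fun t => Int.fract ((c - m * t) / L)) MeasureTheory.volume a b := by
    intro a b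
    refine (intervalIntegrable_const (c := (1 : ℝ))).mono_fun ?_ ?_
    · exact (measurable_fract.comp (by fun_prop)).aestronglyMeasurable
    · refine Filter.Eventually.of_forall (fun t => ?_)
      simp only [Real.norm_eq_abs, abs_one]
      rw [abs_of_nonneg (Int.fract_nonneg _)]
      exact (Int.fract_lt_one _).le
  have key := MeasureTheory.integral_eq_of_hasDerivAt_off_countable f
    (fun t => Int.fract ((c - m * t) / L)) (a := 0) (b := X) (s := S)
    (Set.countable_range _) hcont.continuousOn (fun x hx => ?_) (hint 0 X)
  · rw [key, hf]; simp; ring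
  · have hne : ∀ n : ℤ, (c - m * x) / L ≠ n := by
      intro n hn
      apply hx.2
      refine ⟨n, ?_⟩
      rw [div_eq_iff hL.ne'] at hn
      simp only
      rw [div_eq_iff hm']
      linarith
    have h1 := bet_hasDerivAt _ hne
    have h2 : HasDerivAt (fun t : ℝ => (c - m * t) / L) (-(m : ℝ) / L) x := by
      have := (((hasDerivAt_id x).const_mul (m : ℝ)).const_sub c).div_const L
      simpa using this
    have h3 := ((hasDerivAt_id x).div_const 2).add ((h1.comp x h2).const_mul (L / (2 * m)))
    refine h3.congr_deriv ?_
    generalize Int.fract ((c - m * x) / L) = w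
    field_simp
    ring
end

section
open MeasureTheory Set Filter Topology

noncomputable def cst : ℝ := ∫ t in Ioi (0:ℝ), bet (1 / t ^ 2)

noncomputable def BB (Y : ℝ) : ℝ := ∑' f : ℕ, bet (Y / (f : ℝ) ^ 2)

lemma summable_inv_sq : Summable (fun f : ℕ => 1 / (f : ℝ) ^ 2) :=
  Real.summable_one_div_nat_pow.mpr (by norm_num)

lemma bet_term_le {Y : ℝ} (hY : 0 ≤ Y) (f : ℝ) : bet (Y / f ^ 2) ≤ Y * (1 / f ^ 2) := by
  have := bet_le_abs (Y / f ^ 2)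
  rw [abs_of_nonneg (by positivity)] at this
  calc _ ≤ _ := this
    _ = _ := by ring

lemma summable_BB {Y : ℝ} (hY : 0 ≤ Y) : Summable (fun f : ℕ => bet (Y / (f : ℝ) ^ 2)) :=
  Summable.of_nonneg_of_le (fun _ => bet_nonneg _) (fun f => bet_term_le hY f)
    (summable_inv_sq.mul_left Y)

lemma BB_nonneg (Y : ℝ) : 0 ≤ BB Y := tsum_nonneg (fun _ => bet_nonneg _)

lemma phi_meas (Y : ℝ) : Measurable (fun t : ℝ => bet (Y / t ^ 2)) :=
  bet_continuous.measurable.comp (by fun_prop)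

lemma phi_intble_Ioc (Y a b : ℝ) : IntegrableOn (fun t : ℝ => bet (Y / t ^ 2)) (Ioc a b) := by
  refine Measure.integrableOn_of_bounded (M := 1 / 4) (by simp) (phi_meas Y).aestronglyMeasurable ?_
  refine Eventually.of_forall (fun t => ?_)
  rw [Real.norm_eq_abs, abs_of_nonneg (bet_nonneg _)]
  exact bet_le _

lemma phi_intble_Ioi {Y : ℝ} (hY : 0 ≤ Y) : IntegrableOn (fun t : ℝ => bet (Y / t ^ 2)) (Ioi 0) := by
  rw [← Ioc_union_Ioi_eq_Ioi (zero_le_one : (0:ℝ) ≤ 1)]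
  refine (phi_intble_Ioc Y 0 1).union ?_
  have h := (integrableOn_Ioi_rpow_of_lt (a := -2) (by norm_num) (zero_lt_one : (0:ℝ) < 1)).const_mul Y
  refine Integrable.mono' h (phi_meas Y).aestronglyMeasurable ?_
  refine (ae_restrict_iff' measurableSet_Ioi).mpr (Eventually.of_forall (fun t ht => ?_))
  rw [Real.norm_eq_abs, abs_of_nonneg (bet_nonneg _)]
  refine (bet_term_le hY t).trans (le_of_eq ?_)
  have ht0 : (0:ℝ) < t := lt_trans zero_lt_one ht
  rw [Real.rpow_neg ht0.le, Real.rpow_ofNat]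
  simp

lemma phi_integral {Y : ℝ} (hY : 0 < Y) :
    ∫ t in Ioi (0:ℝ), bet (Y / t ^ 2) = cst * Real.sqrt Y := by
  have hs : 0 < Real.sqrt Y := Real.sqrt_pos.mpr hY
  have h := integral_comp_mul_left_Ioi (fun t : ℝ => bet (1 / t ^ 2)) 0 (inv_pos.mpr hs)
  rw [mul_zero, inv_inv, smul_eq_mul] at h
  rw [cst, mul_comm, ← h]
  congr 1
  ext t
  congr 1
  rw [mul_pow, inv_pow, Real.sq_sqrt hY.le]
  by_cases ht : t = 0
  · simp [ht]
  · field_simp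

lemma cst_nonneg : 0 ≤ cst := integral_nonneg (fun _ => bet_nonneg _)

lemma phi_step {Y : ℝ} (hY : 0 ≤ Y) {a : ℝ} (ha : 0 < a) :
    |bet (Y / (a + 1) ^ 2) - ∫ t in a..(a + 1), bet (Y / t ^ 2)| ≤ Y / a ^ 2 - Y / (a + 1) ^ 2 := by
  have h1 : bet (Y / (a + 1) ^ 2) = ∫ t in a..(a + 1), bet (Y / (a + 1) ^ 2) := by simp
  have hi : IntervalIntegrable (fun t : ℝ => bet (Y / t ^ 2)) volume a (a + 1) :=
    (intervalIntegrable_iff_integrableOn_Ioc_of_le (by linarith)).mpr (phi_intble_Ioc _ _ _)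
  rw [h1, ← intervalIntegral.integral_sub (by simp) hi]
  have := intervalIntegral.norm_integral_le_of_norm_le_const (a := a) (b := a + 1)
    (C := Y / a ^ 2 - Y / (a + 1) ^ 2) (f := fun t => bet (Y / (a + 1) ^ 2) - bet (Y / t ^ 2)) ?_
  · simpa using this
  · intro t ht
    rw [uIoc_of_le (by linarith)] at ht
    have ht0 : 0 < t := ha.trans ht.1
    refine (bet_lip _ _).trans ?_
    have e1 : Y / (a + 1) ^ 2 ≤ Y / t ^ 2 := by
      have := ht.2
      gcongr
    have e2 : Y / t ^ 2 ≤ Y / a ^ 2 := by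
      have := ht.1.le
      gcongr
    rw [abs_le]; constructor <;> linarith

lemma phi_partial {Y : ℝ} (hY : 0 ≤ Y) {F : ℝ} (hF : 0 < F) (n : ℕ) :
    |∑ f ∈ Finset.range n, bet (Y / (F + f + 1) ^ 2) - ∫ t in F..(F + n), bet (Y / t ^ 2)|
      ≤ Y / F ^ 2 - Y / (F + n) ^ 2 := by
  induction n with
  | zero => simp
  | succ n ih =>
    have hi : ∀ a b : ℝ, IntervalIntegrable (fun t : ℝ => bet (Y / t ^ 2)) volume a b := fun a b =>
      ⟨phi_intble_Ioc _ _ _, phi_intble_Ioc _ _ _⟩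
    rw [Finset.sum_range_succ, ← intervalIntegral.integral_add_adjacent_intervals (hi F (F + n)) (hi (F + n) _)]
    have h := phi_step hY (a := F + n) (by positivity)
    push_cast
    rw [← add_assoc]
    rw [abs_le] at *
    constructor <;> linarith [ih.1, ih.2, h.1, h.2]

lemma BB_aux {Y : ℝ} (hY : 0 < Y) (F : ℕ) (hF : 0 < F) :
    |BB Y - cst * Real.sqrt Y| ≤ F / 4 + Y / (F : ℝ) ^ 2 := by
  have hF' : (0:ℝ) < F := by exact_mod_cast hF
  have hs := summable_BB hY.le
  have h1 := hs.sum_add_tsum_nat_add (F + 1)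
  have hs2 : Summable (fun f : ℕ => bet (Y / ((f + (F + 1) : ℕ) : ℝ) ^ 2)) :=
    hs.comp_injective (add_left_injective (F + 1))
  have hI := phi_intble_Ioi hY.le
  have hI2 : IntegrableOn (fun t : ℝ => bet (Y / t ^ 2)) (Ioi (F : ℝ)) :=
    hI.mono_set (Ioi_subset_Ioi hF'.le)
  have hlim1 := hs2.hasSum.tendsto_sum_nat
  have hlim2 := intervalIntegral_tendsto_integral_Ioi (F : ℝ) hI2
    (tendsto_atTop_add_const_left atTop (F : ℝ) (tendsto_natCast_atTop_atTop (R := ℝ)))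
  have h2 : |∑' f : ℕ, bet (Y / ((f + (F + 1) : ℕ) : ℝ) ^ 2) - ∫ t in Ioi (F : ℝ), bet (Y / t ^ 2)|
      ≤ Y / (F : ℝ) ^ 2 := by
    refine le_of_tendsto (hlim1.sub hlim2).abs (Eventually.of_forall (fun n => ?_))
    have h := phi_partial hY.le hF' n
    have e : ∑ f ∈ Finset.range n, bet (Y / ((f + (F + 1) : ℕ) : ℝ) ^ 2)
        = ∑ f ∈ Finset.range n, bet (Y / ((F : ℝ) + f + 1) ^ 2) := by
      refine Finset.sum_congr rfl (fun f _ => ?_)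
      congr 3
      push_cast; ring
    rw [e]
    refine h.trans ?_
    have : 0 ≤ Y / ((F : ℝ) + n) ^ 2 := by positivity
    linarith
  have h3 : ∫ t in Ioi (0:ℝ), bet (Y / t ^ 2) =
      (∫ t in Ioc (0:ℝ) F, bet (Y / t ^ 2)) + ∫ t in Ioi (F : ℝ), bet (Y / t ^ 2) := by
    rw [← Ioc_union_Ioi_eq_Ioi hF'.le]
    exact setIntegral_union Ioc_disjoint_Ioi_same measurableSet_Ioi (phi_intble_Ioc _ _ _) hI2
  have h4 : 0 ≤ ∫ t in Ioc (0:ℝ) F, bet (Y / t ^ 2) := integral_nonneg (fun _ => bet_nonneg _)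
  have h5 : ∫ t in Ioc (0:ℝ) F, bet (Y / t ^ 2) ≤ F / 4 := by
    have := setIntegral_mono_on (phi_intble_Ioc Y 0 F) (integrableOn_const (C := (1/4 : ℝ)) (by simp))
      measurableSet_Ioc (fun t _ => bet_le (Y / t ^ 2))
    refine this.trans (le_of_eq ?_)
    simp; ring
  have h6 : 0 ≤ ∑ f ∈ Finset.range (F + 1), bet (Y / (f : ℝ) ^ 2) :=
    Finset.sum_nonneg (fun _ _ => bet_nonneg _)
  have h7 : ∑ f ∈ Finset.range (F + 1), bet (Y / (f : ℝ) ^ 2) ≤ F / 4 := by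
    rw [Finset.sum_range_succ']
    have := Finset.sum_le_card_nsmul (Finset.range F) (fun f => bet (Y / ((f + 1 : ℕ) : ℝ) ^ 2)) (1/4)
      (fun f _ => bet_le _)
    simp only [Finset.card_range, nsmul_eq_mul] at this
    have e : bet (Y / ((0 : ℕ) : ℝ) ^ 2) = 0 := by simp [bet_zero]
    rw [e]; linarith
  rw [← phi_integral hY, BB, ← h1, h3]
  clear hlim1 hlim2 hI hI2 hs hs2 h1 h3
  generalize (∑' f : ℕ, bet (Y / ((f + (F + 1) : ℕ) : ℝ) ^ 2)) = u at *
  generalize (∫ t in Ioi (F : ℝ), bet (Y / t ^ 2)) = v at *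
  generalize (∫ t in Ioc (0:ℝ) F, bet (Y / t ^ 2)) = w at *
  generalize (∑ f ∈ Finset.range (F + 1), bet (Y / (f : ℝ) ^ 2)) = x at *
  rw [abs_le] at h2 ⊢
  constructor <;> linarith [h2.1, h2.2]

lemma BB_asymp : ∃ K : ℝ, 0 < K ∧ ∀ Y : ℝ, 0 ≤ Y → |BB Y - cst * Real.sqrt Y| ≤ K * Y ^ ((1:ℝ)/3) := by
  set z := ∑' f : ℕ, 1 / (f : ℝ) ^ 2 with hz
  have hz0 : 0 ≤ z := tsum_nonneg (fun _ => by positivity)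
  have hc := cst_nonneg
  refine ⟨2 + z + cst, by positivity, fun Y hY => ?_⟩
  rcases hY.eq_or_lt with rfl | hY
  · simp [BB, bet_zero]
  have hp : 0 < Y ^ ((1:ℝ)/3) := Real.rpow_pos_of_pos hY _
  rcases le_or_gt 1 Y with h1 | h1
  · have hp1 : 1 ≤ Y ^ ((1:ℝ)/3) := Real.one_le_rpow h1 (by norm_num)
    have hF : 0 < ⌈Y ^ ((1:ℝ)/3)⌉₊ := Nat.ceil_pos.mpr hp
    have h := BB_aux hY _ hF
    have hle := Nat.le_ceil (Y ^ ((1:ℝ)/3))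
    have hlt := Nat.ceil_lt_add_one hp.le
    have h2 : Y / (⌈Y ^ ((1:ℝ)/3)⌉₊ : ℝ) ^ 2 ≤ Y ^ ((1:ℝ)/3) := by
      rw [div_le_iff₀ (by positivity)]
      calc Y = Y ^ ((1:ℝ)/3) * (Y ^ ((1:ℝ)/3)) ^ 2 := by
            rw [← pow_succ', ← Real.rpow_natCast, ← Real.rpow_mul hY.le]; norm_num
        _ ≤ _ := by gcongr
    have : 0 ≤ (z + cst) * Y ^ ((1:ℝ)/3) := by positivity
    nlinarith
  · have hb : BB Y ≤ z * Y := by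
      rw [hz, mul_comm, ← tsum_mul_left]
      exact (summable_BB hY.le).tsum_le_tsum (fun f => bet_term_le hY.le f) (summable_inv_sq.mul_left Y)
    have e1 : Y ≤ Y ^ ((1:ℝ)/3) := by
      conv_lhs => rw [← Real.rpow_one Y]
      exact Real.rpow_le_rpow_of_exponent_ge hY h1.le (by norm_num)
    have e2 : Real.sqrt Y ≤ Y ^ ((1:ℝ)/3) := by
      rw [Real.sqrt_eq_rpow]
      exact Real.rpow_le_rpow_of_exponent_ge hY h1.le (by norm_num)
    have e3 := BB_nonneg Y
    have e4 : z * Y ≤ z * Y ^ ((1:ℝ)/3) := by gcongr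
    have e5 : cst * Real.sqrt Y ≤ cst * Y ^ ((1:ℝ)/3) := by gcongr
    have e6 : 0 ≤ cst * Real.sqrt Y := by positivity
    have e7 : 0 ≤ z * Y ^ ((1:ℝ)/3) := by positivity
    rw [abs_le]; constructor <;> nlinarith
end

section
open MeasureTheory Set Filter Topology

lemma int_quartic : ∫ r in Ioi (0:ℝ), 2 / (1 + r ^ 4) = Real.pi / Real.sqrt 2 := by
  set w := Real.sqrt 2 with hw
  have hw2 : w ^ 2 = 2 := Real.sq_sqrt (by norm_num)
  have hw0 : 0 < w := Real.sqrt_pos.mpr (by norm_num)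
  have p1 : ∀ r : ℝ, 0 < r ^ 2 + w * r + 1 := fun r => by nlinarith [sq_nonneg (2 * r + w)]
  have p2 : ∀ r : ℝ, 0 < r ^ 2 - w * r + 1 := fun r => by nlinarith [sq_nonneg (2 * r - w)]
  set F : ℝ → ℝ := fun r => (1 / w) * (Real.arctan (w * r + 1) + Real.arctan (w * r - 1))
    + (1 / (2 * w)) * (Real.log ((r ^ 2 + w * r + 1) / (r ^ 2 - w * r + 1))) with hF
  have hd : ∀ r : ℝ, HasDerivAt F (2 / (1 + r ^ 4)) r := by
    intro r
    have hl : HasDerivAt (fun r : ℝ => w * r) w r := by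
      simpa using (hasDerivAt_id r).const_mul w
    have hsq : HasDerivAt (fun r : ℝ => r ^ 2) (2 * r) r := by
      simpa using hasDerivAt_pow 2 r
    have a1 := (hl.add_const 1).arctan
    have a2 := (hl.sub_const 1).arctan
    have b1 := (hsq.add hl).add_const 1
    have b2 := (hsq.sub hl).add_const 1
    have b3 := (b1.div b2 (p2 r).ne').log (div_pos (p1 r) (p2 r)).ne'
    have := ((a1.add a2).const_mul (1 / w)).add (b3.const_mul (1 / (2 * w)))
    refine this.congr_deriv ?_
    simp only [Pi.add_apply, Pi.sub_apply, Pi.div_apply]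
    have q1 := (p1 r).ne'
    have q2 := (p2 r).ne'
    have e1 : 1 + (w * r + 1) ^ 2 = 2 * (r ^ 2 + w * r + 1) := by nlinarith
    have e2 : 1 + (w * r - 1) ^ 2 = 2 * (r ^ 2 - w * r + 1) := by nlinarith
    have e3 : 1 + r ^ 4 = (r ^ 2 + w * r + 1) * (r ^ 2 - w * r + 1) := by
      have : (r ^ 2 + w * r + 1) * (r ^ 2 - w * r + 1) = r ^ 4 + (2 - w ^ 2) * r ^ 2 + 1 := by ring
      rw [this, hw2]; ring
    rw [e1, e2, e3]
    have s1 : (r ^ 2 + w * r + 1) - (r ^ 2 - w * r + 1) = 2 * (w * r) := by ring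
    have s2 : (r ^ 2 + w * r + 1) + (r ^ 2 - w * r + 1) = 2 * r ^ 2 + 2 := by ring
    generalize (r ^ 2 + w * r + 1) = U at *
    generalize (r ^ 2 - w * r + 1) = V at *
    have hwn := hw0.ne'
    field_simp
    linear_combination (2 * w) * s2 - 2 * r * s1
  have hlim : Tendsto F atTop (𝓝 (Real.pi / w)) := by
    have t0 : Tendsto (fun r : ℝ => w * r) atTop atTop := tendsto_id.const_mul_atTop hw0
    have t1 : Tendsto (fun r : ℝ => Real.arctan (w * r + 1)) atTop (𝓝 (Real.pi / 2)) :=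
      (tendsto_nhds_of_tendsto_nhdsWithin Real.tendsto_arctan_atTop).comp (tendsto_atTop_add_const_right _ _ t0)
    have t2 : Tendsto (fun r : ℝ => Real.arctan (w * r - 1)) atTop (𝓝 (Real.pi / 2)) :=
      (tendsto_nhds_of_tendsto_nhdsWithin Real.tendsto_arctan_atTop).comp (tendsto_atTop_add_const_right _ _ t0)
    have t3 : Tendsto (fun r : ℝ => (r ^ 2 + w * r + 1) / (r ^ 2 - w * r + 1)) atTop (𝓝 1) := by
      have i1 : Tendsto (fun r : ℝ => r⁻¹) atTop (𝓝 0) := tendsto_inv_atTop_zero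
      have i2 : Tendsto (fun r : ℝ => (1 + w * r⁻¹ + r⁻¹ ^ 2) / (1 - w * r⁻¹ + r⁻¹ ^ 2)) atTop
          (𝓝 ((1 + w * 0 + 0 ^ 2) / (1 - w * 0 + 0 ^ 2))) :=
        ((tendsto_const_nhds.add (i1.const_mul w)).add (i1.pow 2)).div
          ((tendsto_const_nhds.sub (i1.const_mul w)).add (i1.pow 2)) (by norm_num)
      have e : (1 + w * 0 + 0 ^ 2) / (1 - w * 0 + 0 ^ 2) = (1:ℝ) := by norm_num
      rw [e] at i2
      refine i2.congr' ?_
      filter_upwards [eventually_gt_atTop 0] with r hr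
      have q2 := (p2 r).ne'
      have : 1 - w * r⁻¹ + r⁻¹ ^ 2 = (r ^ 2 - w * r + 1) / r ^ 2 := by field_simp
      have h' : 1 + w * r⁻¹ + r⁻¹ ^ 2 = (r ^ 2 + w * r + 1) / r ^ 2 := by field_simp
      rw [this, h', div_div_div_cancel_right₀ (by positivity)]
    have t4 : Tendsto (fun r : ℝ => Real.log ((r ^ 2 + w * r + 1) / (r ^ 2 - w * r + 1))) atTop (𝓝 0) := by
      have := (Real.continuousAt_log (one_ne_zero)).tendsto.comp t3
      simpa [Function.comp_def] using this
    have := ((t1.add t2).const_mul (1 / w)).add (t4.const_mul (1 / (2 * w)))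
    convert this using 2; ring
  have := integral_Ioi_of_hasDerivAt_of_nonneg' (a := 0) (fun r _ => hd r) (fun r _ => by positivity) hlim
  rw [this]
  simp [hF, Real.arctan_neg]
end

section
open MeasureTheory Set Filter Topology

lemma int_s_quart : ∫ s in Ioi (0:ℝ), s ^ (-(1:ℝ)/2) / (s ^ 2 + 1) = Real.pi / Real.sqrt 2 := by
  rw [← int_quartic, ← integral_comp_rpow_Ioi (fun r : ℝ => 2 / (1 + r ^ 4)) (p := 1/2) (by norm_num)]
  refine setIntegral_congr_fun measurableSet_Ioi fun x hx => ?_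
  have hx0 : (0:ℝ) < x := hx
  have h4 : (x ^ ((1:ℝ)/2)) ^ 4 = x ^ 2 := by
    rw [← Real.rpow_natCast, ← Real.rpow_mul hx0.le, ← Real.rpow_natCast x 2]; norm_num
  simp only [smul_eq_mul]
  rw [h4, abs_of_pos (by norm_num : (0:ℝ) < 1/2)]
  have : (1:ℝ)/2 - 1 = -1/2 := by norm_num
  rw [this]
  field_simp
  ring

lemma laplace_aux (s : ℝ) (hs : 0 < s) :
    IntegrableOn (fun v => (1 - Real.cos v) * Real.exp (-(s * v))) (Ioi 0) ∧
    ∫ v in Ioi (0:ℝ), (1 - Real.cos v) * Real.exp (-(s * v)) = 1 / s - s / (s ^ 2 + 1) := by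
  set F : ℝ → ℝ := fun v => Real.exp (-(s * v)) * (-(1 / s) + (s * Real.cos v - Real.sin v) / (s ^ 2 + 1)) with hF
  have hs2 : s ^ 2 + 1 ≠ 0 := by positivity
  have hd : ∀ v ∈ Ici (0:ℝ), HasDerivAt F ((1 - Real.cos v) * Real.exp (-(s * v))) v := by
    intro v _
    have h1 : HasDerivAt (fun v : ℝ => -(s * v)) (-(s * 1)) v := ((hasDerivAt_id v).const_mul s).neg
    have h2 := h1.exp
    have h3 := ((((Real.hasDerivAt_cos v).const_mul s).sub (Real.hasDerivAt_sin v)).div_const (s ^ 2 + 1)).const_add (-(1 / s))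
    refine (h2.mul h3).congr_deriv ?_
    simp only [Pi.sub_apply]
    field_simp
    ring
  have hpos : ∀ v ∈ Ioi (0:ℝ), 0 ≤ (1 - Real.cos v) * Real.exp (-(s * v)) := fun v _ =>
    mul_nonneg (by linarith [Real.cos_le_one v]) (Real.exp_pos _).le
  have hlim : Tendsto F atTop (𝓝 0) := by
    have e1 : Tendsto (fun v : ℝ => Real.exp (-(s * v))) atTop (𝓝 0) := by
      refine Real.tendsto_exp_atBot.comp (tendsto_neg_atTop_atBot.comp (tendsto_id.const_mul_atTop hs))
    refine squeeze_zero_norm (a := fun v => Real.exp (-(s * v)) * (1 / s + (s + 1) / (s ^ 2 + 1))) ?_ ?_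
    · intro v
      rw [hF]; simp only [norm_mul, Real.norm_eq_abs, Real.abs_exp]
      gcongr
      refine (abs_add_le _ _).trans ?_
      rw [abs_neg, abs_of_pos (by positivity : 0 < 1 / s), abs_div, abs_of_pos (by positivity : 0 < s ^ 2 + 1)]
      gcongr
      refine (abs_sub _ _).trans ?_
      rw [abs_mul, abs_of_pos hs]
      nlinarith [Real.abs_cos_le_one v, Real.abs_sin_le_one v]
    · simpa using e1.mul_const (1 / s + (s + 1) / (s ^ 2 + 1))
  refine ⟨integrableOn_Ioi_deriv_of_nonneg' hd hpos hlim, ?_⟩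
  rw [integral_Ioi_of_hasDerivAt_of_nonneg' hd hpos hlim]
  simp [hF]
  ring

lemma int_cos_v : ∫ v in Ioi (0:ℝ), (1 - Real.cos v) * (1 / v) ^ ((3:ℝ)/2) = Real.sqrt (2 * Real.pi) := by
  set f : ℝ → ℝ → ℝ := fun s v => s ^ ((1:ℝ)/2) * ((1 - Real.cos v) * Real.exp (-(s * v))) with hf
  have hin : ∀ s ∈ Ioi (0:ℝ), ∫ v in Ioi (0:ℝ), f s v = s ^ (-(1:ℝ)/2) / (s ^ 2 + 1) := by
    intro s hs
    have hs0 : (0:ℝ) < s := hs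
    rw [hf]; simp only []
    rw [integral_const_mul, (laplace_aux s hs).2]
    have : s ^ ((1:ℝ)/2) = s * s ^ (-(1:ℝ)/2) := by
      rw [← Real.rpow_one_add' hs0.le (by norm_num)]; norm_num
    rw [this]; field_simp; ring
  have hin2 : ∀ v ∈ Ioi (0:ℝ), ∫ s in Ioi (0:ℝ), f s v = (1 - Real.cos v) * (1 / v) ^ ((3:ℝ)/2) * Real.Gamma (3/2) := by
    intro v hv
    have := Real.integral_rpow_mul_exp_neg_mul_Ioi (a := 3/2) (by norm_num) (show 0 < v from hv)
    rw [mul_assoc, ← this, ← integral_const_mul]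
    refine setIntegral_congr_fun measurableSet_Ioi fun s _ => ?_
    simp only [hf]
    rw [mul_comm v s]; norm_num; ring
  have hne : Real.pi / Real.sqrt 2 ≠ 0 := by positivity
  have hnn : ∀ s v : ℝ, 0 ≤ s → 0 ≤ f s v := fun s v hs => by
    have := Real.cos_le_one v
    simp only [hf]
    exact mul_nonneg (Real.rpow_nonneg hs _) (mul_nonneg (by linarith) (Real.exp_pos _).le)
  have hint : Integrable (Function.uncurry f) ((volume.restrict (Ioi (0:ℝ))).prod (volume.restrict (Ioi (0:ℝ)))) := by
    rw [integrable_prod_iff]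
    · constructor
      · refine (ae_restrict_iff' measurableSet_Ioi).2 (Eventually.of_forall fun s hs => ?_)
        exact (laplace_aux s hs).1.const_mul (s ^ ((1:ℝ)/2))
      · have : Integrable (fun s : ℝ => s ^ (-(1:ℝ)/2) / (s ^ 2 + 1)) (volume.restrict (Ioi (0:ℝ))) :=
          Integrable.of_integral_ne_zero (by rw [int_s_quart]; exact hne)
        refine this.congr ?_
        refine (ae_restrict_iff' measurableSet_Ioi).2 (Eventually.of_forall fun s hs => ?_)
        simp only []
        rw [← hin s hs]
        congr 1; ext v
        simp only [Function.uncurry]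
        rw [Real.norm_of_nonneg (hnn s v (le_of_lt hs))]
    · have : Measurable (Function.uncurry f) := by
        simp only [hf, Function.uncurry_def]; fun_prop
      exact this.aestronglyMeasurable
  have hsw := integral_integral_swap hint
  rw [setIntegral_congr_fun measurableSet_Ioi hin, setIntegral_congr_fun measurableSet_Ioi hin2,
    int_s_quart, integral_mul_const] at hsw
  have hG : Real.Gamma (3/2) = Real.sqrt Real.pi / 2 := by
    have := Real.Gamma_add_one (s := 1/2) (by norm_num)
    rw [Real.Gamma_one_half_eq] at this
    rw [show (3:ℝ)/2 = 1/2 + 1 by norm_num, this]; ring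
  rw [hG] at hsw
  have h1 : Real.sqrt (2 * Real.pi) = Real.sqrt 2 * Real.sqrt Real.pi := Real.sqrt_mul (by norm_num) _
  have h2 : Real.sqrt Real.pi ^ 2 = Real.pi := Real.sq_sqrt Real.pi_pos.le
  have h3 : Real.sqrt 2 ^ 2 = 2 := Real.sq_sqrt (by norm_num)
  have h4 : 0 < Real.sqrt Real.pi := Real.sqrt_pos.2 Real.pi_pos
  have h5 : 0 < Real.sqrt 2 := Real.sqrt_pos.2 (by norm_num)
  rw [h1]
  generalize (∫ v in Ioi (0:ℝ), (1 - Real.cos v) * (1 / v) ^ ((3:ℝ)/2)) = I at *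
  have : Real.pi / Real.sqrt 2 = Real.sqrt Real.pi / 2 * (Real.sqrt 2 * Real.sqrt Real.pi) := by
    field_simp; rw [h2, h3]; ring
  have h6 : (Real.sqrt Real.pi / 2) * I = Real.sqrt Real.pi / 2 * (Real.sqrt 2 * Real.sqrt Real.pi) := by
    rw [← this, hsw]; ring
  exact mul_left_cancel₀ (by positivity) h6

lemma int_cos_J : ∫ t in Ioi (0:ℝ), (1 - Real.cos (1 / t ^ 2)) = Real.sqrt (2 * Real.pi) / 2 := by
  rw [← int_cos_v, ← integral_comp_rpow_Ioi (fun v : ℝ => (1 - Real.cos v) * (1 / v) ^ ((3:ℝ)/2)) (p := -2) (by norm_num),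
    ← integral_div]
  refine setIntegral_congr_fun measurableSet_Ioi fun x hx => ?_
  have hx0 : (0:ℝ) < x := hx
  simp only [smul_eq_mul]
  have e1 : x ^ (-2:ℝ) = 1 / x ^ 2 := by
    rw [Real.rpow_neg hx0.le]; norm_num
  have e2 : (x ^ 2) ^ ((3:ℝ)/2) = x ^ 3 := by
    rw [← Real.rpow_natCast, ← Real.rpow_mul hx0.le, ← Real.rpow_natCast]; norm_num
  have e3 : x ^ ((-2:ℝ) - 1) = (x ^ 3)⁻¹ := by
    rw [show (-2:ℝ) - 1 = -(3:ℕ) by norm_num, Real.rpow_neg hx0.le, Real.rpow_natCast]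
  rw [e1, e3, one_div_one_div, e2, abs_of_neg (by norm_num)]
  field_simp

lemma int_cos_n (n : ℕ) : ∫ t in Ioi (0:ℝ), (1 - Real.cos (2 * Real.pi * n * (1 / t ^ 2))) = Real.pi * Real.sqrt n := by
  rcases Nat.eq_zero_or_pos n with rfl | hn
  · simp
  have hn' : (0:ℝ) < n := by exact_mod_cast hn
  set b := Real.sqrt (2 * Real.pi * n) with hb
  have hb0 : 0 < b := Real.sqrt_pos.2 (by positivity)
  have hb2 : b ^ 2 = 2 * Real.pi * n := Real.sq_sqrt (by positivity)
  have := integral_comp_mul_left_Ioi' (fun t : ℝ => 1 - Real.cos (2 * Real.pi * n * (1 / t ^ 2))) 0 hb0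
  rw [mul_zero] at this
  rw [← this]
  have e : ∀ x ∈ Ioi (0:ℝ), (1 - Real.cos (2 * Real.pi * n * (1 / (b * x) ^ 2))) = 1 - Real.cos (1 / x ^ 2) := by
    intro x hx
    have hx0 : (0:ℝ) < x := hx
    congr 2
    rw [mul_pow, hb2]; field_simp
  rw [setIntegral_congr_fun measurableSet_Ioi e, int_cos_J, smul_eq_mul, hb,
    Real.sqrt_mul (by positivity)]
  have h2 : Real.sqrt (2 * Real.pi) ^ 2 = 2 * Real.pi := Real.sq_sqrt (by positivity)
  linear_combination (Real.sqrt n / 2) * h2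
end

section
open MeasureTheory Set Filter Topology

lemma bet_hasSum (x : ℝ) : HasSum (fun n : ℕ => (1 - Real.cos (2 * Real.pi * n * x)) / (Real.pi ^ 2 * (n:ℝ) ^ 2)) (bet x) := by
  have key : ∀ y ∈ Icc (0:ℝ) 1, HasSum (fun n : ℕ => 1 / (n : ℝ) ^ 2 * Real.cos (2 * Real.pi * n * y)) (Real.pi ^ 2 * (y ^ 2 - y + 1/6)) := by
    intro y hy
    have h := hasSum_one_div_nat_pow_mul_cos (k := 1) one_ne_zero hy
    have hb := bernoulliFun_two y
    rw [bernoulliFun] at hb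
    rw [mul_one, hb] at h
    have e : ((-1:ℝ) ^ (1 + 1) * (2 * Real.pi) ^ 2 / 2 / (Nat.factorial 2 : ℕ) * (y ^ 2 - y + 6⁻¹)) = Real.pi ^ 2 * (y ^ 2 - y + 1/6) := by
      norm_num [Nat.factorial]; left; ring
    rw [← e]; exact h
  have h0 := key 0 (by simp)
  have h1 := key (Int.fract x) ⟨Int.fract_nonneg x, (Int.fract_lt_one x).le⟩
  have h2 := (h0.sub h1).mul_left (1 / Real.pi ^ 2)
  have hpi := Real.pi_ne_zero
  have e2 : bet x = 1 / Real.pi ^ 2 * (Real.pi ^ 2 * (0 ^ 2 - 0 + 1 / 6) - Real.pi ^ 2 * (Int.fract x ^ 2 - Int.fract x + 1 / 6)) := by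
    simp only [bet]; field_simp; ring
  rw [e2]
  refine h2.congr_fun ?_
  intro n
  have : Real.cos (2 * Real.pi * n * Int.fract x) = Real.cos (2 * Real.pi * n * x) := by
    have : 2 * Real.pi * n * Int.fract x = 2 * Real.pi * n * x - (((n:ℤ) * ⌊x⌋ : ℤ) : ℝ) * (2 * Real.pi) := by
      have := Int.self_sub_floor x
      push_cast
      rw [← this]; ring
    rw [this, Real.cos_sub_int_mul_two_pi]
  rw [this]
  simp
  rcases Nat.eq_zero_or_pos n with rfl | hn
  · simp
  · field_simp

lemma cst_eq : cst = (riemannZeta (3/2)).re / Real.pi := by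
  have hI : ∀ n : ℕ, Integrable (fun t : ℝ => (1 - Real.cos (2 * Real.pi * n * (1 / t ^ 2))) / (Real.pi ^ 2 * (n:ℝ) ^ 2)) (volume.restrict (Ioi 0)) := by
    intro n
    rcases Nat.eq_zero_or_pos n with rfl | hn
    · simp
    · refine Integrable.div_const (Integrable.of_integral_ne_zero ?_) _
      rw [int_cos_n]
      have : (0:ℝ) < n := by exact_mod_cast hn
      have := Real.pi_pos
      positivity
  have hv : ∀ n : ℕ, ∫ t in Ioi (0:ℝ), (1 - Real.cos (2 * Real.pi * n * (1 / t ^ 2))) / (Real.pi ^ 2 * (n:ℝ) ^ 2) = (1 / (n:ℝ) ^ ((3:ℝ)/2)) / Real.pi := by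
    intro n
    rw [integral_div, int_cos_n]
    rcases Nat.eq_zero_or_pos n with rfl | hn
    · norm_num
    · have hn' : (0:ℝ) < n := by exact_mod_cast hn
      have : (n:ℝ) ^ ((3:ℝ)/2) * Real.sqrt n = (n:ℝ) ^ 2 := by
        rw [Real.sqrt_eq_rpow, ← Real.rpow_add hn', ← Real.rpow_natCast]; norm_num
      have h3 : 0 < (n:ℝ) ^ ((3:ℝ)/2) := Real.rpow_pos_of_pos hn' _
      have := Real.pi_pos
      rw [← ‹_ = (n:ℝ) ^ 2›]
      have := Real.sqrt_pos.2 hn'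
      field_simp
  have hs : Summable (fun n : ℕ => 1 / (n:ℝ) ^ ((3:ℝ)/2)) := Real.summable_one_div_nat_rpow.2 (by norm_num)
  have hN : Summable (fun n : ℕ => ∫ t in Ioi (0:ℝ), ‖(1 - Real.cos (2 * Real.pi * n * (1 / t ^ 2))) / (Real.pi ^ 2 * (n:ℝ) ^ 2)‖) := by
    refine (hs.div_const Real.pi).congr fun n => ?_
    rw [← hv n]
    congr 1; ext t
    rw [Real.norm_of_nonneg]
    have := Real.cos_le_one (2 * Real.pi * n * (1 / t ^ 2))
    exact div_nonneg (by linarith) (by positivity)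
  have h := hasSum_integral_of_summable_integral_norm hI hN
  have h2 : cst = ∑' n : ℕ, (1 / (n:ℝ) ^ ((3:ℝ)/2)) / Real.pi := by
    rw [cst, ← tsum_congr hv, h.tsum_eq]
    congr 1; ext t
    exact (bet_hasSum _).tsum_eq.symm
  rw [h2, tsum_div_const]
  congr 1
  rw [zeta_eq_tsum_one_div_nat_cpow (by norm_num)]
  have : ∀ n : ℕ, (1:ℂ) / (n:ℂ) ^ ((3:ℂ)/2) = ((1 / (n:ℝ) ^ ((3:ℝ)/2) : ℝ) : ℂ) := by
    intro n
    push_cast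
    rw [Complex.ofReal_cpow (by positivity)]
    push_cast; rfl
  rw [tsum_congr this, ← Complex.ofReal_tsum, Complex.ofReal_re]
end

section
open Finset


lemma sum_mu_divisors (n : ℕ) (hn : n ≠ 0) : ∑ e ∈ n.divisors, ArithmeticFunction.moebius e = if n = 1 then 1 else 0 := by
  have := congrArg (fun f => f n) ArithmeticFunction.moebius_mul_coe_zeta
  simp only [ArithmeticFunction.mul_zeta_apply, ArithmeticFunction.coe_mul_zeta_apply] at this
  rw [this, ArithmeticFunction.one_apply]

lemma sum_mu_gcd (n K : ℕ) (hK : K ≠ 0) :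
    ∑ e ∈ K.divisors, (if e ∣ n then (ArithmeticFunction.moebius e : ℤ) else 0) = if Nat.Coprime n K then 1 else 0 := by
  rw [← Finset.sum_filter]
  have : K.divisors.filter (fun e => e ∣ n) = (n.gcd K).divisors := by
    ext e
    simp only [mem_filter, Nat.mem_divisors, Nat.dvd_gcd_iff, ne_eq, Nat.gcd_eq_zero_iff]
    tauto
  rw [this, sum_mu_divisors _ (by simp [hK])]

lemma sq_dvd_sq_mul_sqf {r b a : ℕ} (ha : Squarefree a) (hb : b ≠ 0) : r ^ 2 ∣ b ^ 2 * a ↔ r ∣ b := by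
  constructor
  · intro h
    obtain ⟨g, r', b', hg, hco, rfl, rfl⟩ := Nat.exists_coprime' (Nat.gcd_pos_of_pos_right r (Nat.pos_of_ne_zero hb))
    have h2 : r' ^ 2 ∣ b' ^ 2 * a := by
      have : g ^ 2 * r' ^ 2 ∣ g ^ 2 * (b' ^ 2 * a) := by convert h using 1 <;> ring
      exact Nat.dvd_of_mul_dvd_mul_left (by positivity) this
    have h3 : r' ^ 2 ∣ a := (Nat.Coprime.pow 2 2 hco).dvd_of_dvd_mul_left h2
    rw [sq] at h3
    have := ha _ h3
    rw [Nat.isUnit_iff] at this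
    subst this
    simp
  · intro h
    exact (pow_dvd_pow_of_dvd h 2).trans (dvd_mul_right _ _)

/-- any finset containing all `r ≥ 1` with `r^2 ∣ n` works -/
lemma sum_mu_sq (n : ℕ) (hn : n ≠ 0) (S : Finset ℕ) (hS : ∀ r, r ^ 2 ∣ n → r ∈ S) :
    ∑ r ∈ S, (if r ^ 2 ∣ n then (ArithmeticFunction.moebius r : ℤ) else 0) = (ArithmeticFunction.moebius n) ^ 2 := by
  obtain ⟨a, b, hab, ha⟩ := Nat.sq_mul_squarefree n
  have hb : b ≠ 0 := by rintro rfl; simp at hab; omega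
  rw [← Finset.sum_filter]
  have : S.filter (fun r => r ^ 2 ∣ n) = b.divisors := by
    ext r
    simp only [mem_filter, Nat.mem_divisors]
    constructor
    · rintro ⟨_, h⟩
      rw [← hab, sq_dvd_sq_mul_sqf ha hb] at h
      exact ⟨h, hb⟩
    · rintro ⟨h, _⟩
      have : r ^ 2 ∣ n := by rw [← hab]; exact (sq_dvd_sq_mul_sqf ha hb).2 h
      exact ⟨hS r this, this⟩
  rw [this, sum_mu_divisors b hb]
  split_ifs with h
  · subst h
    rw [← hab, one_pow, one_mul, ArithmeticFunction.moebius_sq_eq_one_of_squarefree ha]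
  · have : ¬ Squarefree n := by
      intro hsq
      have h2 : b * b ∣ n := by rw [← hab]; exact ⟨a, by ring⟩
      have := hsq b h2
      rw [Nat.isUnit_iff] at this; exact h this
    rw [ArithmeticFunction.moebius_eq_zero_of_not_squarefree this]; simp

lemma sum_mu_div (K : ℕ) (hK : K ≠ 0) :
    ∑ e ∈ K.divisors, (ArithmeticFunction.moebius e : ℝ) / e = (K.totient : ℝ) / K := by
  have h := (ArithmeticFunction.sum_eq_iff_sum_mul_moebius_eq (R := ℝ) (f := fun n => (n.totient : ℝ)) (g := fun n => (n:ℝ))).1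
    (fun n hn => by exact_mod_cast congrArg (Nat.cast (R := ℝ)) (Nat.sum_totient n)) K (Nat.pos_of_ne_zero hK)
  rw [← h, Nat.sum_divisorsAntidiagonal (fun i j => (ArithmeticFunction.moebius i : ℝ) * (j:ℝ)), Finset.sum_div]
  refine Finset.sum_congr rfl fun e he => ?_
  have hd := Nat.dvd_of_mem_divisors he
  have he0 : (e:ℝ) ≠ 0 := by exact_mod_cast (Nat.pos_of_mem_divisors he).ne'
  have hK' : (K:ℝ) ≠ 0 := by exact_mod_cast hK
  rw [Nat.cast_div hd he0]; field_simp

noncomputable def sqf (v : ℕ → ℝ) (n : ℕ) : ℝ := if Squarefree n then ∏ p ∈ n.primeFactors, v p else 0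

lemma sqf_mul (v : ℕ → ℝ) {m n : ℕ} (h : m.Coprime n) : sqf v (m * n) = sqf v m * sqf v n := by
  unfold sqf
  rw [h.primeFactors_mul, Finset.prod_union h.disjoint_primeFactors]
  by_cases h1 : Squarefree m <;> by_cases h2 : Squarefree n <;> simp [h1, h2, Nat.squarefree_mul h]

lemma sqf_hasProd (v : ℕ → ℝ) (hs : Summable (fun n => |sqf v n|)) :
    HasProd (fun p : Nat.Primes => 1 + v p) (∑' n, sqf v n) := by
  have h := EulerProduct.eulerProduct_hasProd (f := sqf v) (by simp [sqf]) (fun h => sqf_mul v h) hs (by simp [sqf])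
  refine h.congr_fun fun p => ?_
  have hp := p.2
  rw [tsum_eq_sum (s := {0, 1})]
  · rw [Finset.sum_pair (by norm_num)]
    simp [sqf, hp.squarefree, hp.primeFactors, Nat.Prime.primeFactors, Nat.prime_iff.1 hp |>.squarefree]
  · intro e he
    simp only [mem_insert, mem_singleton, not_or] at he
    have : ¬ Squarefree ((p:ℕ) ^ e) := by
      intro hsq
      rcases (Nat.squarefree_pow_iff hp.ne_one he.1).1 hsq with ⟨_, h⟩
      exact he.2 h
    simp [sqf, this]

lemma hasProd_fin (F : ℕ → ℝ) (K : ℕ) (hK : K ≠ 0) :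
    HasProd (fun p : Nat.Primes => if (p:ℕ) ∣ K then F p else 1) (∏ p ∈ K.primeFactors, F p) := by
  have h := hasProd_prod_of_ne_finset_one (f := ({p : ℕ | p.Prime} : Set ℕ).mulIndicator (fun p : ℕ => if p ∣ K then F p else 1))
    (s := K.primeFactors) (L := SummationFilter.unconditional _) (fun p hp => by
      by_cases h1 : p.Prime
      · rw [Nat.mem_primeFactors] at hp
        rw [Set.mulIndicator_of_mem (show p ∈ {p : ℕ | p.Prime} from h1), if_neg]
        exact fun h => hp ⟨h1, h, hK⟩
      · exact Set.mulIndicator_of_notMem (show p ∉ {p : ℕ | p.Prime} from h1) _)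
  rw [← hasProd_subtype_iff_mulIndicator] at h
  have e : ∏ b ∈ K.primeFactors, ({p : ℕ | p.Prime} : Set ℕ).mulIndicator (fun p : ℕ => if p ∣ K then F p else 1) b = ∏ p ∈ K.primeFactors, F p := by
    refine Finset.prod_congr rfl fun p hp => ?_
    rw [Set.mulIndicator_of_mem (show p ∈ {p : ℕ | p.Prime} from Nat.prime_of_mem_primeFactors hp), if_pos (Nat.dvd_of_mem_primeFactors hp)]
  rw [e] at h
  exact h

lemma zeta2_hasProd : HasProd (fun p : Nat.Primes => (1 - ((p:ℕ):ℝ)⁻¹ ^ 2)⁻¹) (Real.pi ^ 2 / 6) := by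
  have h := riemannZeta_eulerProduct_hasProd (s := 2) (by norm_num)
  rw [riemannZeta_two] at h
  have h2 : HasProd (fun p : Nat.Primes => (((1 - ((p:ℕ):ℝ)⁻¹ ^ 2)⁻¹ : ℝ) : ℂ)) ((Real.pi ^ 2 / 6 : ℝ) : ℂ) := by
    have e : ((Real.pi ^ 2 / 6 : ℝ) : ℂ) = (Real.pi:ℂ) ^ 2 / 6 := by push_cast; rfl
    rw [e]
    refine h.congr_fun fun p => ?_
    push_cast
    rw [Complex.cpow_neg, Complex.cpow_ofNat, inv_pow]
  rw [HasProd] at h2 ⊢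
  have h3 := (Complex.continuous_re.tendsto _).comp h2
  rw [Complex.ofReal_re] at h3
  refine h3.congr fun s => ?_
  simp only [Function.comp]
  rw [← Complex.ofReal_prod, Complex.ofReal_re]
end

section
open Finset

lemma mu_abs_le (n : ℕ) : |((ArithmeticFunction.moebius n : ℤ) : ℝ)| ≤ 1 := by
  have : |ArithmeticFunction.moebius n| ≤ 1 := ArithmeticFunction.abs_moebius_le_one
  exact_mod_cast this

noncomputable def ac (K r : ℕ) : ℝ := if Nat.Coprime r K then (ArithmeticFunction.moebius r : ℝ) else 0

lemma ac_abs_le (K r : ℕ) : |ac K r| ≤ 1 := by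
  unfold ac; split_ifs
  · exact mu_abs_le r
  · simp

lemma sqf_mu (v : ℕ → ℝ) (N n : ℕ) (hN : N ≠ 0) :
    sqf (fun p => if p ∣ N then 0 else - v p) n = ac N n * sqf v n := by
  unfold sqf ac
  by_cases hn : Squarefree n
  · simp only [hn, if_true]
    by_cases hc : Nat.Coprime n N
    · rw [if_pos hc, ArithmeticFunction.moebius_apply_of_squarefree hn]
      rw [← (ArithmeticFunction.cardDistinctFactors_eq_cardFactors_iff_squarefree hn.ne_zero).2 hn,
        ArithmeticFunction.cardDistinctFactors_apply]
      have : (n.primeFactorsList.dedup.length) = n.primeFactors.card := rfl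
      rw [this]
      push_cast
      rw [← Finset.prod_const, ← Finset.prod_mul_distrib]
      refine Finset.prod_congr rfl fun p hp => ?_
      have hpp := Nat.prime_of_mem_primeFactors hp
      rw [if_neg]
      · ring
      · intro h
        exact hpp.one_lt.ne' (Nat.dvd_one.1 (hc ▸ Nat.dvd_gcd (Nat.dvd_of_mem_primeFactors hp) h))
    · rw [if_neg hc, zero_mul]
      obtain ⟨p, hp, h1, h2⟩ := Nat.Prime.not_coprime_iff_dvd.1 hc
      exact Finset.prod_eq_zero (Nat.mem_primeFactors.2 ⟨hp, h1, hn.ne_zero⟩) (by simp [h2])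
  · simp [hn]

lemma sqf_inv_sq {n : ℕ} (hn : Squarefree n) : sqf (fun p => ((p:ℝ))⁻¹ ^ 2) n = 1 / (n:ℝ) ^ 2 := by
  unfold sqf
  rw [if_pos hn, Finset.prod_pow, Finset.prod_inv_distrib]
  have : (∏ p ∈ n.primeFactors, (p:ℝ)) = n := by
    rw [← Nat.cast_prod, Nat.prod_primeFactors_of_squarefree hn]
  rw [this]; simp

lemma ac_zero_of_not {K n : ℕ} (hn : ¬ Squarefree n) : ac K n = 0 := by
  unfold ac; rw [ArithmeticFunction.moebius_eq_zero_of_not_squarefree hn]; simp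

lemma inv_sq_lt {p : ℕ} (hp : 2 ≤ p) : ((p:ℝ))⁻¹ ^ 2 < 1 := by
  have : (2:ℝ) ≤ p := by exact_mod_cast hp
  rw [inv_pow]; exact inv_lt_one_of_one_lt₀ (by nlinarith)

lemma summable_ac_sq (K : ℕ) : Summable (fun r : ℕ => ac K r / (r:ℝ) ^ 2) := by
  refine Summable.of_norm_bounded summable_inv_sq fun r => ?_
  rw [Real.norm_eq_abs, abs_div, abs_of_nonneg (by positivity : (0:ℝ) ≤ (r:ℝ) ^ 2)]
  gcongr
  exact ac_abs_le K r

lemma tsum_ac (K : ℕ) (hK : K ≠ 0) : ∑' r : ℕ, ac K r / (r:ℝ) ^ 2 = Cq K := by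
  have e : ∀ n, sqf (fun p => if p ∣ K then 0 else - ((p:ℝ))⁻¹ ^ 2) n = ac K n / (n:ℝ) ^ 2 := by
    intro n
    rw [sqf_mu (fun p => ((p:ℝ))⁻¹ ^ 2) K n hK]
    by_cases hn : Squarefree n
    · rw [sqf_inv_sq hn]; ring
    · rw [ac_zero_of_not hn]; simp
  have h := sqf_hasProd (fun p => if p ∣ K then 0 else - ((p:ℝ))⁻¹ ^ 2)
    (by simp_rw [e]; exact (summable_ac_sq K).abs)
  rw [tsum_congr e] at h
  have h2 := h.mul zeta2_hasProd
  have h3 := hasProd_fin (fun p => (1 - ((p : ℝ))⁻¹ ^ 2)⁻¹) K hK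
  have h4 := h2.unique (h3.congr_fun fun p => by
    have := inv_sq_lt p.2.two_le
    split_ifs with hd
    · simp
    · have : (1 - ((p:ℕ):ℝ)⁻¹ ^ 2) ≠ 0 := by linarith
      rw [← sub_eq_add_neg, mul_inv_cancel₀ this])
  rw [Cq, ← h4]
  have := Real.pi_pos
  field_simp

lemma tot_div (K : ℕ) (hK : K ≠ 0) : (K.totient : ℝ) / K = ∏ p ∈ K.primeFactors, (1 - (p:ℝ)⁻¹) := by
  have := Nat.totient_eq_mul_prod_factors K
  have h : (K.totient : ℝ) = K * ∏ p ∈ K.primeFactors, (1 - (p:ℝ)⁻¹) := by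
    have h2 := congrArg (Rat.cast (K := ℝ)) this
    push_cast at h2
    exact h2
  rw [h]; field_simp

noncomputable def kap (K : ℕ) : ℝ := (K.totient : ℝ) / K * Cq K

lemma kap_eq (K : ℕ) (hK : K ≠ 0) : kap K = 6 / Real.pi ^ 2 * ∏ p ∈ K.primeFactors, (1 + (p:ℝ)⁻¹)⁻¹ := by
  rw [kap, Cq, tot_div K hK, mul_left_comm, ← Finset.prod_mul_distrib]
  congr 1
  refine Finset.prod_congr rfl fun p hp => ?_
  have hp2 : (2:ℝ) ≤ p := by exact_mod_cast (Nat.prime_of_mem_primeFactors hp).two_le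
  have h1 : (p:ℝ)⁻¹ < 1 := inv_lt_one_of_one_lt₀ (by linarith)
  have h0 : 0 < (p:ℝ)⁻¹ := by positivity
  have : (1 - (p:ℝ)⁻¹ ^ 2) = (1 - (p:ℝ)⁻¹) * (1 + (p:ℝ)⁻¹) := by ring
  rw [this, mul_inv, ← mul_assoc, mul_inv_cancel₀ (by linarith), one_mul]

lemma tsum_mult (d : ℕ) (hd : d ≠ 0) (h : ℕ → ℝ) : ∑' g, (if d ∣ g then h g else 0) = ∑' f, h (d * f) := by
  have hi : Function.Injective (fun f : ℕ => d * f) := fun a b hab => Nat.eq_of_mul_eq_mul_left (Nat.pos_of_ne_zero hd) hab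
  rw [← hi.tsum_eq (f := fun g => if d ∣ g then h g else 0)]
  · simp
  · intro g hg
    rw [Function.mem_support] at hg
    by_cases hdg : d ∣ g
    · obtain ⟨k, rfl⟩ := hdg; exact ⟨k, rfl⟩
    · simp [hdg] at hg

lemma summable_bet (Z : ℝ) (hZ : 0 ≤ Z) : Summable (fun f : ℕ => bet (Z / (f:ℝ) ^ 2)) := summable_BB hZ

noncomputable def DD (K : ℕ) (Z : ℝ) : ℝ := ∑' f : ℕ, if Nat.Coprime f K then bet (Z / (f:ℝ) ^ 2) else 0

lemma DD_eq (K : ℕ) (hK : K ≠ 0) (Z : ℝ) (hZ : 0 ≤ Z) :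
    DD K Z = ∑ e ∈ K.divisors, (ArithmeticFunction.moebius e : ℝ) * BB (Z / (e:ℝ) ^ 2) := by
  have h1 : ∀ f : ℕ, (if Nat.Coprime f K then bet (Z / (f:ℝ) ^ 2) else 0) =
      ∑ e ∈ K.divisors, (if e ∣ f then (ArithmeticFunction.moebius e : ℝ) * bet (Z / (f:ℝ) ^ 2) else 0) := by
    intro f
    have := congrArg (Int.cast (R := ℝ)) (sum_mu_gcd f K hK)
    push_cast at this
    have h2 : (if Nat.Coprime f K then bet (Z / (f:ℝ) ^ 2) else 0) = (if Nat.Coprime f K then (1:ℝ) else 0) * bet (Z / (f:ℝ) ^ 2) := by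
      split_ifs <;> simp
    rw [h2, ← this, Finset.sum_mul]
    refine Finset.sum_congr rfl fun e _ => by split_ifs <;> simp
  rw [DD, tsum_congr h1, Summable.tsum_finsetSum]
  · refine Finset.sum_congr rfl fun e he => ?_
    have he0 : e ≠ 0 := (Nat.pos_of_mem_divisors he).ne'
    rw [tsum_mult e he0 (fun f => (ArithmeticFunction.moebius e : ℝ) * bet (Z / (f:ℝ) ^ 2)), tsum_mul_left, BB]
    congr 2; ext f; congr 1
    push_cast
    rw [mul_pow, div_div]
  · intro e he
    refine Summable.of_norm_bounded (summable_bet Z hZ) fun f => ?_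
    have hb := bet_nonneg (Z / (f:ℝ) ^ 2)
    split_ifs
    · rw [norm_mul, Real.norm_eq_abs, Real.norm_of_nonneg hb]
      nlinarith [mu_abs_le e]
    · simpa using hb

noncomputable def PP (K : ℕ) (Z : ℝ) : ℝ := ∑' g : ℕ, if Squarefree g ∧ Nat.Coprime g K then bet (Z / (g:ℝ) ^ 2) else 0

lemma PP_eq (K : ℕ) (hK : K ≠ 0) (Z : ℝ) (hZ : 0 ≤ Z) : PP K Z = ∑' r : ℕ, ac K r * DD K (Z / (r:ℝ) ^ 4) := by
  set F : ℕ → ℝ := fun g => if Nat.Coprime g K then bet (Z / (g:ℝ) ^ 2) else 0 with hF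
  have hF0 : F 0 = 0 := by simp [hF, bet_zero]
  have hFn : ∀ g, 0 ≤ F g := fun g => by simp only [hF]; split_ifs <;> [exact bet_nonneg _; exact le_refl _]
  have hFle : ∀ g, F g ≤ Z / (g:ℝ) ^ 2 := fun g => by
    have h2 : bet (Z / (g:ℝ) ^ 2) ≤ Z / (g:ℝ) ^ 2 := (bet_le_abs _).trans (abs_of_nonneg (by positivity)).le
    simp only [hF]; split_ifs
    · exact h2
    · positivity
  set T : ℕ → ℕ → ℝ := fun r g => if r ^ 2 ∣ g then (ArithmeticFunction.moebius r : ℝ) * F g else 0 with hT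
  have hTr : ∀ r g, |T r g| ≤ if r ^ 2 ∣ g then (if r = 0 then 0 else Z / (g:ℝ) ^ 2) else 0 := by
    intro r g
    simp only [hT]
    by_cases hr : r = 0
    · subst hr; simp
    · rw [if_neg hr]
      split_ifs
      · rw [abs_mul, abs_of_nonneg (hFn g)]
        nlinarith [mu_abs_le r, hFn g, hFle g, abs_nonneg ((ArithmeticFunction.moebius r : ℝ))]
      · simp
  have hsum : Summable (Function.uncurry T) := by
    refine Summable.of_norm_bounded (g := fun x : ℕ × ℕ => if x.1 ^ 2 ∣ x.2 then (if x.1 = 0 then 0 else Z / (x.2:ℝ) ^ 2) else 0) ?_ (fun x => hTr x.1 x.2)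
    rw [summable_prod_of_nonneg]
    · constructor
      · intro r
        refine Summable.of_nonneg_of_le (f := fun g : ℕ => Z * (1 / (g:ℝ) ^ 2)) ?_ ?_ (summable_inv_sq.mul_left Z)
        · intro g; simp only []; split_ifs <;> positivity
        · intro g; simp only []; split_ifs
          · positivity
          · exact le_of_eq (by ring)
          · positivity
      · have : ∀ r : ℕ, (∑' g : ℕ, if r ^ 2 ∣ g then (if r = 0 then 0 else Z / (g:ℝ) ^ 2) else 0) = (1 / (r:ℝ) ^ 4) * (Z * ∑' f : ℕ, 1 / (f:ℝ) ^ 2) := by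
          intro r
          by_cases hr : r = 0
          · subst hr; simp
          · rw [tsum_mult (r ^ 2) (by positivity), ← tsum_mul_left, ← tsum_mul_left]
            congr 1; ext f; rw [if_neg hr]; push_cast; field_simp
        simp_rw [this]
        exact (Real.summable_one_div_nat_pow.2 (by norm_num)).mul_right _
    · intro x; simp only [Pi.zero_apply]; split_ifs <;> positivity
  have hmain : ∀ g : ℕ, (if Squarefree g ∧ Nat.Coprime g K then bet (Z / (g:ℝ) ^ 2) else 0) = ∑' r, T r g := by
    intro g
    by_cases hg : g = 0
    · subst hg
      have : ∀ r, T r 0 = 0 := fun r => by simp [hT, hF0]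
      simp [this]
    · rw [tsum_eq_sum (s := Finset.range (g + 1))]
      · have := congrArg (Int.cast (R := ℝ)) (sum_mu_sq g hg (Finset.range (g+1)) (fun r hr => by
          rw [Finset.mem_range, Nat.lt_succ_iff]
          exact (Nat.le_self_pow two_ne_zero r).trans (Nat.le_of_dvd (Nat.pos_of_ne_zero hg) hr)))
        push_cast at this
        have e : ∑ r ∈ Finset.range (g+1), T r g = (∑ r ∈ Finset.range (g+1), (if r ^ 2 ∣ g then (ArithmeticFunction.moebius r : ℝ) else 0)) * F g := by
          rw [Finset.sum_mul]; refine Finset.sum_congr rfl fun r _ => ?_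
          simp only [hT]; split_ifs <;> simp
        rw [e, this]
        by_cases hs : Squarefree g
        · have : ((ArithmeticFunction.moebius g : ℤ) : ℝ) ^ 2 = 1 := by
            exact_mod_cast ArithmeticFunction.moebius_sq_eq_one_of_squarefree hs
          rw [this, one_mul]
          simp only [hs, hF, true_and]
        · simp [hs, ArithmeticFunction.moebius_eq_zero_of_not_squarefree hs]
      · intro r hr
        rw [Finset.mem_range, not_lt] at hr
        simp only [hT]; rw [if_neg]
        intro h
        have h1 := (Nat.le_self_pow two_ne_zero r).trans (Nat.le_of_dvd (Nat.pos_of_ne_zero hg) h)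
        omega
  rw [PP, tsum_congr hmain]
  rw [Summable.tsum_comm hsum]
  refine tsum_congr fun r => ?_
  by_cases hr : r = 0
  · subst hr; simp [hT, ac]
  · simp only [hT]
    rw [tsum_mult (r ^ 2) (by positivity), tsum_mul_left, ac]
    by_cases hc : Nat.Coprime r K
    · rw [if_pos hc, DD]
      congr 2; ext f
      simp only [hF]
      have : Nat.Coprime (r ^ 2 * f) K ↔ Nat.Coprime f K := by
        rw [Nat.coprime_mul_iff_left]
        exact ⟨fun h => h.2, fun h => ⟨hc.pow_left 2, h⟩⟩
      simp only [this]
      congr 2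
      push_cast; rw [div_div]; congr 1; ring
    · rw [if_neg hc, zero_mul]
      have : ∀ f, F (r ^ 2 * f) = 0 := by
        intro f
        simp only [hF]; rw [if_neg]
        intro h
        have := Nat.Coprime.coprime_mul_right h
        exact hc ((Nat.coprime_pow_left_iff (by norm_num) _ _).1 this)
      simp [this]

lemma DD_asymp : ∃ C : ℝ, 0 < C ∧ ∀ K : ℕ, K ≠ 0 → ∀ Z : ℝ, 0 ≤ Z →
    |DD K Z - cst * Real.sqrt Z * ((K.totient : ℝ) / K)| ≤ C * (K.divisors.card) * Z ^ ((1:ℝ)/3) := by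
  obtain ⟨C, hC, h⟩ := BB_asymp
  refine ⟨C, hC, fun K hK Z hZ => ?_⟩
  rw [DD_eq K hK Z hZ, ← sum_mu_div K hK, Finset.mul_sum, ← Finset.sum_sub_distrib]
  refine (Finset.abs_sum_le_sum_abs _ _).trans ?_
  have : C * (K.divisors.card) * Z ^ ((1:ℝ)/3) = ∑ e ∈ K.divisors, C * Z ^ ((1:ℝ)/3) := by
    rw [Finset.sum_const, nsmul_eq_mul]; ring
  rw [this]
  refine Finset.sum_le_sum fun e he => ?_
  have he0 : (1:ℝ) ≤ e := by exact_mod_cast Nat.pos_of_mem_divisors he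
  have hsq : Real.sqrt (Z / (e:ℝ) ^ 2) = Real.sqrt Z / e := by
    rw [Real.sqrt_div hZ, Real.sqrt_sq (by linarith)]
  have h1 := h (Z / (e:ℝ) ^ 2) (by positivity)
  rw [hsq] at h1
  have h2 : (Z / (e:ℝ) ^ 2) ^ ((1:ℝ)/3) ≤ Z ^ ((1:ℝ)/3) := by
    refine Real.rpow_le_rpow (by positivity) (div_le_self hZ (by nlinarith)) (by norm_num)
  have e1 : (ArithmeticFunction.moebius e : ℝ) * BB (Z / (e:ℝ) ^ 2) - cst * Real.sqrt Z * ((ArithmeticFunction.moebius e : ℝ) / e)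
    = (ArithmeticFunction.moebius e : ℝ) * (BB (Z / (e:ℝ) ^ 2) - cst * (Real.sqrt Z / e)) := by ring
  rw [e1, abs_mul]
  have h3 := mu_abs_le e
  calc _ ≤ 1 * (C * (Z / (e:ℝ) ^ 2) ^ ((1:ℝ)/3)) := by gcongr
    _ ≤ _ := by rw [one_mul]; gcongr

lemma PP_asymp : ∃ C : ℝ, 0 < C ∧ ∀ K : ℕ, K ≠ 0 → ∀ Z : ℝ, 0 ≤ Z →
    |PP K Z - cst * Real.sqrt Z * kap K| ≤ C * (K.divisors.card) * Z ^ ((1:ℝ)/3) := by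
  obtain ⟨C, hC, h⟩ := DD_asymp
  set S := ∑' r : ℕ, 1 / (r:ℝ) ^ ((4:ℝ)/3) with hS
  have hs : Summable (fun r : ℕ => 1 / (r:ℝ) ^ ((4:ℝ)/3)) := Real.summable_one_div_nat_rpow.2 (by norm_num)
  have hS0 : 0 ≤ S := tsum_nonneg fun r => by positivity
  refine ⟨C * (S + 1), by positivity, fun K hK Z hZ => ?_⟩
  rw [PP_eq K hK Z hZ, kap, ← tsum_ac K hK]
  have hb : ∀ r : ℕ, ‖ac K r * DD K (Z / (r:ℝ) ^ 4) - (cst * Real.sqrt Z * ((K.totient : ℝ) / K)) * (ac K r / (r:ℝ) ^ 2)‖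
      ≤ (C * (K.divisors.card) * Z ^ ((1:ℝ)/3)) * (1 / (r:ℝ) ^ ((4:ℝ)/3)) := by
    intro r
    rcases Nat.eq_zero_or_pos r with rfl | hr
    · simp [ac]
    have hr1 : (0:ℝ) < r := by exact_mod_cast hr
    have hsq : Real.sqrt (Z / (r:ℝ) ^ 4) = Real.sqrt Z / (r:ℝ) ^ 2 := by
      rw [Real.sqrt_div hZ, show (r:ℝ) ^ 4 = ((r:ℝ) ^ 2) ^ 2 by ring, Real.sqrt_sq (by positivity)]
    have h1 := h K hK (Z / (r:ℝ) ^ 4) (by positivity)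
    rw [hsq, Real.div_rpow hZ (by positivity)] at h1
    have e2 : ((r:ℝ) ^ 4) ^ ((1:ℝ)/3) = (r:ℝ) ^ ((4:ℝ)/3) := by
      rw [← Real.rpow_natCast, ← Real.rpow_mul hr1.le]; norm_num
    rw [e2] at h1
    have e1 : ac K r * DD K (Z / (r:ℝ) ^ 4) - (cst * Real.sqrt Z * ((K.totient : ℝ) / K)) * (ac K r / (r:ℝ) ^ 2)
      = ac K r * (DD K (Z / (r:ℝ) ^ 4) - cst * (Real.sqrt Z / (r:ℝ) ^ 2) * ((K.totient : ℝ) / K)) := by ring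
    rw [e1, norm_mul, Real.norm_eq_abs, Real.norm_eq_abs]
    have h3 := ac_abs_le K r
    calc _ ≤ 1 * (C * (K.divisors.card) * (Z ^ ((1:ℝ)/3) / (r:ℝ) ^ ((4:ℝ)/3))) := by gcongr
      _ = _ := by ring
  have hsum := Summable.of_norm_bounded (hs.mul_left _) hb
  have hm := (summable_ac_sq K).mul_left (cst * Real.sqrt Z * ((K.totient : ℝ) / K))
  have hfull : Summable (fun r : ℕ => ac K r * DD K (Z / (r:ℝ) ^ 4)) := by
    simpa using hsum.add hm
  have := tsum_of_norm_bounded (hs.mul_left (C * (K.divisors.card) * Z ^ ((1:ℝ)/3))).hasSum hb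
  rw [Summable.tsum_sub hfull hm, tsum_mul_left, tsum_mul_left, ← hS, Real.norm_eq_abs] at this
  rw [← mul_assoc]
  refine this.trans ?_
  have : 0 ≤ C * (K.divisors.card) * Z ^ ((1:ℝ)/3) := by positivity
  nlinarith
end

section
open Finset

lemma summable_lcm (s : ℝ) (hs : 1 < s) : Summable (fun x : ℕ × ℕ => 1 / ((Nat.lcm x.1 x.2 : ℕ) : ℝ) ^ s) := by
  have h1 : Summable (fun n : ℕ => 1 / (n:ℝ) ^ s) := Real.summable_one_div_nat_rpow.2 hs
  have hn : ∀ n : ℕ, 0 ≤ 1 / (n:ℝ) ^ s := fun n => by positivity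
  have h2 := h1.mul_of_nonneg (h1.mul_of_nonneg h1 hn hn) hn (fun x => mul_nonneg (hn _) (hn _))
  set ι : ℕ × ℕ → ℕ × ℕ × ℕ := fun x => (Nat.gcd x.1 x.2, x.1 / Nat.gcd x.1 x.2, x.2 / Nat.gcd x.1 x.2) with hι
  have hi : Function.Injective ι := by
    rintro ⟨a, b⟩ ⟨c, d⟩ h
    simp only [hι, Prod.mk.injEq] at h ⊢
    obtain ⟨h1, h2, h3⟩ := h
    have e1 := Nat.mul_div_cancel' (Nat.gcd_dvd_left a b)
    have e2 := Nat.mul_div_cancel' (Nat.gcd_dvd_right a b)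
    have e3 := Nat.mul_div_cancel' (Nat.gcd_dvd_left c d)
    have e4 := Nat.mul_div_cancel' (Nat.gcd_dvd_right c d)
    rw [h2, h1] at e1; rw [h3, h1] at e2
    exact ⟨e1.symm.trans e3, e2.symm.trans e4⟩
  refine (h2.comp_injective hi).congr fun x => ?_
  obtain ⟨a, b⟩ := x
  simp only [hι, Function.comp]
  have : Nat.lcm a b = Nat.gcd a b * ((a / Nat.gcd a b) * (b / Nat.gcd a b)) := by
    rcases Nat.eq_zero_or_pos (Nat.gcd a b) with h | h
    · rw [Nat.gcd_eq_zero_iff] at h; obtain ⟨rfl, rfl⟩ := h; simp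
    · have e1 := Nat.mul_div_cancel' (Nat.gcd_dvd_left a b)
      have e2 := Nat.mul_div_cancel' (Nat.gcd_dvd_right a b)
      have e3 := Nat.gcd_mul_lcm a b
      refine Nat.eq_of_mul_eq_mul_left h ?_
      rw [e3]
      calc a * b = (Nat.gcd a b * (a / Nat.gcd a b)) * (Nat.gcd a b * (b / Nat.gcd a b)) := by rw [e1, e2]
        _ = _ := by ring
  rw [this]
  push_cast
  rw [Real.mul_rpow (by positivity) (by positivity), Real.mul_rpow (by positivity) (by positivity)]
  field_simp

noncomputable def GG (M d1 d2 : ℕ) : ℕ := Nat.gcd (M * d1 ^ 2) (d2 ^ 2)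

noncomputable def Pm (M q : ℕ) (Z : ℝ) : ℝ := ∑' x : ℕ × ℕ, ac q x.1 * ac q x.2 *
    ((GG M x.1 x.2 : ℝ) ^ 2 / ((x.1:ℝ) ^ 2 * (x.2:ℝ) ^ 2)) * bet (Z / (GG M x.1 x.2 : ℝ))

lemma GG_pos {M d1 d2 : ℕ} (h2 : d2 ≠ 0) : 0 < GG M d1 d2 := Nat.gcd_pos_of_pos_right _ (by positivity)

lemma GG_le {M d1 d2 : ℕ} (hM : M ≠ 0) (h2 : d2 ≠ 0) : GG M d1 d2 ≤ M * (Nat.gcd d1 d2) ^ 2 := by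
  have h : GG M d1 d2 ∣ M * (Nat.gcd d1 d2) ^ 2 := by
    unfold GG
    rw [← Nat.pow_gcd_pow, ← Nat.gcd_mul_left]
    exact Nat.gcd_dvd_gcd_of_dvd_right _ (dvd_mul_left _ _)
  refine Nat.le_of_dvd ?_ h
  have := Nat.gcd_pos_of_pos_right d1 (Nat.pos_of_ne_zero h2)
  positivity

/-- `G/(d1^2 d2^2) ≤ M/lcm^2`. -/
lemma GG_div_le {M : ℕ} (hM : M ≠ 0) (d1 d2 : ℕ) :
    (GG M d1 d2 : ℝ) / ((d1:ℝ) ^ 2 * (d2:ℝ) ^ 2) ≤ M * (1 / ((Nat.lcm d1 d2 : ℕ) : ℝ) ^ (2:ℝ)) := by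
  by_cases h1 : d1 = 0
  · subst h1; simp
  by_cases h2 : d2 = 0
  · subst h2; simp
  have hg : (0:ℝ) < Nat.gcd d1 d2 := by exact_mod_cast Nat.gcd_pos_of_pos_right d1 (Nat.pos_of_ne_zero h2)
  have hl : (0:ℝ) < Nat.lcm d1 d2 := by exact_mod_cast Nat.lcm_pos (Nat.pos_of_ne_zero h1) (Nat.pos_of_ne_zero h2)
  have e : (d1:ℝ) * d2 = Nat.gcd d1 d2 * Nat.lcm d1 d2 := by exact_mod_cast (Nat.gcd_mul_lcm d1 d2).symm
  have h3 : (GG M d1 d2 : ℝ) ≤ M * (Nat.gcd d1 d2 : ℝ) ^ 2 := by exact_mod_cast GG_le hM h2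
  rw [← mul_pow, e, Real.rpow_two, div_le_iff₀ (by positivity)]
  refine h3.trans (le_of_eq ?_)
  field_simp

lemma Pm_term_le {M q : ℕ} (hM : M ≠ 0) {Z : ℝ} (hZ : 0 ≤ Z) (d1 d2 : ℕ) :
    |ac q d1 * ac q d2 * ((GG M d1 d2 : ℝ) ^ 2 / ((d1:ℝ) ^ 2 * (d2:ℝ) ^ 2)) * bet (Z / (GG M d1 d2 : ℝ))|
      ≤ Z * M * (1 / ((Nat.lcm d1 d2 : ℕ) : ℝ) ^ (2:ℝ)) := by
  by_cases h2 : d2 = 0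
  · subst h2; simp
  have hG : (0:ℝ) < GG M d1 d2 := by exact_mod_cast GG_pos h2
  have hb : bet (Z / (GG M d1 d2 : ℝ)) ≤ Z / (GG M d1 d2 : ℝ) := (bet_le_abs _).trans (abs_of_nonneg (by positivity)).le
  have hb0 := bet_nonneg (Z / (GG M d1 d2 : ℝ))
  rw [abs_mul, abs_mul, abs_mul, abs_of_nonneg hb0, abs_of_nonneg (a := (GG M d1 d2 : ℝ) ^ 2 / _) (by positivity)]
  calc _ ≤ 1 * 1 * ((GG M d1 d2 : ℝ) ^ 2 / ((d1:ℝ) ^ 2 * (d2:ℝ) ^ 2)) * (Z / (GG M d1 d2 : ℝ)) := by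
        gcongr
        · exact ac_abs_le q d1
        · exact ac_abs_le q d2
    _ = Z * ((GG M d1 d2 : ℝ) / ((d1:ℝ) ^ 2 * (d2:ℝ) ^ 2)) := by field_simp
    _ ≤ Z * (M * (1 / ((Nat.lcm d1 d2 : ℕ) : ℝ) ^ (2:ℝ))) := by gcongr; exact GG_div_le hM d1 d2
    _ = _ := by ring

lemma Pm_summable {M q : ℕ} (hM : M ≠ 0) {Z : ℝ} (hZ : 0 ≤ Z) : Summable (fun x : ℕ × ℕ => ac q x.1 * ac q x.2 *
    ((GG M x.1 x.2 : ℝ) ^ 2 / ((x.1:ℝ) ^ 2 * (x.2:ℝ) ^ 2)) * bet (Z / (GG M x.1 x.2 : ℝ))) :=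
  Summable.of_norm_bounded ((summable_lcm 2 (by norm_num)).mul_left (Z * M)) fun x => Pm_term_le hM hZ x.1 x.2

noncomputable def cc (N c1 c2 : ℕ) : ℝ :=
  if Nat.Coprime c1 c2 then ac N c1 * ac N c2 / ((c1:ℝ) ^ 2 * (c2:ℝ) ^ 2) else 0

lemma cc_abs_le (N c1 c2 : ℕ) : |cc N c1 c2| ≤ 1 / (c1:ℝ) ^ 2 * (1 / (c2:ℝ) ^ 2) := by
  unfold cc; split_ifs
  · rw [abs_div, abs_mul, abs_of_nonneg (a := (c1:ℝ) ^ 2 * _) (by positivity), div_mul_div_comm]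
    gcongr
    · exact ac_abs_le N c1
    · exact ac_abs_le N c2
  · simp; positivity

structure Cnd (M q a1 a2 g c1 c2 : ℕ) : Prop where
  a1d : a1 ∣ M
  a2d : a2 ∣ M
  a1s : Squarefree a1
  a2s : Squarefree a2
  gs : Squarefree g
  c1s : Squarefree c1
  c2s : Squarefree c2
  gc1 : Nat.Coprime g c1
  gc2 : Nat.Coprime g c2
  cc' : Nat.Coprime c1 c2
  gM : Nat.Coprime g M
  c1M : Nat.Coprime c1 M
  c2M : Nat.Coprime c2 M
  gq : Nat.Coprime g q
  c1q : Nat.Coprime c1 q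
  c2q : Nat.Coprime c2 q

lemma GG_cnd {M q a1 a2 g c1 c2 : ℕ} (h : Cnd M q a1 a2 g c1 c2) :
    GG M (a1 * (g * c1)) (a2 * (g * c2)) = GG M a1 a2 * g ^ 2 := by
  have e1 : M * (a1 * (g * c1)) ^ 2 = (M * a1 ^ 2 * c1 ^ 2) * g ^ 2 := by ring
  have e2 : (a2 * (g * c2)) ^ 2 = (a2 ^ 2 * c2 ^ 2) * g ^ 2 := by ring
  unfold GG
  rw [e1, e2, Nat.gcd_mul_right]
  congr 1
  have h1 : Nat.Coprime (c1 ^ 2) (a2 ^ 2 * c2 ^ 2) := by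
    refine Nat.Coprime.mul_right ?_ ?_
    · exact Nat.Coprime.pow _ _ (h.c1M.coprime_dvd_right h.a2d)
    · exact Nat.Coprime.pow _ _ h.cc'
  have h2 : Nat.Coprime (c2 ^ 2) (M * a1 ^ 2) := by
    refine Nat.Coprime.mul_right (h.c2M.pow_left 2) (Nat.Coprime.pow _ _ (h.c2M.coprime_dvd_right h.a1d))
  rw [Nat.Coprime.gcd_mul_right_cancel _ h1, Nat.Coprime.gcd_mul_right_cancel_right _ h2]

lemma ac_cnd {M q a1 g c1 : ℕ} (hMq : Nat.Coprime M q) (a1d : a1 ∣ M) (gc : Nat.Coprime g c1)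
    (gM : Nat.Coprime g M) (cM : Nat.Coprime c1 M) (gq : Nat.Coprime g q) (cq : Nat.Coprime c1 q) :
    ac q (a1 * (g * c1)) = (ArithmeticFunction.moebius a1 : ℝ) * (ArithmeticFunction.moebius g : ℝ) * (ArithmeticFunction.moebius c1 : ℝ) := by
  unfold ac
  rw [if_pos (Nat.Coprime.mul_left (hMq.coprime_dvd_left a1d) (Nat.Coprime.mul_left gq cq))]
  have h1 : Nat.Coprime a1 (g * c1) := (Nat.Coprime.mul_left gM cM).symm.coprime_dvd_left a1d
  rw [ArithmeticFunction.isMultiplicative_moebius.map_mul_of_coprime h1,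
    ArithmeticFunction.isMultiplicative_moebius.map_mul_of_coprime gc]
  push_cast; ring

lemma fiber_eq {M q : ℕ} (hM : M ≠ 0) (hq : q ≠ 0) (hMq : Nat.Coprime M q) {Z : ℝ} (hZ : 0 ≤ Z) (a1 a2 : ℕ) (h1 : a1 ∣ M) (h2 : a2 ∣ M) :
    ∑' x : ℕ × ℕ, (if Nat.gcd x.1 M = a1 ∧ Nat.gcd x.2 M = a2 then ac q x.1 * ac q x.2 *
    ((GG M x.1 x.2 : ℝ) ^ 2 / ((x.1:ℝ) ^ 2 * (x.2:ℝ) ^ 2)) * bet (Z / (GG M x.1 x.2 : ℝ)) else 0) =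
    (ArithmeticFunction.moebius a1 : ℝ) * (ArithmeticFunction.moebius a2 : ℝ) * ((GG M a1 a2 : ℝ) ^ 2 / ((a1:ℝ) ^ 2 * (a2:ℝ) ^ 2)) *
      ∑' c : ℕ × ℕ, cc (M * q) c.1 c.2 * PP (c.1 * c.2 * (M * q)) (Z / (GG M a1 a2 : ℝ)) := by
  have ha1 : a1 ≠ 0 := by rintro rfl; simp at h1; exact hM h1
  have ha2 : a2 ≠ 0 := by rintro rfl; simp at h2; exact hM h2
  have hγ : (0:ℝ) < GG M a1 a2 := by exact_mod_cast GG_pos ha2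
  set A : ℝ := (ArithmeticFunction.moebius a1 : ℝ) * (ArithmeticFunction.moebius a2 : ℝ) * ((GG M a1 a2 : ℝ) ^ 2 / ((a1:ℝ) ^ 2 * (a2:ℝ) ^ 2)) with hA
  set f : ℕ × ℕ → ℝ := fun x => (if Nat.gcd x.1 M = a1 ∧ Nat.gcd x.2 M = a2 then ac q x.1 * ac q x.2 *
    ((GG M x.1 x.2 : ℝ) ^ 2 / ((x.1:ℝ) ^ 2 * (x.2:ℝ) ^ 2)) * bet (Z / (GG M x.1 x.2 : ℝ)) else 0) with hf
  set R : (ℕ × ℕ) × ℕ → ℝ := fun y => A * (cc (M * q) y.1.1 y.1.2 *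
    (if Squarefree y.2 ∧ Nat.Coprime y.2 (y.1.1 * y.1.2 * (M * q)) then bet (Z / (GG M a1 a2 : ℝ) / (y.2:ℝ) ^ 2) else 0)) with hR
  set i : (ℕ × ℕ) × ℕ → ℕ × ℕ := fun y => (a1 * (y.2 * y.1.1), a2 * (y.2 * y.1.2)) with hi
  have key : ∀ y : (ℕ × ℕ) × ℕ, Cnd M q a1 a2 y.2 y.1.1 y.1.2 → f (i y) = R y := by
    rintro ⟨⟨c1, c2⟩, g⟩ h
    simp only [hf, hi, hR] at h ⊢
    have hg1 : Nat.gcd (a1 * (g * c1)) M = a1 := by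
      rw [Nat.Coprime.gcd_mul_right_cancel _ (Nat.Coprime.mul_left h.gM h.c1M), Nat.gcd_eq_left h1]
    have hg2 : Nat.gcd (a2 * (g * c2)) M = a2 := by
      rw [Nat.Coprime.gcd_mul_right_cancel _ (Nat.Coprime.mul_left h.gM h.c2M), Nat.gcd_eq_left h2]
    have hcop : Nat.Coprime g (c1 * c2 * (M * q)) :=
      Nat.Coprime.mul_right (Nat.Coprime.mul_right h.gc1 h.gc2) (Nat.Coprime.mul_right h.gM h.gq)
    rw [if_pos ⟨hg1, hg2⟩, if_pos ⟨h.gs, hcop⟩, GG_cnd h, ac_cnd hMq h.a1d h.gc1 h.gM h.c1M h.gq h.c1q,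
      ac_cnd hMq h.a2d h.gc2 h.gM h.c2M h.gq h.c2q, cc, if_pos h.cc', ac, ac,
      if_pos (Nat.Coprime.mul_right h.c1M h.c1q), if_pos (Nat.Coprime.mul_right h.c2M h.c2q)]
    have hmu : ((ArithmeticFunction.moebius g : ℤ) : ℝ) ^ 2 = 1 := by
      exact_mod_cast ArithmeticFunction.moebius_sq_eq_one_of_squarefree h.gs
    push_cast
    rw [div_div Z]
    have hg0 : (g:ℝ) ≠ 0 := by exact_mod_cast h.gs.ne_zero
    have hc1 : (c1:ℝ) ≠ 0 := by exact_mod_cast h.c1s.ne_zero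
    have hc2 : (c2:ℝ) ≠ 0 := by exact_mod_cast h.c2s.ne_zero
    have ha1' : (a1:ℝ) ≠ 0 := by exact_mod_cast ha1
    have ha2' : (a2:ℝ) ≠ 0 := by exact_mod_cast ha2
    generalize bet (Z / ((GG M a1 a2 : ℝ) * (g:ℝ) ^ 2)) = b
    rw [hA]
    field_simp
    linear_combination (((ArithmeticFunction.moebius a1 : ℤ) : ℝ) * ((ArithmeticFunction.moebius c1 : ℤ) : ℝ) * ((ArithmeticFunction.moebius a2 : ℤ) : ℝ) * ((ArithmeticFunction.moebius c2 : ℤ) : ℝ) * b) * hmu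
  have hsup : ∀ y : (ℕ × ℕ) × ℕ, R y ≠ 0 → Cnd M q a1 a2 y.2 y.1.1 y.1.2 := by
    rintro ⟨⟨c1, c2⟩, g⟩ h
    simp only [hR] at h ⊢
    have hAne := left_ne_zero_of_mul h
    have h' := right_ne_zero_of_mul h
    have hcne := left_ne_zero_of_mul h'
    have hgne := right_ne_zero_of_mul h'
    have hgc : Squarefree g ∧ Nat.Coprime g (c1 * c2 * (M * q)) := by
      by_contra hcon; rw [if_neg hcon] at hgne; exact hgne rfl
    have hc12 : Nat.Coprime c1 c2 := by
      by_contra hcon; rw [cc, if_neg hcon] at hcne; exact hcne rfl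
    rw [cc, if_pos hc12] at hcne
    have hc' := (div_ne_zero_iff.1 hcne).1
    have hac : ∀ c, ac (M * q) c ≠ 0 → Squarefree c ∧ Nat.Coprime c M ∧ Nat.Coprime c q := by
      intro c hc
      have e1 : Squarefree c := by
        by_contra hcon; exact hc (ac_zero_of_not hcon)
      have e2 : Nat.Coprime c (M * q) := by
        by_contra hcon; rw [ac, if_neg hcon] at hc; exact hc rfl
      exact ⟨e1, Nat.Coprime.coprime_mul_right_right e2, Nat.Coprime.coprime_mul_left_right e2⟩
    obtain ⟨x1, x2, x3⟩ := hac c1 (left_ne_zero_of_mul hc')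
    obtain ⟨y1, y2, y3⟩ := hac c2 (right_ne_zero_of_mul hc')
    have hmm := left_ne_zero_of_mul hAne
    have hsq : ∀ a : ℕ, ((ArithmeticFunction.moebius a : ℤ) : ℝ) ≠ 0 → Squarefree a := fun a ha =>
      ArithmeticFunction.moebius_ne_zero_iff_squarefree.1 (by exact_mod_cast ha)
    have z1 : Nat.Coprime g (c1 * c2) := Nat.Coprime.coprime_mul_right_right hgc.2
    have z2 : Nat.Coprime g (M * q) := Nat.Coprime.coprime_mul_left_right hgc.2
    exact ⟨h1, h2, hsq _ (left_ne_zero_of_mul hmm), hsq _ (right_ne_zero_of_mul hmm), hgc.1, x1, y1,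
      Nat.Coprime.coprime_mul_right_right z1, Nat.Coprime.coprime_mul_left_right z1, hc12,
      Nat.Coprime.coprime_mul_right_right z2, x2, y2, Nat.Coprime.coprime_mul_left_right z2, x3, y3⟩
  have hreidx : ∑' x, f x = ∑' y, R y := by
    refine tsum_eq_tsum_of_ne_zero_bij (fun y : Function.support R => i y.1) ?_ ?_ ?_
    · rintro ⟨⟨⟨c1, c2⟩, g⟩, hy⟩ ⟨⟨⟨d1, d2⟩, g'⟩, hy'⟩ hh
      have A1 := hsup _ hy
      have A2 := hsup _ hy'
      simp only [hi, Prod.mk.injEq] at hh A1 A2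
      have e1 := Nat.eq_of_mul_eq_mul_left (Nat.pos_of_ne_zero ha1) hh.1
      have e2 := Nat.eq_of_mul_eq_mul_left (Nat.pos_of_ne_zero ha2) hh.2
      have eg : g = g' := by
        have u1 : Nat.gcd (g * c1) (g * c2) = g := by rw [Nat.gcd_mul_left, A1.cc'.gcd_eq_one, mul_one]
        have u2 : Nat.gcd (g' * d1) (g' * d2) = g' := by rw [Nat.gcd_mul_left, A2.cc'.gcd_eq_one, mul_one]
        rw [← u1, ← u2, e1, e2]
      subst eg
      have hg0 := Nat.pos_of_ne_zero A1.gs.ne_zero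
      have e3 := Nat.eq_of_mul_eq_mul_left hg0 e1
      have e4 := Nat.eq_of_mul_eq_mul_left hg0 e2
      subst e3; subst e4; rfl
    · rintro ⟨d1, d2⟩ hx
      rw [Function.mem_support] at hx
      have hcond : Nat.gcd d1 M = a1 ∧ Nat.gcd d2 M = a2 := by
        by_contra hcon; simp only [hf] at hx; rw [if_neg hcon] at hx; exact hx rfl
      have hx2 := hx
      simp only [hf] at hx2
      rw [if_pos hcond] at hx2
      have hx3 := left_ne_zero_of_mul (left_ne_zero_of_mul hx2)
      have hac : ∀ c, ac q c ≠ 0 → Squarefree c ∧ Nat.Coprime c q := by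
        intro c hc
        refine ⟨by by_contra hcon; exact hc (ac_zero_of_not hcon), ?_⟩
        by_contra hcon; rw [ac, if_neg hcon] at hc; exact hc rfl
      obtain ⟨s1, k1⟩ := hac d1 (left_ne_zero_of_mul hx3)
      obtain ⟨s2, k2⟩ := hac d2 (right_ne_zero_of_mul hx3)
      obtain ⟨b1, hb1⟩ : a1 ∣ d1 := hcond.1 ▸ Nat.gcd_dvd_left _ _
      obtain ⟨b2, hb2⟩ : a2 ∣ d2 := hcond.2 ▸ Nat.gcd_dvd_left _ _
      have hcopM : ∀ a b d, Squarefree d → Nat.gcd d M = a → d = a * b → Nat.Coprime b M := by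
        intro a b d hd hg hab
        rw [hab, Nat.squarefree_mul_iff] at hd
        by_contra hcon
        obtain ⟨p, hp, u1, u2⟩ := Nat.Prime.not_coprime_iff_dvd.1 hcon
        have : p ∣ a := hg ▸ Nat.dvd_gcd (hab ▸ u1.mul_left a) u2
        exact hp.one_lt.ne' (Nat.dvd_one.1 (hd.1 ▸ Nat.dvd_gcd this u1))
      have cM1 := hcopM a1 b1 d1 s1 hcond.1 hb1
      have cM2 := hcopM a2 b2 d2 s2 hcond.2 hb2
      have b10 : b1 ≠ 0 := by rintro rfl; simp at hb1; exact s1.ne_zero hb1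
      obtain ⟨g, c1, c2, hg, hco, e1, e2⟩ := Nat.exists_coprime' (Nat.gcd_pos_of_pos_left b2 (Nat.pos_of_ne_zero b10))
      rw [mul_comm] at e1 e2
      have s1' := s1; have s2' := s2
      rw [hb1, Nat.squarefree_mul_iff, e1, Nat.squarefree_mul_iff] at s1'
      rw [hb2, Nat.squarefree_mul_iff, e2, Nat.squarefree_mul_iff] at s2'
      have cnd : Cnd M q a1 a2 g c1 c2 := by
        rw [e1] at cM1; rw [e2] at cM2
        have k1' : Nat.Coprime (g * c1) q := k1.coprime_dvd_left (by rw [hb1, e1]; exact dvd_mul_left _ _)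
        have k2' : Nat.Coprime (g * c2) q := k2.coprime_dvd_left (by rw [hb2, e2]; exact dvd_mul_left _ _)
        exact ⟨h1, h2, s1'.2.1, s2'.2.1, s1'.2.2.2.1, s1'.2.2.2.2, s2'.2.2.2.2, s1'.2.2.1, s2'.2.2.1, hco,
          Nat.Coprime.coprime_mul_right cM1, Nat.Coprime.coprime_mul_left cM1, Nat.Coprime.coprime_mul_left cM2,
          Nat.Coprime.coprime_mul_right k1', Nat.Coprime.coprime_mul_left k1', Nat.Coprime.coprime_mul_left k2'⟩
      have hix : i ((c1, c2), g) = (d1, d2) := by simp only [hi]; rw [← e1, ← e2, ← hb1, ← hb2]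
      have := key ((c1, c2), g) cnd
      rw [hix] at this
      exact ⟨⟨((c1, c2), g), by rw [Function.mem_support, ← this]; exact hx⟩, hix⟩
    · rintro ⟨y, hy⟩
      exact key y (hsup y hy)
  rw [hreidx]
  have hRs : Summable R := by
    have hS := (summable_inv_sq.mul_of_nonneg summable_inv_sq (fun n => by simp only [Pi.zero_apply]; positivity) (fun n => by simp only [Pi.zero_apply]; positivity)).mul_of_nonneg (summable_inv_sq.mul_left (Z / (GG M a1 a2 : ℝ))) (fun n => by simp only [Pi.zero_apply]; positivity) (fun n => by simp only [Pi.zero_apply]; positivity)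
    refine Summable.of_norm_bounded (hS.mul_left |A|) ?_
    rintro ⟨⟨c1, c2⟩, g⟩
    simp only [hR, norm_mul, Real.norm_eq_abs]
    have hb : |(if Squarefree g ∧ Nat.Coprime g (c1 * c2 * (M * q)) then bet (Z / (GG M a1 a2 : ℝ) / (g:ℝ) ^ 2) else 0)| ≤ Z / (GG M a1 a2 : ℝ) * (1 / (g:ℝ) ^ 2) := by
      split_ifs
      · rw [abs_of_nonneg (bet_nonneg _)]; exact bet_term_le (by positivity) _
      · simp; positivity
    gcongr
    exact cc_abs_le _ _ _
  rw [hRs.tsum_prod, ← tsum_mul_left]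
  refine tsum_congr fun c => ?_
  simp only [hR]
  rw [tsum_mul_left, tsum_mul_left, PP]

lemma Pm_eq {M q : ℕ} (hM : M ≠ 0) (hq : q ≠ 0) (hMq : Nat.Coprime M q) {Z : ℝ} (hZ : 0 ≤ Z) :
    Pm M q Z = ∑ a1 ∈ M.divisors, ∑ a2 ∈ M.divisors, (ArithmeticFunction.moebius a1 : ℝ) * (ArithmeticFunction.moebius a2 : ℝ) * ((GG M a1 a2 : ℝ) ^ 2 / ((a1:ℝ) ^ 2 * (a2:ℝ) ^ 2)) *
      ∑' c : ℕ × ℕ, cc (M * q) c.1 c.2 * PP (c.1 * c.2 * (M * q)) (Z / (GG M a1 a2 : ℝ)) := by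
  set f : ℕ × ℕ → ℝ := fun x => ac q x.1 * ac q x.2 *
    ((GG M x.1 x.2 : ℝ) ^ 2 / ((x.1:ℝ) ^ 2 * (x.2:ℝ) ^ 2)) * bet (Z / (GG M x.1 x.2 : ℝ)) with hf
  have hfs : Summable f := Pm_summable hM hZ
  have hind : ∀ a1 a2, Summable (fun x : ℕ × ℕ => if Nat.gcd x.1 M = a1 ∧ Nat.gcd x.2 M = a2 then f x else 0) := by
    intro a1 a2
    refine Summable.of_norm_bounded hfs.norm fun x => ?_
    split_ifs
    · exact le_refl _
    · simp
  have h1 : ∀ x, f x = ∑ a1 ∈ M.divisors, ∑ a2 ∈ M.divisors, (if Nat.gcd x.1 M = a1 ∧ Nat.gcd x.2 M = a2 then f x else 0) := by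
    intro x
    have m1 : Nat.gcd x.1 M ∈ M.divisors := Nat.mem_divisors.2 ⟨Nat.gcd_dvd_right _ _, hM⟩
    have m2 : Nat.gcd x.2 M ∈ M.divisors := Nat.mem_divisors.2 ⟨Nat.gcd_dvd_right _ _, hM⟩
    simp_rw [ite_and]
    rw [Finset.sum_eq_single_of_mem _ m1, Finset.sum_eq_single_of_mem _ m2]
    · simp
    · intro b _ hb; simp [hb.symm]
    · intro b _ hb; simp [hb.symm]
  have : Pm M q Z = ∑' x, f x := rfl
  rw [this, tsum_congr h1, Summable.tsum_finsetSum (fun a1 _ => summable_sum fun a2 _ => hind a1 a2)]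
  refine Finset.sum_congr rfl fun a1 ha1 => ?_
  rw [Summable.tsum_finsetSum (fun a2 _ => hind a1 a2)]
  refine Finset.sum_congr rfl fun a2 ha2 => ?_
  exact fiber_eq hM hq hMq hZ a1 a2 (Nat.dvd_of_mem_divisors ha1) (Nat.dvd_of_mem_divisors ha2)
end

section
open Finset

noncomputable def hh (c : ℕ) : ℝ := ∏ p ∈ c.primeFactors, (1 + (p:ℝ)⁻¹)⁻¹

lemma hh_nonneg (c : ℕ) : 0 ≤ hh c := Finset.prod_nonneg fun p _ => by positivity

lemma hh_le (c : ℕ) : hh c ≤ 1 := Finset.prod_le_one (fun p _ => by positivity) fun p _ => by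
  apply inv_le_one_of_one_le₀
  have : (0:ℝ) ≤ (p:ℝ)⁻¹ := by positivity
  linarith

lemma sqf_le (v : ℕ → ℝ) (hv : ∀ p : ℕ, p.Prime → |v p| ≤ ((p:ℝ))⁻¹ ^ 2) (n : ℕ) : |sqf v n| ≤ 1 / (n:ℝ) ^ 2 := by
  by_cases hn : Squarefree n
  · rw [← sqf_inv_sq hn, sqf, sqf, if_pos hn, if_pos hn, Finset.abs_prod]
    exact Finset.prod_le_prod (fun _ _ => abs_nonneg _) fun p hp => hv p (Nat.prime_of_mem_primeFactors hp)
  · rw [sqf, if_neg hn]; simp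

lemma sqf_le_summable (v : ℕ → ℝ) (hv : ∀ p : ℕ, p.Prime → |v p| ≤ ((p:ℝ))⁻¹ ^ 2) : Summable (fun n => |sqf v n|) :=
  Summable.of_nonneg_of_le (fun _ => abs_nonneg _) (sqf_le v hv) summable_inv_sq

noncomputable def vv (p : ℕ) : ℝ := ((p:ℝ))⁻¹ ^ 2 * (1 + (p:ℝ)⁻¹)⁻¹
noncomputable def uu (N p : ℕ) : ℝ := if p ∣ N then 0 else - vv p

lemma vv_nonneg (p : ℕ) : 0 ≤ vv p := by unfold vv; positivity
lemma vv_le (p : ℕ) : vv p ≤ ((p:ℝ))⁻¹ ^ 2 := by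
  unfold vv
  refine mul_le_of_le_one_right (by positivity) (inv_le_one_of_one_le₀ ?_)
  have : (0:ℝ) ≤ (p:ℝ)⁻¹ := by positivity
  linarith
lemma uu_abs (N p : ℕ) : |uu N p| ≤ ((p:ℝ))⁻¹ ^ 2 := by
  unfold uu; split_ifs
  · simp
  · rw [abs_neg, abs_of_nonneg (vv_nonneg p)]; exact vv_le p

lemma prime_inv {p : ℕ} (hp : p.Prime) : ((p:ℝ))⁻¹ ≤ 1/2 ∧ 0 < ((p:ℝ))⁻¹ := by
  have : (2:ℝ) ≤ p := by exact_mod_cast hp.two_le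
  exact ⟨by rw [one_div]; exact inv_anti₀ (by norm_num) this, by positivity⟩

lemma vv_bd {p : ℕ} (hp : p.Prime) : 1 - vv p > 0 ∧ vv p / (1 - vv p) ≤ ((p:ℝ))⁻¹ ^ 2 := by
  obtain ⟨h1, h2⟩ := prime_inv hp
  unfold vv
  set x := ((p:ℝ))⁻¹
  have e : x ^ 2 * (1 + x)⁻¹ = x ^ 2 / (1 + x) := by ring
  have h3 : 1 - x ^ 2 / (1 + x) = (1 + x - x ^ 2) / (1 + x) := by field_simp
  have h4 : 1 ≤ 1 + x - x ^ 2 := by nlinarith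
  rw [e, h3]
  refine ⟨by positivity, ?_⟩
  rw [div_div_div_cancel_right₀ (by positivity), div_le_iff₀ (by positivity)]
  nlinarith [sq_nonneg x]

lemma uu_pos (N : ℕ) {p : ℕ} (hp : p.Prime) : 0 < 1 + uu N p := by
  unfold uu; split_ifs
  · simp
  · have := (vv_bd hp).1; linarith

lemma uu_div (N : ℕ) {p : ℕ} (hp : p.Prime) : |uu N p / (1 + uu N p)| ≤ ((p:ℝ))⁻¹ ^ 2 := by
  unfold uu; split_ifs
  · simp
  · obtain ⟨h1, h2⟩ := vv_bd hp
    rw [← sub_eq_add_neg, neg_div, abs_neg, abs_of_nonneg (div_nonneg (vv_nonneg p) h1.le)]; exact h2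

lemma sqf_uu (N : ℕ) (hN : N ≠ 0) (n : ℕ) : sqf (uu N) n = ac N n / (n:ℝ) ^ 2 * hh n := by
  have : uu N = fun p => if p ∣ N then 0 else - vv p := rfl
  rw [this, sqf_mu _ _ _ hN]
  by_cases hn : Squarefree n
  · have h := sqf_inv_sq hn
    rw [sqf, if_pos hn] at h ⊢
    rw [div_eq_mul_one_div, ← h, hh, mul_assoc, ← Finset.prod_mul_distrib]; rfl
  · rw [ac_zero_of_not hn]; simp

lemma cc_hh (N : ℕ) (hN : N ≠ 0) (c1 c2 : ℕ) : cc N c1 c2 * (hh c1 * hh c2) =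
    if Nat.Coprime c1 c2 then sqf (uu N) c1 * sqf (uu N) c2 else 0 := by
  unfold cc; split_ifs
  · rw [sqf_uu N hN, sqf_uu N hN]; ring
  · simp

lemma sqf_cop (v : ℕ → ℝ) (c1 : ℕ) (hc1 : c1 ≠ 0) (n : ℕ) : (if Nat.Coprime c1 n then sqf v n else 0) = sqf (fun p => if p ∣ c1 then 0 else v p) n := by
  unfold sqf
  by_cases hn : Squarefree n
  · rw [if_pos hn, if_pos hn]
    split_ifs with h
    · refine Finset.prod_congr rfl fun p hp => ?_
      refine (if_neg fun hd => ?_).symm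
      exact (Nat.prime_of_mem_primeFactors hp).one_lt.ne' (Nat.dvd_one.1 (h ▸ Nat.dvd_gcd hd (Nat.dvd_of_mem_primeFactors hp)))
    · obtain ⟨p, hp, u1, u2⟩ := Nat.Prime.not_coprime_iff_dvd.1 h
      symm
      refine Finset.prod_eq_zero (Nat.mem_primeFactors.2 ⟨hp, u2, hn.ne_zero⟩) ?_
      exact if_pos u1
  · simp [hn]

lemma inner_sqf (N : ℕ) (c1 : ℕ) (hc1 : c1 ≠ 0) :
    ∑' n, (if Nat.Coprime c1 n then sqf (uu N) n else 0) = (∑' n, sqf (uu N) n) * ∏ p ∈ c1.primeFactors, (1 + uu N p)⁻¹ := by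
  simp_rw [sqf_cop _ _ hc1]
  have h1 := sqf_hasProd (fun p => if p ∣ c1 then 0 else uu N p) (sqf_le_summable _ fun p hp => by
    split_ifs
    · simp
    · exact uu_abs N p)
  have h2 := (sqf_hasProd (uu N) (sqf_le_summable _ fun p hp => uu_abs N p)).mul (hasProd_fin (fun p => (1 + uu N p)⁻¹) c1 hc1)
  refine h1.unique (h2.congr_fun fun p => ?_)
  split_ifs
  · rw [mul_inv_cancel₀ (uu_pos N p.2).ne']; simp
  · simp

noncomputable def SS (N : ℕ) : ℝ := ∑' c : ℕ × ℕ, cc N c.1 c.2 * (hh c.1 * hh c.2)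

lemma summable_sq2 : Summable (fun c : ℕ × ℕ => 1 / (c.1:ℝ) ^ 2 * (1 / (c.2:ℝ) ^ 2)) :=
  summable_inv_sq.mul_of_nonneg summable_inv_sq (fun n => by simp only [Pi.zero_apply]; positivity) (fun n => by simp only [Pi.zero_apply]; positivity)

lemma cch_summable (N : ℕ) : Summable (fun c : ℕ × ℕ => cc N c.1 c.2 * (hh c.1 * hh c.2)) := by
  refine Summable.of_norm_bounded summable_sq2 fun c => ?_
  rw [Real.norm_eq_abs, abs_mul]
  have h1 : |hh c.1 * hh c.2| ≤ 1 := by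
    rw [abs_of_nonneg (mul_nonneg (hh_nonneg _) (hh_nonneg _))]
    exact mul_le_one₀ (hh_le _) (hh_nonneg _) (hh_le _)
  calc _ ≤ |cc N c.1 c.2| * 1 := by gcongr
    _ ≤ _ := by rw [mul_one]; exact cc_abs_le N _ _

lemma SS_hasProd (N : ℕ) (hN : N ≠ 0) : HasProd (fun p : Nat.Primes => 1 + 2 * uu N p) (SS N) := by
  have e : SS N = (∑' n, sqf (uu N) n) * ∑' n, sqf (fun p => uu N p / (1 + uu N p)) n := by
    unfold SS
    rw [(cch_summable N).tsum_prod, ← tsum_mul_left]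
    refine tsum_congr fun c1 => ?_
    simp_rw [cc_hh N hN]
    by_cases h : Squarefree c1
    · have : ∀ c2, (if Nat.Coprime c1 c2 then sqf (uu N) c1 * sqf (uu N) c2 else 0) = sqf (uu N) c1 * (if Nat.Coprime c1 c2 then sqf (uu N) c2 else 0) := by
        intro c2; split_ifs <;> simp
      simp_rw [this]
      rw [tsum_mul_left, inner_sqf N c1 h.ne_zero]
      simp only [sqf, if_pos h, div_eq_mul_inv]
      rw [Finset.prod_mul_distrib]; ring
    · have : ∀ v, sqf v c1 = 0 := fun v => by simp [sqf, h]
      simp [this]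
  rw [e]
  refine ((sqf_hasProd (uu N) (sqf_le_summable _ fun p hp => uu_abs N p)).mul
    (sqf_hasProd (fun p => uu N p / (1 + uu N p)) (sqf_le_summable _ fun p hp => uu_div N hp))).congr_fun fun p => ?_
  have := (uu_pos N p.2).ne'
  field_simp; ring

noncomputable def Ct : ℝ := ∏' p : Nat.Primes, ((((p : ℕ) : ℝ) ^ 3 - 3 * ((p : ℕ) : ℝ) + 2) / ((p : ℕ) : ℝ) ^ 3)

lemma kap_SS (N : ℕ) (hN : N ≠ 0) : kap N * SS N = Ct * ∏ p ∈ N.primeFactors, ((p:ℝ) ^ 2 / (((p:ℝ) - 1) * ((p:ℝ) + 2))) := by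
  have h1 := zeta2_hasProd.inv₀ (by positivity)
  have h2 := (h1.mul (SS_hasProd N hN)).mul (hasProd_fin (fun p => ((p:ℝ) ^ 3 - 3 * (p:ℝ) + 2) / (p:ℝ) ^ 3 / (1 - ((p:ℝ))⁻¹ ^ 2)) N hN)
  have h3 : HasProd (fun p : Nat.Primes => ((((p : ℕ) : ℝ) ^ 3 - 3 * ((p : ℕ) : ℝ) + 2) / ((p : ℕ) : ℝ) ^ 3)) ((Real.pi ^ 2 / 6)⁻¹ * SS N * ∏ p ∈ N.primeFactors, ((p:ℝ) ^ 3 - 3 * (p:ℝ) + 2) / (p:ℝ) ^ 3 / (1 - ((p:ℝ))⁻¹ ^ 2)) := by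
    refine h2.congr_fun fun p => ?_
    have hp := p.2
    have hp2 : (2:ℝ) ≤ ((p:ℕ):ℝ) := by exact_mod_cast hp.two_le
    have hne : (1 - (((p:ℕ):ℝ))⁻¹ ^ 2) ≠ 0 := by have := inv_sq_lt hp.two_le; linarith
    simp only [uu, inv_inv]
    split_ifs
    · rw [mul_zero, add_zero, mul_one, mul_div_cancel₀ _ hne]
    · unfold vv
      field_simp
      ring
  have h4 : Ct = _ := h3.tprod_eq
  rw [h4, kap_eq N hN, mul_assoc _ _ (∏ p ∈ N.primeFactors, _), ← Finset.prod_mul_distrib, inv_div]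
  have : ∏ p ∈ N.primeFactors, (((p:ℝ) ^ 3 - 3 * (p:ℝ) + 2) / (p:ℝ) ^ 3 / (1 - ((p:ℝ))⁻¹ ^ 2) * ((p:ℝ) ^ 2 / (((p:ℝ) - 1) * ((p:ℝ) + 2)))) = ∏ p ∈ N.primeFactors, (1 + (p:ℝ)⁻¹)⁻¹ := by
    refine Finset.prod_congr rfl fun p hp => ?_
    have hp := Nat.prime_of_mem_primeFactors hp
    have hp2 : (2:ℝ) ≤ (p:ℝ) := by exact_mod_cast hp.two_le
    have e1 : (p:ℝ) ^ 3 - 3 * (p:ℝ) + 2 = ((p:ℝ) - 1) ^ 2 * ((p:ℝ) + 2) := by ring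
    have e2 : 1 - ((p:ℝ))⁻¹ ^ 2 = ((p:ℝ) - 1) * ((p:ℝ) + 1) / (p:ℝ) ^ 2 := by field_simp; ring
    have e3 : (1 + (p:ℝ)⁻¹) = ((p:ℝ) + 1) / p := by field_simp
    rw [e1, e2, e3]
    have : (p:ℝ) - 1 ≠ 0 := by linarith
    field_simp
  rw [this]; ring
end

section
open Finset

lemma prod_add_ite (P : Finset ℕ) (f g : ℕ → ℝ) : ∏ p ∈ P, (f p + g p) = ∑ S ∈ P.powerset, ∏ p ∈ P, (if p ∈ S then f p else g p) := by
  rw [Finset.prod_add]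
  refine Finset.sum_congr rfl fun S hS => ?_
  have hS := Finset.mem_powerset.1 hS
  rw [← Finset.prod_sdiff hS, mul_comm]
  congr 1
  · refine Finset.prod_congr rfl fun p hp => ?_
    rw [if_neg (Finset.mem_sdiff.1 hp).2]
  · refine Finset.prod_congr rfl fun p hp => ?_
    rw [if_pos hp]

lemma gcd_prod_sq (K : ℕ) (S : Finset ℕ) (hS : ∀ p ∈ S, p.Prime) : Nat.gcd K (∏ p ∈ S, p ^ 2) = ∏ p ∈ S, Nat.gcd K (p ^ 2) := by
  induction S using Finset.induction_on with
  | empty => simp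
  | insert a s ha ih =>
    rw [Finset.prod_insert ha, Finset.prod_insert ha, Nat.Coprime.gcd_mul, ih fun p hp => hS p (Finset.mem_insert_of_mem hp)]
    refine Nat.Coprime.prod_right fun p hp => Nat.Coprime.pow _ _ ?_
    exact (Nat.coprime_primes (hS a (Finset.mem_insert_self _ _)) (hS p (Finset.mem_insert_of_mem hp))).2 (by rintro rfl; exact ha hp)

lemma GG_loc (M : ℕ) (hM : M ≠ 0) (S : Finset ℕ) (hS : S ⊆ M.primeFactors) (p : ℕ) (hp : p ∈ M.primeFactors) :
    Nat.gcd (M * (∏ p ∈ S, p) ^ 2) (p ^ 2) = if p ∈ S ∨ p ^ 2 ∣ M then p ^ 2 else p := by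
  have hpp := Nat.prime_of_mem_primeFactors hp
  split_ifs with h
  · refine Nat.gcd_eq_right ?_
    rcases h with h | h
    · exact (pow_dvd_pow_of_dvd (Finset.dvd_prod_of_mem (fun p => p) h) 2).mul_left _
    · exact h.mul_right _
  · push Not at h
    obtain ⟨u, hu⟩ := Nat.dvd_of_mem_primeFactors hp
    have h1 : Nat.Coprime p u := by
      rw [hpp.coprime_iff_not_dvd]
      rintro ⟨w, rfl⟩
      exact h.2 ⟨w, by rw [hu]; ring⟩
    have h2 : Nat.Coprime p (∏ p ∈ S, p) := Nat.Coprime.prod_right fun r hr => by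
      refine (Nat.coprime_primes hpp (Nat.prime_of_mem_primeFactors (hS hr))).2 ?_
      rintro rfl; exact h.1 hr
    rw [hu, sq p, mul_assoc p, Nat.gcd_mul_left]
    have : Nat.Coprime (u * (∏ p ∈ S, p) ^ 2) p := (Nat.Coprime.mul_right h1 (h2.pow_right 2)).symm
    rw [this.gcd_eq_one, mul_one]

noncomputable def Aloc (M p : ℕ) : ℝ :=
  if p ^ 2 ∣ M then (1 - ((p:ℝ))⁻¹ ^ 2) * (1 - p) else 1 - ((p:ℝ))⁻¹ ^ 2 - (p:ℝ) ^ ((3:ℝ)/2) / (p:ℝ) ^ 2 + (p:ℝ)⁻¹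

lemma mu_prod (S : Finset ℕ) (hS : ∀ p ∈ S, p.Prime) : ((ArithmeticFunction.moebius (∏ p ∈ S, p) : ℤ) : ℝ) = ∏ p ∈ S, (-1) := by
  induction S using Finset.induction_on with
  | empty => simp
  | insert a s ha ih =>
    rw [Finset.prod_insert ha, Finset.prod_insert ha, ArithmeticFunction.isMultiplicative_moebius.map_mul_of_coprime,
      Int.cast_mul, ih fun p hp => hS p (Finset.mem_insert_of_mem hp), ArithmeticFunction.moebius_apply_prime (hS a (Finset.mem_insert_self _ _))]
    · simp
    · refine Nat.Coprime.prod_right fun p hp => ?_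
      exact (Nat.coprime_primes (hS a (Finset.mem_insert_self _ _)) (hS p (Finset.mem_insert_of_mem hp))).2 (by rintro rfl; exact ha hp)

lemma sum_div_powerset (M : ℕ) (hM : M ≠ 0) (F : ℕ → ℝ) : ∑ a ∈ M.divisors, (ArithmeticFunction.moebius a : ℝ) * F a =
    ∑ S ∈ M.primeFactors.powerset, (ArithmeticFunction.moebius (∏ p ∈ S, p) : ℝ) * F (∏ p ∈ S, p) := by
  have h := Nat.sum_divisors_filter_squarefree hM (f := fun a => (ArithmeticFunction.moebius a : ℝ) * F a)
  have h2 : ∑ a ∈ M.divisors with Squarefree a, (ArithmeticFunction.moebius a : ℝ) * F a = ∑ a ∈ M.divisors, (ArithmeticFunction.moebius a : ℝ) * F a := by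
    refine Finset.sum_filter_of_ne fun a _ h => ?_
    by_contra hc
    rw [ArithmeticFunction.moebius_eq_zero_of_not_squarefree hc] at h; simp at h
  have h3 : (UniqueFactorizationMonoid.normalizedFactors M).toFinset = M.primeFactors := by
    rw [Nat.factors_eq]; rfl
  rw [← h2, h, h3]
  refine Finset.sum_congr rfl fun S _ => ?_
  have : S.val.prod = ∏ p ∈ S, p := by rw [Finset.prod_eq_multiset_prod, Multiset.map_id']
  rw [this]

noncomputable def tl (M : ℕ) (S1 : Finset ℕ) (p : ℕ) : ℝ := - (((if p ∈ S1 ∨ p ^ 2 ∣ M then p ^ 2 else p : ℕ) : ℝ) ^ ((3:ℝ)/2) / (p:ℝ) ^ 2)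

lemma sq_rpow32 {x : ℝ} (hx : 0 ≤ x) : (x ^ 2) ^ ((3:ℝ)/2) = x ^ 3 := by
  rw [← Real.rpow_natCast x 2, ← Real.rpow_mul hx, ← Real.rpow_natCast x 3]; norm_num

lemma Asum (M : ℕ) (hM : M ≠ 0) : ∑ a1 ∈ M.divisors, ∑ a2 ∈ M.divisors, (ArithmeticFunction.moebius a1 : ℝ) * (ArithmeticFunction.moebius a2 : ℝ) *
    ((GG M a1 a2 : ℝ) ^ ((3:ℝ)/2) / ((a1:ℝ) ^ 2 * (a2:ℝ) ^ 2)) = ∏ p ∈ M.primeFactors, Aloc M p := by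
  have hP : ∀ p ∈ M.primeFactors, p.Prime := fun p hp => Nat.prime_of_mem_primeFactors hp
  have e1 : ∀ p ∈ M.primeFactors, Aloc M p = (-(((p:ℝ))⁻¹ ^ 2) * (1 + (-((p:ℝ) ^ 3/(p:ℝ) ^ 2)))) + (1 + tl M ∅ p) := by
    intro p hp
    have hp0 : (0:ℝ) < p := by exact_mod_cast (hP p hp).pos
    simp only [Aloc, tl, Finset.notMem_empty, false_or]
    split_ifs
    · push_cast
      rw [sq_rpow32 hp0.le]
      field_simp
      ring
    · field_simp; ring
  rw [Finset.prod_congr rfl e1, prod_add_ite]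
  have : ∀ a1 ∈ M.divisors, ∑ a2 ∈ M.divisors, (ArithmeticFunction.moebius a1 : ℝ) * (ArithmeticFunction.moebius a2 : ℝ) *
    ((GG M a1 a2 : ℝ) ^ ((3:ℝ)/2) / ((a1:ℝ) ^ 2 * (a2:ℝ) ^ 2)) = (ArithmeticFunction.moebius a1 : ℝ) * ((fun a1 => ∑ a2 ∈ M.divisors, (ArithmeticFunction.moebius a2 : ℝ) * 
    ((GG M a1 a2 : ℝ) ^ ((3:ℝ)/2) / ((a1:ℝ) ^ 2 * (a2:ℝ) ^ 2))) a1) := by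
    intro a1 _; simp only; rw [Finset.mul_sum]; exact Finset.sum_congr rfl fun _ _ => by ring
  rw [Finset.sum_congr rfl this, sum_div_powerset M hM (fun a1 => ∑ a2 ∈ M.divisors, (ArithmeticFunction.moebius a2 : ℝ) * 
    ((GG M a1 a2 : ℝ) ^ ((3:ℝ)/2) / ((a1:ℝ) ^ 2 * (a2:ℝ) ^ 2)))]
  refine Finset.sum_congr rfl fun S1 hS1 => ?_
  have hS1 := Finset.mem_powerset.1 hS1
  rw [sum_div_powerset M hM (fun a2 => ((GG M (∏ p ∈ S1, p) a2 : ℝ) ^ ((3:ℝ)/2) / (((∏ p ∈ S1, p : ℕ):ℝ) ^ 2 * (a2:ℝ) ^ 2)))]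
  have e2 : ∏ p ∈ M.primeFactors, (if p ∈ S1 then (-(((p:ℝ))⁻¹ ^ 2) * (1 + (-((p:ℝ) ^ 3/(p:ℝ) ^ 2)))) else (1 + tl M ∅ p)) =
      (∏ p ∈ S1, (-(((p:ℝ))⁻¹ ^ 2))) * ∏ p ∈ M.primeFactors, (tl M S1 p + 1) := by
    have : ∏ p ∈ S1, (-(((p:ℝ))⁻¹ ^ 2)) = ∏ p ∈ M.primeFactors, (if p ∈ S1 then (-(((p:ℝ))⁻¹ ^ 2)) else 1) := by
      rw [← Finset.prod_sdiff hS1, Finset.prod_congr rfl (fun p hp => if_neg (Finset.mem_sdiff.1 hp).2), Finset.prod_const_one, one_mul]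
      exact Finset.prod_congr rfl (fun p hp => (if_pos hp).symm)
    rw [this, ← Finset.prod_mul_distrib]
    refine Finset.prod_congr rfl fun p hp => ?_
    have hp0 : (0:ℝ) < p := by exact_mod_cast (hP p hp).pos
    by_cases h : p ∈ S1
    · simp only [h, if_true, tl, true_or]
      push_cast
      rw [sq_rpow32 hp0.le]
      ring
    · simp only [h, if_false, tl, Finset.notMem_empty]; ring
  rw [e2, prod_add_ite, Finset.mul_sum, Finset.mul_sum]
  refine Finset.sum_congr rfl fun S2 hS2 => ?_
  have hS2 := Finset.mem_powerset.1 hS2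
  have e3 : ∏ p ∈ M.primeFactors, (if p ∈ S2 then tl M S1 p else 1) = ∏ p ∈ S2, tl M S1 p := by
    rw [← Finset.prod_sdiff hS2, Finset.prod_congr rfl (fun p hp => if_neg (Finset.mem_sdiff.1 hp).2), Finset.prod_const_one, one_mul]
    exact Finset.prod_congr rfl (fun p hp => (if_pos hp))
  have e4 : GG M (∏ p ∈ S1, p) (∏ p ∈ S2, p) = ∏ p ∈ S2, (if p ∈ S1 ∨ p ^ 2 ∣ M then p ^ 2 else p) := by
    rw [GG, ← Finset.prod_pow S2, gcd_prod_sq _ _ fun p hp => hP p (hS2 hp)]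
    exact Finset.prod_congr rfl fun p hp => GG_loc M hM S1 hS1 p (hS2 hp)
  rw [e3, e4, mu_prod S1 fun p hp => hP p (hS1 hp), mu_prod S2 fun p hp => hP p (hS2 hp)]
  rw [Nat.cast_prod, Nat.cast_prod, Nat.cast_prod, ← Real.finset_prod_rpow _ _ (fun _ _ => by positivity)]
  unfold tl
  have f1 : ∏ p ∈ S1, (-(((p:ℝ))⁻¹ ^ 2)) = (∏ p ∈ S1, (-1:ℝ)) / (∏ p ∈ S1, (p:ℝ)) ^ 2 := by
    rw [← Finset.prod_pow, ← Finset.prod_div_distrib]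
    exact Finset.prod_congr rfl fun _ _ => by rw [inv_pow, neg_div, one_div]
  have f2 : ∀ W : ℕ → ℝ, ∏ p ∈ S2, (-(W p / (p:ℝ) ^ 2)) = (∏ p ∈ S2, (-1:ℝ)) * (∏ p ∈ S2, W p) / (∏ p ∈ S2, (p:ℝ)) ^ 2 := by
    intro W
    rw [← Finset.prod_pow, ← Finset.prod_mul_distrib, ← Finset.prod_div_distrib]
    exact Finset.prod_congr rfl fun _ _ => by ring
  rw [f1, f2]
  ring
end

section
open Finset

lemma div_bound (ε : ℝ) (hε : 0 < ε) : ∃ C : ℝ, 1 ≤ C ∧ ∀ n : ℕ, n ≠ 0 → (n.divisors.card : ℝ) ≤ C * (n:ℝ) ^ ε := by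
  have hl2 : 0 < Real.log 2 := Real.log_pos (by norm_num)
  set B : ℝ := 1 + 1 / (ε * Real.log 2) with hB
  have hB1 : 1 ≤ B := by rw [hB]; have : 0 < 1 / (ε * Real.log 2) := by positivity
                         linarith
  set P0 : ℕ := ⌈(2:ℝ) ^ (1/ε)⌉₊ with hP0
  refine ⟨B ^ P0, one_le_pow₀ hB1, fun n hn => ?_⟩
  have key : ∀ p : ℕ, p.Prime → ∀ v : ℕ, ((v:ℝ) + 1) ≤ (if p < P0 then B else 1) * ((p:ℝ) ^ v) ^ ε := by
    intro p hp v
    have hp2 : (2:ℝ) ≤ p := by exact_mod_cast hp.two_le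
    split_ifs with h
    · have h1 : ((2:ℝ) ^ v) ^ ε ≤ ((p:ℝ) ^ v) ^ ε := by gcongr
      have h2 : 1 + v * (ε * Real.log 2) ≤ ((2:ℝ) ^ v) ^ ε := by
        rw [← Real.rpow_natCast, ← Real.rpow_mul (by norm_num), Real.rpow_def_of_pos (by norm_num)]
        have := Real.add_one_le_exp (Real.log 2 * (v * ε))
        linarith
      have h3 : (v:ℝ) + 1 ≤ B * (1 + v * (ε * Real.log 2)) := by
        have e : B * (1 + v * (ε * Real.log 2)) = 1 + v + 1 / (ε * Real.log 2) + v * (ε * Real.log 2) := by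
          rw [hB]; field_simp; ring
        rw [e]
        have : 0 ≤ 1 / (ε * Real.log 2) + v * (ε * Real.log 2) := by positivity
        linarith
      exact h3.trans (mul_le_mul_of_nonneg_left (h2.trans h1) (by linarith))
    · have h1 : (2:ℝ) ^ (1/ε) ≤ p := (Nat.le_ceil _).trans (by exact_mod_cast not_lt.1 h)
      have h2 : (2:ℝ) ≤ (p:ℝ) ^ ε := by
        calc (2:ℝ) = ((2:ℝ) ^ (1/ε)) ^ ε := by rw [← Real.rpow_mul (by norm_num), one_div_mul_cancel hε.ne', Real.rpow_one]
          _ ≤ _ := by gcongr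
      rw [one_mul, ← Real.rpow_natCast, ← Real.rpow_mul (by positivity), mul_comm, Real.rpow_mul (by positivity), Real.rpow_natCast]
      calc (v:ℝ) + 1 ≤ (2:ℝ) ^ v := by exact_mod_cast (Nat.lt_two_pow_self (n := v))
        _ ≤ _ := by gcongr
  rw [Nat.card_divisors hn, Nat.cast_prod]
  have e : (n:ℝ) ^ ε = ∏ p ∈ n.primeFactors, ((p:ℝ) ^ (n.factorization p)) ^ ε := by
    conv_lhs => rw [← Nat.prod_factorization_pow_eq_self hn]
    rw [Finsupp.prod, Nat.cast_prod, Nat.support_factorization, ← Real.finset_prod_rpow _ _ (fun _ _ => by positivity)]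
    push_cast; rfl
  calc ∏ p ∈ n.primeFactors, ((n.factorization p + 1 : ℕ) : ℝ)
      ≤ ∏ p ∈ n.primeFactors, ((if p < P0 then B else 1) * ((p:ℝ) ^ (n.factorization p)) ^ ε) :=
        Finset.prod_le_prod (fun _ _ => by positivity) fun p hp => by
          push_cast; exact key p (Nat.prime_of_mem_primeFactors hp) _
    _ = (∏ p ∈ n.primeFactors, (if p < P0 then B else 1)) * (n:ℝ) ^ ε := by rw [Finset.prod_mul_distrib, e]
    _ ≤ _ := by
      gcongr
      rw [← Finset.prod_filter, Finset.prod_const]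
      refine pow_le_pow_right₀ hB1 ?_
      calc _ ≤ #(Finset.range P0) := Finset.card_le_card fun p hp => by
            rw [Finset.mem_filter] at hp; exact Finset.mem_range.2 hp.2
        _ = P0 := Finset.card_range _

lemma cc_ne {N c1 c2 : ℕ} (h : cc N c1 c2 ≠ 0) : Nat.Coprime c1 c2 ∧ c1 ≠ 0 ∧ c2 ≠ 0 ∧ Nat.Coprime (c1 * c2) N := by
  have hc12 : Nat.Coprime c1 c2 := by
    by_contra hcon; rw [cc, if_neg hcon] at h; exact h rfl
  rw [cc, if_pos hc12] at h
  have hc' := (div_ne_zero_iff.1 h).1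
  have hac : ∀ c, ac N c ≠ 0 → c ≠ 0 ∧ Nat.Coprime c N := by
    intro c hc
    refine ⟨?_, by by_contra hcon; rw [ac, if_neg hcon] at hc; exact hc rfl⟩
    rintro rfl
    exact hc (ac_zero_of_not (by simp))
  obtain ⟨x1, x2⟩ := hac c1 (left_ne_zero_of_mul hc')
  obtain ⟨y1, y2⟩ := hac c2 (right_ne_zero_of_mul hc')
  exact ⟨hc12, x1, y1, Nat.Coprime.mul_left x2 y2⟩

lemma kap_mul {N c1 c2 : ℕ} (hN : N ≠ 0) (h : Nat.Coprime c1 c2 ∧ c1 ≠ 0 ∧ c2 ≠ 0 ∧ Nat.Coprime (c1 * c2) N) :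
    kap (c1 * c2 * N) = kap N * (hh c1 * hh c2) := by
  obtain ⟨h1, h2, h3, h4⟩ := h
  rw [kap_eq _ (by positivity), kap_eq _ hN, h4.primeFactors_mul, Finset.prod_union h4.disjoint_primeFactors,
    h1.primeFactors_mul, Finset.prod_union h1.disjoint_primeFactors, hh, hh]
  ring

lemma PPc_asymp : ∃ C : ℝ, 0 < C ∧ ∀ N : ℕ, N ≠ 0 → ∀ Z : ℝ, 0 ≤ Z →
    |∑' c : ℕ × ℕ, cc N c.1 c.2 * PP (c.1 * c.2 * N) Z - cst * Real.sqrt Z * (kap N * SS N)| ≤ C * (N.divisors.card) * Z ^ ((1:ℝ)/3) := by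
  obtain ⟨C, hC, hPP⟩ := PP_asymp
  obtain ⟨D, hD, hdiv⟩ := div_bound (1/2) (by norm_num)
  have hs1 : Summable (fun n : ℕ => 1 / (n:ℝ) ^ ((3:ℝ)/2)) := Real.summable_one_div_nat_rpow.2 (by norm_num)
  have hs2 : Summable (fun c : ℕ × ℕ => 1 / (c.1:ℝ) ^ ((3:ℝ)/2) * (1 / (c.2:ℝ) ^ ((3:ℝ)/2))) :=
    hs1.mul_of_nonneg hs1 (fun n => by simp only [Pi.zero_apply]; positivity) (fun n => by simp only [Pi.zero_apply]; positivity)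
  set T := ∑' c : ℕ × ℕ, 1 / (c.1:ℝ) ^ ((3:ℝ)/2) * (1 / (c.2:ℝ) ^ ((3:ℝ)/2))
  have hT : 0 ≤ T := tsum_nonneg fun c => by positivity
  refine ⟨C * D * D * T + 1, by positivity, fun N hN Z hZ => ?_⟩
  set Df : ℕ × ℕ → ℝ := fun c => cc N c.1 c.2 * PP (c.1 * c.2 * N) Z - cst * Real.sqrt Z * kap N * (cc N c.1 c.2 * (hh c.1 * hh c.2)) with hDf
  have hd1 : ∀ c : ℕ, c ≠ 0 → 1 / (c:ℝ) ^ 2 * (c.divisors.card:ℝ) ≤ D * (1 / (c:ℝ) ^ ((3:ℝ)/2)) := by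
    intro c hc
    have hc0 : (0:ℝ) < c := by exact_mod_cast Nat.pos_of_ne_zero hc
    have e : (c:ℝ) ^ 2 = (c:ℝ) ^ ((3:ℝ)/2) * (c:ℝ) ^ ((1:ℝ)/2) := by
      rw [← Real.rpow_add hc0]; norm_num
    calc _ ≤ 1 / (c:ℝ) ^ 2 * (D * (c:ℝ) ^ ((1:ℝ)/2)) := by gcongr; exact hdiv c hc
      _ = _ := by rw [e]; field_simp
  have hb : ∀ c, ‖Df c‖ ≤ (C * D * D * (N.divisors.card) * Z ^ ((1:ℝ)/3)) * (1 / (c.1:ℝ) ^ ((3:ℝ)/2) * (1 / (c.2:ℝ) ^ ((3:ℝ)/2))) := by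
    rintro ⟨c1, c2⟩
    by_cases h0 : cc N c1 c2 = 0
    · simp only [hDf, h0]; simp; positivity
    have h := cc_ne h0
    have e : Df (c1, c2) = cc N c1 c2 * (PP (c1 * c2 * N) Z - cst * Real.sqrt Z * kap (c1 * c2 * N)) := by
      rw [kap_mul hN h]; simp only [hDf]; ring
    obtain ⟨h1, h2, h3, h4⟩ := h
    rw [e, Real.norm_eq_abs, abs_mul]
    have h5 := hPP (c1 * c2 * N) (by positivity) Z hZ
    rw [h4.card_divisors_mul, h1.card_divisors_mul] at h5
    push_cast at h5
    calc _ ≤ (1 / (c1:ℝ) ^ 2 * (1 / (c2:ℝ) ^ 2)) * (C * ((c1.divisors.card:ℝ) * (c2.divisors.card:ℝ) * (N.divisors.card:ℝ)) * Z ^ ((1:ℝ)/3)) := by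
          gcongr
          exact cc_abs_le _ _ _
      _ = (C * (N.divisors.card:ℝ) * Z ^ ((1:ℝ)/3)) * ((1 / (c1:ℝ) ^ 2 * (c1.divisors.card:ℝ)) * (1 / (c2:ℝ) ^ 2 * (c2.divisors.card:ℝ))) := by ring
      _ ≤ (C * (N.divisors.card:ℝ) * Z ^ ((1:ℝ)/3)) * ((D * (1 / (c1:ℝ) ^ ((3:ℝ)/2))) * (D * (1 / (c2:ℝ) ^ ((3:ℝ)/2)))) := by
          exact mul_le_mul_of_nonneg_left (mul_le_mul (hd1 c1 h2) (hd1 c2 h3) (by positivity) (by positivity)) (by positivity)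
      _ = _ := by ring
  have hDs : Summable Df := Summable.of_norm_bounded (hs2.mul_left _) hb
  have hMs := (cch_summable N).mul_left (cst * Real.sqrt Z * kap N)
  have e1 : ∑' c : ℕ × ℕ, cc N c.1 c.2 * PP (c.1 * c.2 * N) Z = ∑' c, Df c + cst * Real.sqrt Z * kap N * SS N := by
    rw [SS, ← tsum_mul_left, ← hDs.tsum_add hMs]
    exact tsum_congr fun c => by simp only [hDf]; ring
  rw [e1]
  have e2 : ∑' c, Df c + cst * Real.sqrt Z * kap N * SS N - cst * Real.sqrt Z * (kap N * SS N) = ∑' c, Df c := by ring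
  rw [e2]
  have := tsum_of_norm_bounded (hs2.mul_left (C * D * D * (N.divisors.card) * Z ^ ((1:ℝ)/3))).hasSum hb
  rw [tsum_mul_left, Real.norm_eq_abs] at this
  refine this.trans ?_
  have h0 : 0 ≤ (N.divisors.card : ℝ) * Z ^ ((1:ℝ)/3) := by positivity
  change C * D * D * (N.divisors.card) * Z ^ ((1:ℝ)/3) * T ≤ _
  nlinarith
end

section
open Finset

lemma Aloc_gar (m : ℤ) (hm : m ≠ 0) :
    (∏ p ∈ m.natAbs.primeFactors, ((p:ℝ) ^ 2 / (((p:ℝ) - 1) * ((p:ℝ) + 2)))) * ∏ p ∈ m.natAbs.primeFactors, Aloc m.natAbs p = GammaAr m := by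
  have hiff : ∀ p : ℕ, ((p:ℤ)) ^ 2 ∣ m ↔ p ^ 2 ∣ m.natAbs := fun p => by
    rw [← Int.natCast_dvd, Nat.cast_pow]
  unfold GammaAr
  rw [← Finset.prod_mul_distrib, ← Finset.prod_filter_mul_prod_filter_not m.natAbs.primeFactors (fun p : ℕ => ((p:ℤ)) ^ 2 ∣ m)]
  congr 1
  · refine Finset.prod_congr rfl fun p hp => ?_
    rw [Finset.mem_filter] at hp
    have hpp := Nat.prime_of_mem_primeFactors hp.1
    have hp2 : (2:ℝ) ≤ (p:ℝ) := by exact_mod_cast hpp.two_le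
    rw [Aloc, if_pos ((hiff p).1 hp.2)]
    have : (p:ℝ) - 1 ≠ 0 := by linarith
    field_simp
    ring
  · refine Finset.prod_congr rfl fun p hp => ?_
    rw [Finset.mem_filter] at hp
    have hpp := Nat.prime_of_mem_primeFactors hp.1
    have hp2 : (2:ℝ) ≤ (p:ℝ) := by exact_mod_cast hpp.two_le
    rw [Aloc, if_neg (fun h => hp.2 ((hiff p).2 h))]
    have hp0 : (0:ℝ) ≤ p := by positivity
    have e1 : (p:ℝ) ^ ((1:ℝ)/2) = Real.sqrt p := (Real.sqrt_eq_rpow _).symm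
    have e2 : (p:ℝ) ^ ((3:ℝ)/2) = Real.sqrt p ^ 3 := by
      rw [Real.sqrt_eq_rpow, ← Real.rpow_natCast, ← Real.rpow_mul hp0]; norm_num
    rw [e1, e2]
    have hs : (p:ℝ) = Real.sqrt p ^ 2 := (Real.sq_sqrt hp0).symm
    have ht1 : 1 < Real.sqrt p := by rw [Real.lt_sqrt (by norm_num)]; linarith
    rw [hs, Real.sqrt_sq (Real.sqrt_nonneg _)]
    generalize Real.sqrt (p:ℝ) = t at ht1
    have ha : t ^ 2 - 1 ≠ 0 := by nlinarith
    have hb : t ^ 3 + t + 1 ≠ 0 := by positivity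
    have hc : (1 + (t ^ 2 + t + 1) / (t ^ 3 + t + 1))⁻¹ = (t ^ 3 + t + 1) / ((t ^ 2 + 2) * (t + 1)) := by
      rw [one_add_div hb, inv_div]; congr 1; ring
    rw [hc]
    field_simp
    ring

lemma q_part (q : ℕ) (hq : q ≠ 0) : (q.totient : ℝ) / q * ∏ p ∈ q.primeFactors, ((p:ℝ) ^ 2 / (((p:ℝ) - 1) * ((p:ℝ) + 2))) =
    ∏ p ∈ q.primeFactors, (1 + 2 * (p:ℝ)⁻¹)⁻¹ := by
  rw [tot_div q hq, ← Finset.prod_mul_distrib]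
  refine Finset.prod_congr rfl fun p hp => ?_
  have hpp := Nat.prime_of_mem_primeFactors hp
  have hp2 : (2:ℝ) ≤ (p:ℝ) := by exact_mod_cast hpp.two_le
  have e3 : (1 + 2 * (p:ℝ)⁻¹) = ((p:ℝ) + 2) / p := by field_simp
  have : (p:ℝ) - 1 ≠ 0 := by linarith
  rw [e3]
  field_simp

lemma tot_le (q : ℕ) : (q.totient : ℝ) / q ≤ 1 := by
  apply div_le_one_of_le₀ _ (by positivity)
  exact_mod_cast Nat.totient_le q

lemma alg_aux (u g D c z k : ℝ) {s : ℝ} (hs : s ≠ 0) : u * (g * s / D) * (c * (z / s) * k) = u * (g / D) * (c * z * k) := by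
  field_simp

set_option maxHeartbeats 800000 in
lemma Pm_asymp (m : ℤ) (hm : m ≠ 0) : ∃ C : ℝ, 0 < C ∧ ∀ q : ℕ, q ≠ 0 → Nat.Coprime m.natAbs q → ∀ Z : ℝ, 0 ≤ Z →
    |(q.totient : ℝ) / q * Pm m.natAbs q Z - Cmain * GammaAr m * (∏ p ∈ q.primeFactors, (1 + 2 * (p:ℝ)⁻¹)⁻¹) * Real.sqrt Z| ≤
      C * (q.divisors.card) * Z ^ ((1:ℝ)/3) := by
  obtain ⟨C, hC, hPc⟩ := PPc_asymp
  set M := m.natAbs with hM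
  have hM0 : M ≠ 0 := Int.natAbs_ne_zero.2 hm
  set co : ℕ → ℕ → ℝ := fun a1 a2 => (ArithmeticFunction.moebius a1 : ℝ) * (ArithmeticFunction.moebius a2 : ℝ) * ((GG M a1 a2 : ℝ) ^ 2 / ((a1:ℝ) ^ 2 * (a2:ℝ) ^ 2)) with hco
  set U : ℝ := ∑ a1 ∈ M.divisors, ∑ a2 ∈ M.divisors, |co a1 a2| with hU
  have hU0 : 0 ≤ U := Finset.sum_nonneg fun _ _ => Finset.sum_nonneg fun _ _ => abs_nonneg _
  refine ⟨U * C * M.divisors.card + 1, by positivity, fun q hq hcop Z hZ => ?_⟩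
  have hN : M * q ≠ 0 := by positivity
  have hmain : (q.totient : ℝ) / q * (∑ a1 ∈ M.divisors, ∑ a2 ∈ M.divisors, co a1 a2 * (cst * Real.sqrt (Z / (GG M a1 a2 : ℝ)) * (kap (M * q) * SS (M * q)))) =
      Cmain * GammaAr m * (∏ p ∈ q.primeFactors, (1 + 2 * (p:ℝ)⁻¹)⁻¹) * Real.sqrt Z := by
    have e1 : ∑ a1 ∈ M.divisors, ∑ a2 ∈ M.divisors, co a1 a2 * (cst * Real.sqrt (Z / (GG M a1 a2 : ℝ)) * (kap (M * q) * SS (M * q))) =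
        (∏ p ∈ M.primeFactors, Aloc M p) * (cst * Real.sqrt Z * (kap (M * q) * SS (M * q))) := by
      rw [← Asum M hM0, Finset.sum_mul]
      refine Finset.sum_congr rfl fun a1 _ => ?_
      rw [Finset.sum_mul]
      refine Finset.sum_congr rfl fun a2 ha2 => ?_
      have hG : (0:ℝ) < GG M a1 a2 := by exact_mod_cast GG_pos (Nat.pos_of_mem_divisors ha2).ne'
      have e : (GG M a1 a2 : ℝ) ^ 2 = (GG M a1 a2 : ℝ) ^ ((3:ℝ)/2) * Real.sqrt (GG M a1 a2 : ℝ) := by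
        rw [Real.sqrt_eq_rpow, ← Real.rpow_add hG]; norm_num
      simp only [hco]
      rw [Real.sqrt_div hZ, e]
      exact alg_aux _ _ _ _ _ _ (by positivity)
    rw [e1, kap_SS _ hN, hcop.primeFactors_mul, Finset.prod_union hcop.disjoint_primeFactors, ← Aloc_gar m hm, ← q_part q hq]
    have e2 : Cmain = cst * Ct := by rw [cst_eq]; rfl
    rw [e2]
    ring
  rw [← hmain, Pm_eq hM0 hq hcop hZ, ← mul_sub, ← Finset.sum_sub_distrib, abs_mul]
  have ht0 : 0 ≤ (q.totient : ℝ) / q := by positivity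
  rw [abs_of_nonneg ht0]
  have hb : |∑ a1 ∈ M.divisors, (∑ a2 ∈ M.divisors, (ArithmeticFunction.moebius a1 : ℝ) * (ArithmeticFunction.moebius a2 : ℝ) * ((GG M a1 a2 : ℝ) ^ 2 / ((a1:ℝ) ^ 2 * (a2:ℝ) ^ 2)) *
      ∑' c : ℕ × ℕ, cc (M * q) c.1 c.2 * PP (c.1 * c.2 * (M * q)) (Z / (GG M a1 a2 : ℝ)) -
      ∑ a2 ∈ M.divisors, co a1 a2 * (cst * Real.sqrt (Z / (GG M a1 a2 : ℝ)) * (kap (M * q) * SS (M * q))))| ≤ U * (C * (M.divisors.card * q.divisors.card) * Z ^ ((1:ℝ)/3)) := by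
    refine (Finset.abs_sum_le_sum_abs _ _).trans ?_
    rw [hU, Finset.sum_mul]
    refine Finset.sum_le_sum fun a1 _ => ?_
    rw [← Finset.sum_sub_distrib, Finset.sum_mul]
    refine (Finset.abs_sum_le_sum_abs _ _).trans (Finset.sum_le_sum fun a2 ha2 => ?_)
    have hG : (1:ℝ) ≤ GG M a1 a2 := by exact_mod_cast GG_pos (Nat.pos_of_mem_divisors ha2).ne'
    change |co a1 a2 * _ - co a1 a2 * _| ≤ _
    rw [← mul_sub, abs_mul]
    refine mul_le_mul_of_nonneg_left ?_ (abs_nonneg _)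
    refine (hPc _ hN _ (by positivity)).trans ?_
    rw [hcop.card_divisors_mul]
    push_cast
    gcongr
    exact div_le_self hZ hG
  calc _ ≤ 1 * (U * (C * (M.divisors.card * q.divisors.card) * Z ^ ((1:ℝ)/3))) :=
        mul_le_mul (tot_le q) hb (abs_nonneg _) zero_le_one
    _ ≤ _ := by
      have h0 : 0 ≤ (q.divisors.card : ℝ) * Z ^ ((1:ℝ)/3) := by positivity
      nlinarith
end

section
open Finset

noncomputable def muR (n : ℕ) : ℝ := ((ArithmeticFunction.moebius n : ℤ) : ℝ)

noncomputable def Sa (X : ℝ) (q a : ℕ) : ℝ := ∑ n ∈ Icc 1 ⌊X⌋₊, if n % q = a % q then muR n ^ 2 else 0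
noncomputable def QQ (X : ℝ) (q : ℕ) : ℝ := ∑ n ∈ Icc 1 ⌊X⌋₊, if Nat.Coprime n q then muR n ^ 2 else 0
noncomputable def NN (m : ℤ) (X : ℝ) (q : ℕ) : ℝ := ∑ n1 ∈ Icc 1 ⌊X⌋₊, ∑ n2 ∈ Icc 1 ⌊X⌋₊,
  if Nat.Coprime n1 q ∧ (q:ℤ) ∣ n2 - m * n1 then muR n1 ^ 2 * muR n2 ^ 2 else 0

lemma Eterm_eq (X : ℝ) (q a : ℕ) : Eterm X q a = Sa X q a - Cq q * X / q := by
  unfold Eterm Sa; rw [Finset.sum_filter]; rfl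

def red (q : ℕ) : Finset ℕ := (Finset.range q).filter (fun a => Nat.Coprime a q)

lemma red_card (q : ℕ) : (red q).card = q.totient := by
  rw [red, Nat.totient]; congr 1; ext a; simp [Nat.coprime_comm]

lemma sig_cast (m : ℤ) {q : ℕ} (hq : q ≠ 0) (a : ℕ) : (((m * a % (q : ℤ)).toNat : ℕ) : ℤ) = m * a % q :=
  Int.toNat_of_nonneg (Int.emod_nonneg _ (by exact_mod_cast hq))

lemma sig_mem (m : ℤ) {q : ℕ} (hq : q ≠ 0) (hc : Int.gcd m q = 1) {a : ℕ} (ha : a ∈ red q) : (m * a % (q : ℤ)).toNat ∈ red q := by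
  unfold red at *
  rw [mem_filter, mem_range] at *
  have h1 := sig_cast m hq a
  constructor
  · have := Int.emod_lt_of_pos (m * a) (show (0:ℤ) < q by exact_mod_cast Nat.pos_of_ne_zero hq)
    omega
  · have h2 : IsCoprime (m * a) (q:ℤ) := IsCoprime.mul_left (Int.isCoprime_iff_gcd_eq_one.2 hc) (Nat.isCoprime_iff_coprime.2 ha.2)
    rw [← Nat.isCoprime_iff_coprime, h1]
    have e : m * a % q = m * a + q * (-(m * a / q)) := by have := Int.emod_add_mul_ediv (m * a) q; linarith
    rw [e]
    exact IsCoprime.add_mul_left_left h2 _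

lemma sig_inj (m : ℤ) {q : ℕ} (hq : q ≠ 0) (hc : Int.gcd m q = 1) : Set.InjOn (fun a : ℕ => (m * a % (q : ℤ)).toNat) (red q) := by
  intro a ha b hb h
  simp only [red, coe_filter, Set.mem_setOf_eq, mem_range] at ha hb
  have h1 : m * a % (q:ℤ) = m * b % q := by rw [← sig_cast m hq a, ← sig_cast m hq b]; exact_mod_cast h
  have h2 : (q:ℤ) ∣ m * a - m * b := Int.dvd_of_emod_eq_zero (by rw [Int.sub_emod, h1]; simp)
  rw [← mul_sub] at h2
  have h3 : (q:ℤ) ∣ a - b := (Int.isCoprime_iff_gcd_eq_one.2 hc).symm.dvd_of_dvd_mul_left h2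
  have h4 := Int.emod_emod_of_dvd
  have h5 : (a:ℤ) % q = b % q := Int.emod_eq_emod_iff_emod_sub_eq_zero.2 (Int.emod_eq_zero_of_dvd h3)
  have h6 : a % q = b % q := by exact_mod_cast h5
  rwa [Nat.mod_eq_of_lt ha.1, Nat.mod_eq_of_lt hb.1] at h6

lemma sum_sig (m : ℤ) {q : ℕ} (hq : q ≠ 0) (hc : Int.gcd m q = 1) (F : ℕ → ℝ) :
    ∑ a ∈ red q, F ((m * a % (q : ℤ)).toNat) = ∑ a ∈ red q, F a := by
  refine Finset.sum_nbij (fun a : ℕ => (m * a % (q : ℤ)).toNat) (fun a ha => sig_mem m hq hc ha) (sig_inj m hq hc) ?_ fun _ _ => rfl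
  exact Finset.surjOn_of_injOn_of_card_le _ (fun a ha => sig_mem m hq hc ha) (sig_inj m hq hc) le_rfl

lemma sum_red {q : ℕ} (hq : q ≠ 0) (n : ℕ) (F : ℕ → ℝ) : ∑ a ∈ red q, (if n % q = a % q then F a else 0) = if Nat.Coprime n q then F (n % q) else 0 := by
  have hlt := Nat.mod_lt n (Nat.pos_of_ne_zero hq)
  have hco : Nat.Coprime (n % q) q ↔ Nat.Coprime n q := by
    rw [Nat.Coprime, Nat.Coprime, ← Nat.gcd_rec, Nat.gcd_comm]
  have : ∀ a ∈ red q, (if n % q = a % q then F a else 0) = if n % q = a then F a else 0 := by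
    intro a ha
    rw [red, mem_filter, mem_range] at ha
    rw [Nat.mod_eq_of_lt ha.1]
  rw [Finset.sum_congr rfl this, Finset.sum_ite_eq]
  simp [red, hlt, hco]

lemma sum_Sa {q : ℕ} (hq : q ≠ 0) (X : ℝ) : ∑ a ∈ red q, Sa X q a = QQ X q := by
  unfold Sa QQ
  rw [Finset.sum_comm]
  refine Finset.sum_congr rfl fun n _ => ?_
  exact sum_red hq n (fun _ => muR n ^ 2)

lemma sig_iff (m : ℤ) {q : ℕ} (hq : q ≠ 0) (n a b : ℕ) (hab : b % q = a % q) : n % q = (m * a % (q : ℤ)).toNat % q ↔ (q:ℤ) ∣ n - m * b := by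
  have h1 := sig_cast m hq a
  have h2 : (b:ℤ) ≡ a [ZMOD q] := by exact_mod_cast congrArg (Nat.cast (R := ℤ)) hab
  have e1 : n % q = (m * a % (q : ℤ)).toNat % q ↔ (n:ℤ) ≡ m * a [ZMOD q] := by
    rw [Int.ModEq, ← Int.emod_emod_of_dvd (m * a) (dvd_refl (q:ℤ)), ← h1]
    norm_cast
    rw [Nat.mod_mod]
  rw [e1]
  constructor
  · intro h
    exact ((h.trans (h2.mul_left m).symm).symm).dvd
  · intro h
    exact (Int.modEq_iff_dvd.2 h).symm.trans (h2.mul_left m)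

lemma sum_SaSa (m : ℤ) {q : ℕ} (hq : q ≠ 0) (X : ℝ) :
    ∑ a ∈ red q, Sa X q a * Sa X q ((m * a % (q : ℤ)).toNat) = NN m X q := by
  unfold Sa NN
  simp_rw [Finset.sum_mul_sum]
  rw [Finset.sum_comm]
  refine Finset.sum_congr rfl fun n1 _ => ?_
  rw [Finset.sum_comm]
  refine Finset.sum_congr rfl fun n2 _ => ?_
  have : ∀ a ∈ red q, ((if n1 % q = a % q then muR n1 ^ 2 else 0) * (if n2 % q = (m * a % (q : ℤ)).toNat % q then muR n2 ^ 2 else 0)) =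
      if n1 % q = a % q then (if (q:ℤ) ∣ n2 - m * n1 then muR n1 ^ 2 * muR n2 ^ 2 else 0) else 0 := by
    intro a _
    by_cases h : n1 % q = a % q
    · rw [if_pos h, if_pos h]
      simp only [sig_iff m hq n2 a n1 h]
      split_ifs <;> simp
    · rw [if_neg h, if_neg h, zero_mul]
  rw [Finset.sum_congr rfl this, sum_red hq n1 (fun _ => (if (q:ℤ) ∣ n2 - m * n1 then muR n1 ^ 2 * muR n2 ^ 2 else 0)), ← ite_and]

lemma M2_eq (m : ℤ) {q : ℕ} (hq : q ≠ 0) (hc : Int.gcd m q = 1) (X : ℝ) :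
    M2corr m X q = NN m X q - 2 * (Cq q * X / q) * QQ X q + q.totient * (Cq q * X / q) ^ 2 := by
  unfold M2corr
  change ∑ a ∈ red q, _ = _
  simp_rw [Eterm_eq]
  have e : ∀ a ∈ red q, (Sa X q a - Cq q * X / q) * (Sa X q ((m * a % (q : ℤ)).toNat) - Cq q * X / q) =
     Sa X q a * Sa X q ((m * a % (q : ℤ)).toNat) - (Cq q * X / q) * Sa X q a - (Cq q * X / q) * Sa X q ((m * a % (q : ℤ)).toNat) + (Cq q * X / q) ^ 2 := fun a _ => by ring
  rw [Finset.sum_congr rfl e, Finset.sum_add_distrib, Finset.sum_sub_distrib, Finset.sum_sub_distrib, ← Finset.mul_sum, ← Finset.mul_sum,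
    sum_sig m hq hc (Sa X q), sum_Sa hq, sum_SaSa m hq, Finset.sum_const, red_card]
  simp only [nsmul_eq_mul]
  ring
end

section
open Finset

lemma count_apZ (a b : ℝ) (hab : a ≤ b) (L : ℕ) (hL : 0 < L) (r : ℤ) (S : Finset ℤ)
    (h1 : ∀ n ∈ S, a ≤ n ∧ (n:ℝ) ≤ b ∧ (L:ℤ) ∣ n - r) (h2 : ∀ n : ℤ, a < n → (n:ℝ) < b → (L:ℤ) ∣ n - r → n ∈ S) :
    |(S.card : ℝ) - (b - a) / L| ≤ 1 := by
  have hL' : (0:ℝ) < L := by exact_mod_cast hL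
  set α : ℝ := (a - r) / L with hα
  set β : ℝ := (b - r) / L with hβ
  have hαβ : α ≤ β := by rw [hα, hβ]; gcongr
  have hinj : Function.Injective (fun k : ℤ => r + L * k) := by
    intro x y h
    have h' : r + (L:ℤ) * x = r + L * y := h
    have : (L:ℤ) ≠ 0 := by exact_mod_cast hL.ne'
    exact mul_left_cancel₀ this (by linarith)
  have up : (S.card : ℝ) ≤ β - α + 1 := by
    have hsub : S ⊆ (Icc ⌈α⌉ ⌊β⌋).image (fun k : ℤ => r + L * k) := by
      intro n hn
      obtain ⟨x1, x2, k, hk⟩ := h1 n hn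
      have hk' : (n:ℝ) = r + L * k := by
        have : n = r + L * k := by linarith
        rw [this]; push_cast; ring
      refine mem_image.2 ⟨k, mem_Icc.2 ⟨Int.ceil_le.2 ?_, Int.le_floor.2 ?_⟩, by linarith⟩
      · rw [hα, div_le_iff₀ hL']; linarith
      · rw [hβ, le_div_iff₀ hL']; linarith
    have hc := card_le_card hsub
    rw [card_image_of_injective _ hinj, Int.card_Icc] at hc
    have f1 := Int.floor_le β
    have f2 := Int.le_ceil α
    rcases le_or_gt 0 (⌊β⌋ + 1 - ⌈α⌉) with h | h
    · have : ((⌊β⌋ + 1 - ⌈α⌉).toNat : ℝ) = ((⌊β⌋ + 1 - ⌈α⌉ : ℤ) : ℝ) := by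
        exact_mod_cast congrArg (Int.cast (R := ℝ)) (Int.toNat_of_nonneg h)
      have hc' : (S.card : ℝ) ≤ ((⌊β⌋ + 1 - ⌈α⌉).toNat : ℝ) := by exact_mod_cast hc
      rw [this] at hc'; push_cast at hc'; linarith
    · rw [Int.toNat_of_nonpos h.le] at hc
      have : (S.card : ℝ) ≤ 0 := by exact_mod_cast hc
      linarith
  have lo : β - α - 1 ≤ (S.card : ℝ) := by
    have hsub : (Icc (⌊α⌋ + 1) (⌈β⌉ - 1)).image (fun k : ℤ => r + L * k) ⊆ S := by
      intro n hn
      obtain ⟨k, hk, rfl⟩ := mem_image.1 hn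
      rw [mem_Icc] at hk
      have g1 : α < k := Int.floor_lt.1 (by omega)
      have g2 : (k:ℝ) < β := Int.lt_ceil.1 (by omega)
      rw [hα, div_lt_iff₀ hL'] at g1
      rw [hβ, lt_div_iff₀ hL'] at g2
      exact h2 _ (by push_cast; linarith) (by push_cast; linarith) ⟨k, by ring⟩
    have hc := card_le_card hsub
    rw [card_image_of_injective _ hinj, Int.card_Icc] at hc
    have f1 := Int.floor_le α
    have f2 := Int.le_ceil β
    have h3 : ((⌈β⌉ - 1 + 1 - (⌊α⌋ + 1) : ℤ) : ℝ) ≤ (S.card : ℝ) := by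
      exact_mod_cast (Int.self_le_toNat _).trans (by exact_mod_cast hc)
    push_cast at h3; linarith
  have e : β - α = (b - a) / L := by rw [hα, hβ]; ring
  rw [abs_le]; constructor <;> linarith

lemma count_ap (a b : ℝ) (ha : 0 ≤ a) (hab : a ≤ b) (L : ℕ) (hL : 0 < L) (r : ℤ) (S : Finset ℕ)
    (h1 : ∀ n ∈ S, a ≤ n ∧ (n:ℝ) ≤ b ∧ (L:ℤ) ∣ n - r) (h2 : ∀ n : ℕ, a < n → (n:ℝ) < b → (L:ℤ) ∣ n - r → n ∈ S) :
    |(S.card : ℝ) - (b - a) / L| ≤ 1 := by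
  have := count_apZ a b hab L hL r (S.image (Nat.cast : ℕ → ℤ)) ?_ ?_
  · rwa [card_image_of_injective _ Nat.cast_injective] at this
  · intro n hn
    obtain ⟨k, hk, rfl⟩ := mem_image.1 hn
    exact_mod_cast h1 k hk
  · intro n x1 x2 x3
    have hn : 0 ≤ n := by
      have : (0:ℝ) < n := ha.trans_lt x1
      exact_mod_cast this.le
    lift n to ℕ using hn
    exact mem_image.2 ⟨n, h2 n (by exact_mod_cast x1) (by exact_mod_cast x2) x3, rfl⟩

lemma card_cop (q : ℕ) (hq : q ≠ 0) (S : Finset ℕ) : ((S.filter (fun n => Nat.Coprime n q)).card : ℝ) =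
    ∑ e ∈ q.divisors, (ArithmeticFunction.moebius e : ℝ) * ((S.filter (fun n => e ∣ n)).card : ℝ) := by
  have h : ∀ n ∈ S, (if Nat.Coprime n q then (1:ℝ) else 0) = ∑ e ∈ q.divisors, (if e ∣ n then (ArithmeticFunction.moebius e : ℝ) else 0) := by
    intro n _
    have := congrArg (Int.cast (R := ℝ)) (sum_mu_gcd n q hq)
    push_cast at this
    exact this.symm
  rw [card_filter, Nat.cast_sum]
  push_cast
  rw [Finset.sum_congr rfl h, Finset.sum_comm]
  refine Finset.sum_congr rfl fun e _ => ?_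
  rw [← Finset.sum_filter, Finset.sum_const, nsmul_eq_mul, mul_comm]

lemma count_cop (q : ℕ) (hq : q ≠ 0) (a b : ℝ) (ha : 0 ≤ a) (hab : a ≤ b) (L : ℕ) (hL : 0 < L) (hLq : Nat.Coprime L q) (r : ℤ) (S : Finset ℕ)
    (h1 : ∀ n ∈ S, a ≤ n ∧ (n:ℝ) ≤ b ∧ (L:ℤ) ∣ n - r) (h2 : ∀ n : ℕ, a < n → (n:ℝ) < b → (L:ℤ) ∣ n - r → n ∈ S) :
    |((S.filter (fun n => Nat.Coprime n q)).card : ℝ) - (q.totient:ℝ) / q * ((b - a) / L)| ≤ q.divisors.card := by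
  rw [card_cop q hq, ← sum_mu_div q hq, Finset.sum_mul, ← Finset.sum_sub_distrib]
  refine (Finset.abs_sum_le_sum_abs _ _).trans ?_
  rw [card_eq_sum_ones, Nat.cast_sum]
  push_cast
  refine Finset.sum_le_sum fun e he => ?_
  have hed := Nat.dvd_of_mem_divisors he
  have he0 := Nat.pos_of_mem_divisors he
  have hco : Nat.Coprime L e := hLq.coprime_dvd_right hed
  obtain ⟨u, v, huv⟩ := Nat.isCoprime_iff_coprime.2 hco
  -- r' ≡ r mod L, ≡ 0 mod e
  have hiff : ∀ n : ℤ, ((L * e : ℕ) : ℤ) ∣ n - r * (v * e) ↔ (L:ℤ) ∣ n - r ∧ (e:ℤ) ∣ n := by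
    intro n
    have e1 : n - r * (v * e) = (n - r) + L * (r * u) := by linear_combination (-r) * huv
    constructor
    · intro h
      rw [Nat.cast_mul] at h
      refine ⟨?_, ?_⟩
      · have := (dvd_mul_right (L:ℤ) e).trans h
        rw [e1] at this
        exact (dvd_add_left (dvd_mul_right _ _)).1 this
      · have := (dvd_mul_left (e:ℤ) L).trans h
        exact (dvd_sub_left (Dvd.intro_left (r * v) (by ring))).1 this
    · rintro ⟨x, y⟩
      rw [Nat.cast_mul]
      refine (Nat.isCoprime_iff_coprime.2 hco).mul_dvd ?_ ?_
      · rw [e1]; exact dvd_add x (dvd_mul_right _ _)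
      · exact dvd_sub y (Dvd.intro_left (r * v) (by ring))
  have hc := count_ap a b ha hab (L * e) (by positivity) (r * (v * e)) (S.filter (fun n => e ∣ n)) ?_ ?_
  · have hm := mu_abs_le e
    have e2 : (ArithmeticFunction.moebius e : ℝ) * ((S.filter (fun n => e ∣ n)).card : ℝ) - (ArithmeticFunction.moebius e : ℝ) / e * ((b - a) / L) =
      (ArithmeticFunction.moebius e : ℝ) * (((S.filter (fun n => e ∣ n)).card : ℝ) - (b - a) / ((L * e : ℕ) : ℝ)) := by
      push_cast
      rw [mul_sub, ← div_div]; ring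
    rw [e2, abs_mul]
    exact mul_le_one₀ hm (abs_nonneg _) hc
  · intro n hn
    rw [mem_filter] at hn
    obtain ⟨x1, x2, x3⟩ := h1 n hn.1
    exact ⟨x1, x2, (hiff n).2 ⟨x3, by exact_mod_cast hn.2⟩⟩
  · intro n x1 x2 x3
    obtain ⟨y1, y2⟩ := (hiff n).1 x3
    exact mem_filter.2 ⟨h2 n x1 x2 y1, by exact_mod_cast y2⟩
end

section
open Finset

lemma muR_sq (n : ℕ) (hn : n ≠ 0) (N : ℕ) (hN : n ≤ N) : muR n ^ 2 = ∑ d ∈ Icc 1 N, if d ^ 2 ∣ n then muR d else 0 := by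
  have := sum_mu_sq n hn (Icc 1 N) ?_
  · have h2 := congrArg (Int.cast (R := ℝ)) this
    push_cast at h2
    exact h2.symm
  · intro r hr
    have h1 := Nat.le_of_dvd (Nat.pos_of_ne_zero hn) hr
    have h0 : r ≠ 0 := by rintro rfl; simp at hr; exact hn hr
    exact mem_Icc.2 ⟨Nat.pos_of_ne_zero h0, by nlinarith [Nat.pos_of_ne_zero h0]⟩

lemma ac_eq {q d n : ℕ} (h : Nat.Coprime n q) (hd : d ^ 2 ∣ n) : muR d = ac q d := by
  have : Nat.Coprime d q := h.coprime_dvd_left ((dvd_pow_self d two_ne_zero).trans hd)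
  simp [ac, this, muR]

lemma ac_zero (q : ℕ) : ac q 0 = 0 := ac_zero_of_not not_squarefree_zero

lemma ac_ne {q d : ℕ} (h : ac q d ≠ 0) : d ≠ 0 ∧ Nat.Coprime d q := by
  refine ⟨?_, ?_⟩
  · rintro rfl; exact h (ac_zero q)
  · by_contra hc; exact h (by simp [ac, hc])

lemma min_rpow {u s C : ℝ} (hu : 0 < u) (hs0 : 0 ≤ s) (hs1 : s ≤ 1) (hC : 1 ≤ C) {f : ℝ} (h1 : 1 ≤ u → f ≤ C) (h2 : u < 1 → f ≤ u) : f ≤ C * u ^ s := by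
  rcases le_or_gt 1 u with h | h
  · have := Real.one_le_rpow h hs0
    nlinarith [h1 h]
  · have h3 := Real.rpow_le_rpow_of_exponent_ge hu h.le hs1
    rw [Real.rpow_one] at h3
    nlinarith [h2 h, Real.rpow_nonneg hu.le s]

lemma QQ_asymp (η : ℝ) (hη : 0 < η) (hη2 : η ≤ 1/2) : ∃ C : ℝ, 0 < C ∧ ∀ q : ℕ, q ≠ 0 → ∀ X : ℝ, 1 ≤ X →
    |QQ X q - (q.totient : ℝ) / q * X * Cq q| ≤ C * (q.divisors.card) * X ^ (1/2 + η) := by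
  have hs : Summable (fun d : ℕ => 1 / (d:ℝ) ^ (1 + 2 * η)) := Real.summable_one_div_nat_rpow.2 (by linarith)
  refine ⟨∑' d : ℕ, 1 / (d:ℝ) ^ (1 + 2 * η) + 1, ?_, ?_⟩
  · have : 0 ≤ ∑' d : ℕ, 1 / (d:ℝ) ^ (1 + 2 * η) := tsum_nonneg fun d => by positivity
    linarith
  intro q hq X hX
  set N := ⌊X⌋₊ with hN
  set S : ℕ → Finset ℕ := fun d => (Icc 1 N).filter (fun n => d ^ 2 ∣ n) with hSdef
  have hQ : QQ X q = ∑ d ∈ Icc 1 N, ac q d * (((S d).filter (fun n => Nat.Coprime n q)).card : ℝ) := by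
    unfold QQ
    have : ∀ n ∈ Icc 1 N, (if Nat.Coprime n q then muR n ^ 2 else 0) = ∑ d ∈ Icc 1 N, if d ^ 2 ∣ n ∧ Nat.Coprime n q then ac q d else 0 := by
      intro n hn
      rw [mem_Icc] at hn
      split_ifs with h
      · rw [muR_sq n (by omega) N hn.2]
        refine sum_congr rfl fun d _ => ?_
        by_cases hd : d ^ 2 ∣ n
        · simp [hd, h, ac_eq h hd]
        · simp [hd]
      · simp [h]
    rw [sum_congr rfl this, sum_comm]
    refine sum_congr rfl fun d _ => ?_
    rw [← sum_filter, sum_const, nsmul_eq_mul, mul_comm, hSdef, filter_filter]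
  have hQ2 : HasSum (fun d : ℕ => ac q d * (((S d).filter (fun n => Nat.Coprime n q)).card : ℝ)) (QQ X q) := by
    rw [hQ]
    refine hasSum_sum_of_ne_finset_zero fun d hd => ?_
    rcases Nat.eq_zero_or_pos d with rfl | h0
    · simp [ac_zero]
    · have : S d = ∅ := by
        rw [hSdef]
        refine filter_eq_empty_iff.2 fun n hn hdn => hd ?_
        rw [mem_Icc] at hn ⊢
        have := Nat.le_of_dvd (by omega) hdn
        exact ⟨h0, by nlinarith⟩
      simp [this]
  have hM : HasSum (fun d : ℕ => (q.totient : ℝ) / q * X * (ac q d / (d:ℝ) ^ 2)) ((q.totient : ℝ) / q * X * Cq q) := by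
    rw [← tsum_ac q hq]
    exact (summable_ac_sq q).hasSum.mul_left _
  have hdq : (1:ℝ) ≤ q.divisors.card := by
    exact_mod_cast Finset.card_pos.2 ⟨1, Nat.one_mem_divisors.2 hq⟩
  have hφ := tot_le q
  have hφ0 : 0 ≤ (q.totient : ℝ) / q := by positivity
  have hb : ∀ d : ℕ, ‖ac q d * (((S d).filter (fun n => Nat.Coprime n q)).card : ℝ) - (q.totient : ℝ) / q * X * (ac q d / (d:ℝ) ^ 2)‖ ≤
      (q.divisors.card) * X ^ (1/2 + η) * (1 / (d:ℝ) ^ (1 + 2 * η)) := by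
    intro d
    by_cases hz : ac q d = 0
    · rw [hz]; simp; positivity
    obtain ⟨hd0, hdc⟩ := ac_ne hz
    have hd : (0:ℝ) < d := by exact_mod_cast Nat.pos_of_ne_zero hd0
    have e1 : ac q d * (((S d).filter (fun n => Nat.Coprime n q)).card : ℝ) - (q.totient : ℝ) / q * X * (ac q d / (d:ℝ) ^ 2)
      = ac q d * ((((S d).filter (fun n => Nat.Coprime n q)).card : ℝ) - (q.totient : ℝ) / q * ((X - 0) / ((d ^ 2 : ℕ) : ℝ))) := by push_cast; ring
    rw [e1, Real.norm_eq_abs, abs_mul]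
    have hu : 0 < X / (d:ℝ) ^ 2 := by positivity
    have e2 : X ^ (1/2 + η) * (1 / (d:ℝ) ^ (1 + 2 * η)) = (X / (d:ℝ) ^ 2) ^ (1/2 + η) := by
      rw [Real.div_rpow (by linarith) (by positivity), ← Real.rpow_natCast (d:ℝ) 2, ← Real.rpow_mul hd.le]
      push_cast
      rw [show 2 * (1/2 + η) = 1 + 2 * η by ring]; ring
    rw [mul_assoc, e2]
    have h1 := ac_abs_le q d
    refine (mul_le_of_le_one_left (abs_nonneg _) h1).trans ?_
    refine min_rpow hu (by linarith) (by linarith) hdq ?_ ?_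
    · intro _
      refine count_cop q hq 0 X le_rfl (by linarith) (d ^ 2) (by positivity) (hdc.pow_left 2) 0 (S d) ?_ ?_
      · intro n hn
        rw [hSdef, mem_filter, mem_Icc] at hn
        exact ⟨by positivity, (Nat.le_floor_iff (by linarith)).1 hn.1.2, by simpa using (by exact_mod_cast hn.2 : ((d ^ 2 : ℕ) : ℤ) ∣ (n:ℤ))⟩
      · intro n a1 a2 a3
        rw [hSdef, mem_filter, mem_Icc]
        refine ⟨⟨by exact_mod_cast a1, Nat.le_floor a2.le⟩, ?_⟩
        rw [sub_zero] at a3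
        exact_mod_cast a3
    · intro hlt
      have : S d = ∅ := by
        rw [hSdef]
        refine filter_eq_empty_iff.2 fun n hn hdn => ?_
        rw [mem_Icc] at hn
        have h2 := Nat.le_of_dvd (by omega) hdn
        have h3 : (n:ℝ) ≤ X := (Nat.le_floor_iff (by linarith)).1 hn.2
        rw [div_lt_one (by positivity)] at hlt
        have h4 : ((d ^ 2 : ℕ) : ℝ) ≤ n := by exact_mod_cast h2
        push_cast at h4
        linarith
      rw [this]
      simp only [filter_empty, card_empty, Nat.cast_zero, zero_sub, abs_neg, sub_zero, Nat.cast_pow]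
      rw [abs_of_nonneg (by positivity)]
      exact mul_le_of_le_one_left hu.le hφ
  have := tsum_of_norm_bounded (hs.mul_left ((q.divisors.card) * X ^ (1/2 + η))).hasSum hb
  rw [(hQ2.sub hM).tsum_eq, tsum_mul_left, Real.norm_eq_abs] at this
  refine this.trans ?_
  have : 0 ≤ (q.divisors.card) * X ^ (1/2 + η) := by positivity
  nlinarith
end

section
open Finset

lemma resid (m : ℤ) (q d1 d2 : ℕ) (hd1 : d1 ≠ 0) (hd2 : d2 ≠ 0) (h : ℤ) (hG : ((GG m.natAbs d1 d2 : ℕ) : ℤ) ∣ h) :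
    ∃ r : ℤ, ∀ n : ℤ, (((d1:ℤ) ^ 2 ∣ n ∧ (d2:ℤ) ^ 2 ∣ m * n + q * h) ↔ ((d1 ^ 2 * (d2 ^ 2 / GG m.natAbs d1 d2) : ℕ) : ℤ) ∣ n - r) := by
  set G := GG m.natAbs d1 d2 with hGdef
  have hGp : 0 < G := GG_pos hd2
  have hG0 : (G:ℤ) ≠ 0 := by exact_mod_cast hGp.ne'
  obtain ⟨w, hw⟩ : G ∣ d2 ^ 2 := Nat.gcd_dvd_right _ _
  obtain ⟨h', rfl⟩ := hG
  have hgcd : Int.gcd (m * (d1:ℤ) ^ 2) ((d2:ℤ) ^ 2) = G := by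
    rw [hGdef, GG, Int.gcd_def, Int.natAbs_mul, Int.natAbs_pow, Int.natAbs_pow, Int.natAbs_natCast, Int.natAbs_natCast]
  have hdv : (G:ℤ) ∣ m * (d1:ℤ) ^ 2 := by rw [← hgcd]; exact Int.gcd_dvd_left ..
  obtain ⟨u, hu⟩ := hdv
  have hw' : (d2:ℤ) ^ 2 = G * w := by exact_mod_cast hw
  have hcop : IsCoprime u (w:ℤ) := by
    rw [Int.isCoprime_iff_gcd_eq_one]
    rw [hu, hw', Int.gcd_mul_left, Int.natAbs_natCast] at hgcd
    exact Nat.eq_of_mul_eq_mul_left hGp (by linarith)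
  obtain ⟨x, y, hxy⟩ := hcop
  refine ⟨-((d1:ℤ) ^ 2 * (x * q * h')), fun n => ?_⟩
  rw [hw, Nat.mul_div_cancel_left _ hGp]
  push_cast
  have hd1' : ((d1:ℤ) ^ 2) ≠ 0 := by positivity
  have key : ∀ k : ℤ, ((G:ℤ) * w ∣ m * (d1 ^ 2 * k) + q * (G * h')) ↔ (w:ℤ) ∣ k + x * q * h' := by
    intro k
    rw [show m * ((d1:ℤ) ^ 2 * k) + q * (G * h') = G * (u * k + q * h') by linear_combination k * hu, mul_dvd_mul_iff_left hG0]
    constructor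
    · intro hh
      have : k + x * q * h' = x * (u * k + q * h') + w * (y * k) := by linear_combination (-k) * hxy
      rw [this]; exact dvd_add (hh.mul_left _) (dvd_mul_right _ _)
    · intro hh
      have : u * k + q * h' = u * (k + x * q * h') + w * (y * q * h') := by linear_combination (-q * h') * hxy
      rw [this]; exact dvd_add (hh.mul_left _) (dvd_mul_right _ _)
  rw [hw']
  constructor
  · rintro ⟨⟨k, rfl⟩, h2⟩
    rw [sub_neg_eq_add, ← mul_add]
    exact mul_dvd_mul_left _ ((key k).1 h2)
  · intro hh
    have h1 : (d1:ℤ) ^ 2 ∣ n := by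
      have := (dvd_mul_right ((d1:ℤ) ^ 2) w).trans hh
      rw [sub_neg_eq_add] at this
      exact (dvd_add_left (dvd_mul_right _ _)).1 this
    obtain ⟨k, rfl⟩ := h1
    rw [sub_neg_eq_add, ← mul_add, mul_dvd_mul_iff_left hd1'] at hh
    exact ⟨dvd_mul_right _ _, (key k).2 hh⟩

/-- endpoints -/
noncomputable def ja (m : ℤ) (X s : ℝ) : ℝ := max 0 (min (-s / m) ((X - s) / m))
noncomputable def jb (m : ℤ) (X s : ℝ) : ℝ := min X (max (-s / m) ((X - s) / m))

lemma j_sub (m : ℤ) (hm : m ≠ 0) (X s t : ℝ) (h0 : 0 < t) (hX : t ≤ X) (h1 : 0 < m * t + s) (h2 : m * t + s ≤ X) :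
    ja m X s ≤ t ∧ t ≤ jb m X s := by
  unfold ja jb
  rcases lt_or_gt_of_ne hm with h | h
  · have hm' : (m:ℝ) < 0 := by exact_mod_cast h
    refine ⟨max_le h0.le (min_le_of_right_le ?_), le_min hX (le_max_of_le_left ?_)⟩
    · rw [div_le_iff_of_neg hm']; linarith
    · rw [le_div_iff_of_neg hm']; linarith
  · have hm' : (0:ℝ) < m := by exact_mod_cast h
    refine ⟨max_le h0.le (min_le_of_left_le ?_), le_min hX (le_max_of_le_right ?_)⟩
    · rw [div_le_iff₀ hm']; linarith
    · rw [le_div_iff₀ hm']; linarith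

lemma j_sup (m : ℤ) (hm : m ≠ 0) (X s t : ℝ) (hX : 0 ≤ X) (h1 : ja m X s < t) (h2 : t < jb m X s) :
    0 < t ∧ t ≤ X ∧ 0 < m * t + s ∧ m * t + s ≤ X := by
  unfold ja at h1; unfold jb at h2
  rw [max_lt_iff] at h1; rw [lt_min_iff] at h2
  obtain ⟨h0, h1⟩ := h1
  obtain ⟨hX', h2⟩ := h2
  refine ⟨h0, hX'.le, ?_⟩
  rcases lt_or_gt_of_ne hm with h | h
  · have hm' : (m:ℝ) < 0 := by exact_mod_cast h
    have hle : (X - s) / m ≤ -s / m := by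
      rw [div_le_div_right_of_neg hm']; linarith
    rw [min_eq_right hle, div_lt_iff_of_neg hm'] at h1
    rw [max_eq_left hle, lt_div_iff_of_neg hm'] at h2
    constructor <;> linarith
  · have hm' : (0:ℝ) < m := by exact_mod_cast h
    have hle : -s / m ≤ (X - s) / m := by
      rw [div_le_div_iff_of_pos_right hm']; linarith
    rw [min_eq_left hle, div_lt_iff₀ hm'] at h1
    rw [max_eq_right hle, lt_div_iff₀ hm'] at h2
    constructor <;> linarith

noncomputable def jv (m : ℤ) (X s : ℝ) : ℝ := max (jb m X s - ja m X s) 0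

def jset (m : ℤ) (X s : ℝ) : Set ℝ := {t | 0 < t ∧ t ≤ X ∧ 0 < m * t + s ∧ m * t + s ≤ X}

lemma jset_meas (m : ℤ) (X s : ℝ) : MeasurableSet (jset m X s) := by
  have h1 : MeasurableSet {t : ℝ | 0 < t} := measurableSet_lt measurable_const measurable_id
  have h2 : MeasurableSet {t : ℝ | t ≤ X} := measurableSet_le measurable_id measurable_const
  have h3 : MeasurableSet {t : ℝ | 0 < m * t + s} := measurableSet_lt measurable_const (by fun_prop)
  have h4 : MeasurableSet {t : ℝ | m * t + s ≤ X} := measurableSet_le (by fun_prop) measurable_const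
  exact h1.inter (h2.inter (h3.inter h4))

lemma jv_int (m : ℤ) (hm : m ≠ 0) (X s : ℝ) (hX : 0 ≤ X) : MeasureTheory.volume.real (jset m X s) = jv m X s := by
  have hsub : jset m X s ⊆ Set.Icc (ja m X s) (jb m X s) := fun t ht => j_sub m hm X s t ht.1 ht.2.1 ht.2.2.1 ht.2.2.2
  have hsup : Set.Ioo (ja m X s) (jb m X s) ⊆ jset m X s := fun t ht => j_sup m hm X s t hX ht.1 ht.2
  have h1 := MeasureTheory.measure_mono (μ := MeasureTheory.volume) hsub
  have h2 := MeasureTheory.measure_mono (μ := MeasureTheory.volume) hsup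
  rw [Real.volume_Icc] at h1; rw [Real.volume_Ioo] at h2
  rw [MeasureTheory.measureReal_def, le_antisymm h1 h2, jv]
  exact ENNReal.toReal_ofReal'
end

section
open Finset

lemma sum_vol (m : ℤ) (hm : m ≠ 0) (X : ℝ) (hX : 0 < X) (q G K : ℕ) (hq : 0 < q) (hG : 0 < G) (hK : ∀ h : ℤ, ∀ t : ℝ, 0 < t → t ≤ X → 0 < m * t + q * h → m * t + q * h ≤ X → h ∈ Icc (-(K:ℤ)) K) :
    ∑ h ∈ (Icc (-(K:ℤ)) K).filter (fun h => (G:ℤ) ∣ h), jv m X (q * h) =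
      X ^ 2 / (q * G) + (q * G) / (2 * m) * (bet (m * X / (q * G)) + bet (X / (q * G)) - bet ((m - 1) * X / (q * G))) := by
  set T := (Icc (-(K:ℤ)) K).filter (fun h => (G:ℤ) ∣ h) with hT
  set L : ℝ := q * G with hLdef
  have hL : 0 < L := by positivity
  have hG' : (0:ℝ) < G := by exact_mod_cast hG
  have hq' : (0:ℝ) < q := by exact_mod_cast hq
  have hpt : ∀ t ∈ Set.Ioc 0 X, ∑ h ∈ T, (jset m X (q * h)).indicator (fun _ => (1:ℝ)) t = X / L - Int.fract ((X - m * t) / L) + Int.fract ((0 - m * t) / L) := by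
    intro t ht
    have h1 : ∑ h ∈ T, (jset m X (q * h)).indicator (fun _ => (1:ℝ)) t = ((Ioc ⌊(0 - m * t) / L⌋ ⌊(X - m * t) / L⌋).card : ℝ) := by
      classical
      simp only [Set.indicator_apply]
      rw [Finset.sum_boole]
      congr 1
      symm
      refine Finset.card_bij (fun k _ => (G:ℤ) * k) ?_ ?_ ?_
      · intro k hk
        rw [mem_Ioc, Int.floor_lt, Int.le_floor, div_lt_iff₀ hL, le_div_iff₀ hL] at hk
        have hj : t ∈ jset m X (q * (((G:ℤ) * k : ℤ) : ℝ)) := by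
          refine ⟨ht.1, ht.2, ?_, ?_⟩ <;> push_cast <;> rw [hLdef] at hk <;> linarith [hk.1, hk.2]
        rw [mem_filter, hT, mem_filter]
        exact ⟨⟨hK _ t ht.1 ht.2 hj.2.2.1 hj.2.2.2, dvd_mul_right _ _⟩, hj⟩
      · intro a _ b _ hab
        exact mul_left_cancel₀ (by exact_mod_cast hG.ne') hab
      · intro h hh
        rw [mem_filter, hT, mem_filter] at hh
        obtain ⟨⟨_, k, rfl⟩, hj⟩ := hh
        refine ⟨k, ?_, rfl⟩
        obtain ⟨_, _, j1, j2⟩ := hj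
        push_cast at j1 j2
        rw [mem_Ioc, Int.floor_lt, Int.le_floor, div_lt_iff₀ hL, le_div_iff₀ hL, hLdef]
        constructor <;> linarith
    rw [h1, Int.card_Ioc]
    have hle : ⌊(0 - m * t) / L⌋ ≤ ⌊(X - m * t) / L⌋ := Int.floor_le_floor (by gcongr)
    have h2 : ((⌊(X - m * t) / L⌋ - ⌊(0 - m * t) / L⌋).toNat : ℝ) = ((⌊(X - m * t) / L⌋ - ⌊(0 - m * t) / L⌋ : ℤ) : ℝ) := by
      exact_mod_cast congrArg (Int.cast (R := ℝ)) (Int.toNat_of_nonneg (sub_nonneg.2 hle))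
    rw [h2]; push_cast
    have f1 := Int.self_sub_floor ((X - m * t) / L)
    have f2 := Int.self_sub_floor ((0 - m * t) / L)
    have f3 : (X - m * t) / L - (0 - m * t) / L = X / L := by ring
    linarith
  have hint : ∀ h ∈ T, jv m X (q * h) = ∫ t in Set.Ioc 0 X, (jset m X (q * h)).indicator (fun _ => (1:ℝ)) t := by
    intro h _
    rw [MeasureTheory.setIntegral_indicator (jset_meas _ _ _), MeasureTheory.setIntegral_const, smul_eq_mul, mul_one, ← jv_int m hm X _ hX.le]
    congr 1
    have hs : jset m X (q * h) ⊆ Set.Ioc 0 X := fun t ht => ⟨ht.1, ht.2.1⟩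
    exact (Set.inter_eq_right.2 hs).symm
  have hfi : ∀ c : ℝ, MeasureTheory.IntegrableOn (fun t : ℝ => Int.fract ((c - m * t) / L)) (Set.Ioc 0 X) := by
    intro c
    refine MeasureTheory.Measure.integrableOn_of_bounded (M := 1) (by simp) ?_ ?_
    · exact (measurable_fract.comp (by fun_prop)).aestronglyMeasurable
    · refine Filter.Eventually.of_forall fun t => ?_
      rw [Real.norm_eq_abs, abs_of_nonneg (Int.fract_nonneg _)]
      exact (Int.fract_lt_one _).le
  rw [sum_congr rfl hint, ← MeasureTheory.integral_finset_sum, MeasureTheory.setIntegral_congr_fun measurableSet_Ioc hpt]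
  · have i1 := integral_fract_line X X L m hm hL
    have i2 := integral_fract_line 0 X L m hm hL
    rw [intervalIntegral.integral_of_le hX.le] at i1 i2
    rw [MeasureTheory.integral_add, MeasureTheory.integral_sub, MeasureTheory.setIntegral_const, i1, i2]
    · rw [zero_div, bet_zero, show (0 - m * X) / L = -(m * X / L) by ring, bet_neg,
        show (X - m * X) / L = -((m - 1) * X / L) by ring, bet_neg]
      simp [hX.le]
      ring
    · simp
    · exact hfi X
    · exact (MeasureTheory.integrable_const _).sub (hfi X)
    · exact hfi 0
  · intro h _
    exact ((MeasureTheory.integrable_const (1:ℝ)).indicator (jset_meas _ _ _))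
end

section
open Finset

noncomputable def cset (m : ℤ) (X : ℝ) (q d1 d2 : ℕ) : Finset (ℕ × ℕ) :=
  (Icc 1 ⌊X⌋₊ ×ˢ Icc 1 ⌊X⌋₊).filter (fun p => (Nat.Coprime p.1 q ∧ (q:ℤ) ∣ p.2 - m * p.1) ∧ d1 ^ 2 ∣ p.1 ∧ d2 ^ 2 ∣ p.2)

lemma cop2 {m : ℤ} {q n1 n2 : ℕ} (hc : Int.gcd m q = 1) (h1 : Nat.Coprime n1 q) (h : (q:ℤ) ∣ n2 - m * n1) : Nat.Coprime n2 q := by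
  have h2 : IsCoprime (m * n1) (q:ℤ) := (Int.isCoprime_iff_gcd_eq_one.2 hc).mul_left (Nat.isCoprime_iff_coprime.2 h1)
  obtain ⟨k, hk⟩ := h
  have : (n2:ℤ) = m * n1 + k * q := by linarith
  rw [← Nat.isCoprime_iff_coprime, this]
  exact (IsCoprime.add_mul_right_left_iff).2 h2

lemma NN_eq (m : ℤ) (X : ℝ) (q : ℕ) (hc : Int.gcd m q = 1) :
    NN m X q = ∑ d ∈ Icc 1 ⌊X⌋₊ ×ˢ Icc 1 ⌊X⌋₊, ac q d.1 * ac q d.2 * ((cset m X q d.1 d.2).card : ℝ) := by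
  unfold NN
  rw [← sum_product' (f := fun (n1 n2 : ℕ) => if Nat.Coprime n1 q ∧ (q:ℤ) ∣ n2 - m * n1 then muR n1 ^ 2 * muR n2 ^ 2 else 0)]
  have : ∀ p ∈ Icc 1 ⌊X⌋₊ ×ˢ Icc 1 ⌊X⌋₊, (if Nat.Coprime p.1 q ∧ (q:ℤ) ∣ p.2 - m * p.1 then muR p.1 ^ 2 * muR p.2 ^ 2 else 0) =
      ∑ d ∈ Icc 1 ⌊X⌋₊ ×ˢ Icc 1 ⌊X⌋₊, if (Nat.Coprime p.1 q ∧ (q:ℤ) ∣ p.2 - m * p.1) ∧ d.1 ^ 2 ∣ p.1 ∧ d.2 ^ 2 ∣ p.2 then ac q d.1 * ac q d.2 else 0 := by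
    intro p hp
    rw [mem_product, mem_Icc, mem_Icc] at hp
    split_ifs with h
    · rw [muR_sq p.1 (by omega) _ hp.1.2, muR_sq p.2 (by omega) _ hp.2.2, sum_mul_sum, ← sum_product']
      refine sum_congr rfl fun d _ => ?_
      by_cases h1 : d.1 ^ 2 ∣ p.1
      · by_cases h2 : d.2 ^ 2 ∣ p.2
        · rw [if_pos h1, if_pos h2, if_pos ⟨h, h1, h2⟩, ac_eq h.1 h1, ac_eq (cop2 hc h.1 h.2) h2]
        · simp [h2]
      · simp [h1]
    · simp [h]
  rw [sum_congr rfl this, sum_comm]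
  refine sum_congr rfl fun d _ => ?_
  rw [← sum_filter, sum_const, nsmul_eq_mul, mul_comm, cset]

noncomputable def hset (m : ℤ) (X : ℝ) (q d1 d2 : ℕ) (h : ℤ) : Finset ℕ :=
  (Icc 1 ⌊X⌋₊).filter (fun n => (0 < m * n + q * h ∧ m * n + q * h ≤ ⌊X⌋₊) ∧ (d1:ℤ) ^ 2 ∣ n ∧ (d2:ℤ) ^ 2 ∣ m * n + q * h)

lemma hK_bound (m : ℤ) (X : ℝ) (q : ℕ) (hq : 0 < q) (h : ℤ) (t : ℝ) (h0 : 0 < t) (hX : t ≤ X) (h1 : 0 < m * t + q * h) (h2 : m * t + q * h ≤ X) :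
    h ∈ Icc (-((⌊(|(m:ℝ)| + 1) * (X / q)⌋₊ : ℕ) : ℤ)) (⌊(|(m:ℝ)| + 1) * (X / q)⌋₊ : ℕ) := by
  have hq' : (0:ℝ) < q := by exact_mod_cast hq
  have hb : |(h:ℝ)| ≤ (|(m:ℝ)| + 1) * (X / q) := by
    have e : (|(m:ℝ)| + 1) * (X / q) = (|(m:ℝ)| * X + X) / q := by ring
    rw [e, le_div_iff₀ hq', ← abs_of_pos hq', ← abs_mul]
    have h3 : |m * t| ≤ |(m:ℝ)| * X := by
      rw [abs_mul, abs_of_pos h0]; gcongr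
    rw [abs_le] at h3 ⊢
    constructor <;> linarith [h3.1, h3.2]
  have h4 : h.natAbs ≤ ⌊(|(m:ℝ)| + 1) * (X / q)⌋₊ := by
    refine Nat.le_floor ?_
    rw [Nat.cast_natAbs]; push_cast; exact hb
  rw [mem_Icc]; omega

lemma cset_card (m : ℤ) (X : ℝ) (hX : 0 ≤ X) (q d1 d2 : ℕ) (hq : 0 < q) :
    (cset m X q d1 d2).card = ∑ h ∈ Icc (-((⌊(|(m:ℝ)| + 1) * (X / q)⌋₊ : ℕ) : ℤ)) (⌊(|(m:ℝ)| + 1) * (X / q)⌋₊ : ℕ),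
      ((hset m X q d1 d2 h).filter (fun n => Nat.Coprime n q)).card := by
  have hq0 : (q:ℤ) ≠ 0 := by exact_mod_cast hq.ne'
  rw [card_eq_sum_card_fiberwise (f := fun p : ℕ × ℕ => ((p.2:ℤ) - m * p.1) / q) (t := Icc (-((⌊(|(m:ℝ)| + 1) * (X / q)⌋₊ : ℕ) : ℤ)) (⌊(|(m:ℝ)| + 1) * (X / q)⌋₊ : ℕ))]
  · refine sum_congr rfl fun h _ => ?_
    refine card_bij (fun p _ => p.1) ?_ ?_ ?_
    · intro p hp
      simp only [cset, mem_filter, mem_product, mem_Icc] at hp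
      obtain ⟨⟨⟨hp1, hp2⟩, ⟨hp3, hp4⟩, hp5, hp6⟩, hp7⟩ := hp
      have e : m * p.1 + q * h = (p.2 : ℤ) := by
        rw [← hp7, Int.mul_ediv_cancel' hp4]; ring
      simp only [hset, mem_filter, mem_Icc, e]
      refine ⟨⟨hp1, ⟨by omega, by omega⟩, by exact_mod_cast hp5, by exact_mod_cast hp6⟩, hp3⟩
    · intro p hp p' hp' hh
      simp only [cset, mem_filter, mem_product, mem_Icc] at hp hp'
      obtain ⟨⟨_, ⟨_, hp4⟩, _⟩, hp7⟩ := hp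
      obtain ⟨⟨_, ⟨_, hp4'⟩, _⟩, hp7'⟩ := hp'
      have e : m * p.1 + q * h = (p.2 : ℤ) := by
        rw [← hp7, Int.mul_ediv_cancel' hp4]; ring
      have e' : m * p'.1 + q * h = (p'.2 : ℤ) := by
        rw [← hp7', Int.mul_ediv_cancel' hp4']; ring
      rw [hh, e'] at e
      exact Prod.ext hh (by exact_mod_cast e.symm)
    · intro n hn
      simp only [hset, mem_filter, mem_Icc] at hn
      obtain ⟨⟨hn1, ⟨hn2, hn3⟩, hn4, hn5⟩, hn6⟩ := hn
      obtain ⟨k, hk⟩ := Int.eq_ofNat_of_zero_le hn2.le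
      refine ⟨(n, k), ?_, rfl⟩
      simp only [cset, mem_filter, mem_product, mem_Icc]
      have e : (k:ℤ) - m * n = q * h := by linarith
      rw [e]
      rw [hk] at hn2 hn3 hn5
      exact ⟨⟨⟨hn1, by omega, by omega⟩, ⟨hn6, dvd_mul_right _ _⟩, by exact_mod_cast hn4, by exact_mod_cast hn5⟩, Int.mul_ediv_cancel_left _ hq0⟩
  · intro p hp
    have hp' : p ∈ cset m X q d1 d2 := hp
    simp only [cset, mem_filter, mem_product, mem_Icc] at hp'
    obtain ⟨⟨hp1, hp2⟩, ⟨hp3, hp4⟩, -⟩ := hp'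
    obtain ⟨k, hk⟩ := hp4
    have e : ((p.2:ℤ) - m * p.1) / q = k := by rw [hk]; exact Int.mul_ediv_cancel_left _ hq0
    have e2 : (m:ℝ) * p.1 + q * k = p.2 := by
      have := congrArg (Int.cast (R := ℝ)) hk
      push_cast at this; linarith
    show ((p.2:ℤ) - m * p.1) / q ∈ _
    rw [e]
    refine hK_bound m X q hq k p.1 (by exact_mod_cast hp1.1) ((Nat.le_floor_iff hX).1 hp1.2) ?_ ?_
    · rw [e2]; exact_mod_cast hp2.1
    · rw [e2]; exact (Nat.le_floor_iff hX).1 hp2.2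

lemma hset_count (m : ℤ) (hm : m ≠ 0) (X : ℝ) (hX : 0 < X) (q d1 d2 : ℕ) (hq : q ≠ 0) (hd1 : d1 ≠ 0) (hd2 : d2 ≠ 0) (c1 : Nat.Coprime d1 q) (c2 : Nat.Coprime d2 q) (h : ℤ)
   (hG : ((GG m.natAbs d1 d2 : ℕ) : ℤ) ∣ h) :
    |(((hset m X q d1 d2 h).filter (fun n => Nat.Coprime n q)).card : ℝ) - (q.totient:ℝ) / q * (jv m X (q * h) * ((GG m.natAbs d1 d2 : ℕ) / ((d1:ℝ) ^ 2 * (d2:ℝ) ^ 2)))| ≤ q.divisors.card := by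
  obtain ⟨r, hr⟩ := resid m q d1 d2 hd1 hd2 h hG
  set G := GG m.natAbs d1 d2 with hGdef
  have hGp : 0 < G := GG_pos hd2
  have hGd : G ∣ d2 ^ 2 := Nat.gcd_dvd_right _ _
  have key : ∀ n ∈ hset m X q d1 d2 h, ja m X (q * h) ≤ n ∧ (n:ℝ) ≤ jb m X (q * h) ∧ ((d1 ^ 2 * (d2 ^ 2 / G) : ℕ) : ℤ) ∣ n - r := by
    intro n hn
    simp only [hset, mem_filter, mem_Icc] at hn
    obtain ⟨hn1, ⟨hn2, hn3⟩, hn4⟩ := hn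
    have a2 : (0:ℝ) < m * (n:ℝ) + q * h := by exact_mod_cast hn2
    have a3 : m * (n:ℝ) + q * h ≤ X := by
      have : (m * (n:ℝ) + q * h) ≤ (⌊X⌋₊ : ℝ) := by exact_mod_cast hn3
      exact this.trans (Nat.floor_le hX.le)
    have := j_sub m hm X (q * h) n (by exact_mod_cast hn1.1) ((Nat.le_floor_iff hX.le).1 hn1.2) a2 a3
    exact ⟨this.1, this.2, (hr n).1 hn4⟩
  have key2 : ∀ n : ℕ, ja m X (q * h) < n → (n:ℝ) < jb m X (q * h) → ((d1 ^ 2 * (d2 ^ 2 / G) : ℕ) : ℤ) ∣ n - r → n ∈ hset m X q d1 d2 h := by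
    intro n h1 h2 h3
    obtain ⟨a1, a2, a3, a4⟩ := j_sup m hm X (q * h) n hX.le h1 h2
    simp only [hset, mem_filter, mem_Icc]
    refine ⟨⟨by exact_mod_cast a1, Nat.le_floor a2⟩, ⟨by exact_mod_cast a3, ?_⟩, (hr n).2 h3⟩
    have : (((m * n + q * h : ℤ)) : ℝ) ≤ X := by push_cast; exact a4
    have h5 := Int.le_floor.2 this
    rwa [Int.natCast_floor_eq_floor hX.le]
  have hj0 : 0 ≤ ja m X (q * h) := le_max_left _ _
  rcases le_or_gt (ja m X (q * h)) (jb m X (q * h)) with hle | hlt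
  · have hL : 0 < d1 ^ 2 * (d2 ^ 2 / G) := Nat.mul_pos (by positivity) (Nat.div_pos (Nat.le_of_dvd (by positivity) hGd) hGp)
    have := count_cop q hq _ _ hj0 hle (d1 ^ 2 * (d2 ^ 2 / G)) hL ?_ r _ key key2
    · convert this using 3
      rw [jv, max_eq_left (sub_nonneg.2 hle)]
      rw [Nat.cast_mul, Nat.cast_div hGd (by exact_mod_cast hGp.ne')]
      have : (G:ℝ) ≠ 0 := by exact_mod_cast hGp.ne'
      have : (d1:ℝ) ≠ 0 := by exact_mod_cast hd1
      have : (d2:ℝ) ≠ 0 := by exact_mod_cast hd2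
      push_cast
      field_simp
    · exact (c1.pow_left 2).mul_left ((c2.pow_left 2).coprime_dvd_left (Nat.div_dvd_of_dvd hGd))
  · have : hset m X q d1 d2 h = ∅ := by
      refine eq_empty_of_forall_notMem fun n hn => ?_
      have := key n hn
      linarith [this.1, this.2.1]
    rw [this, jv, max_eq_right (by linarith)]
    simp

noncomputable def mterm (m : ℤ) (X : ℝ) (q d1 d2 : ℕ) : ℝ := (q.totient:ℝ) / q * ((GG m.natAbs d1 d2 : ℕ) / ((d1:ℝ) ^ 2 * (d2:ℝ) ^ 2)) *
  (X ^ 2 / (q * (GG m.natAbs d1 d2 : ℕ)) + (q * (GG m.natAbs d1 d2 : ℕ)) / (2 * m) * (bet (m * X / (q * (GG m.natAbs d1 d2 : ℕ))) + bet (X / (q * (GG m.natAbs d1 d2 : ℕ))) - bet ((m - 1) * X / (q * (GG m.natAbs d1 d2 : ℕ)))))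

lemma cnt_main (m : ℤ) (hm : m ≠ 0) (X : ℝ) (q d1 d2 : ℕ) (hq : q ≠ 0) (hqX : (q:ℝ) ≤ X) (hd1 : d1 ≠ 0) (hd2 : d2 ≠ 0) (c1 : Nat.Coprime d1 q) (c2 : Nat.Coprime d2 q) :
    |((cset m X q d1 d2).card : ℝ) - mterm m X q d1 d2| ≤ (2 * |(m:ℝ)| + 3) * (X / q) * q.divisors.card := by
  have hq' : (0:ℝ) < q := by exact_mod_cast Nat.pos_of_ne_zero hq
  have hX : 0 < X := by linarith
  have hH : 1 ≤ X / q := by rw [le_div_iff₀ hq']; linarith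
  set K := ⌊(|(m:ℝ)| + 1) * (X / q)⌋₊ with hK
  set G := GG m.natAbs d1 d2 with hGdef
  have hGp : 0 < G := GG_pos hd2
  have hGc : Nat.Coprime G q := (c2.pow_left 2).coprime_dvd_left (Nat.gcd_dvd_right _ _)
  have hsv := sum_vol m hm X hX q G K (Nat.pos_of_ne_zero hq) hGp (hK_bound m X q (Nat.pos_of_ne_zero hq))
  have e1 : mterm m X q d1 d2 = ∑ h ∈ Icc (-(K:ℤ)) K, if (G:ℤ) ∣ h then (q.totient:ℝ) / q * (jv m X (q * h) * (G / ((d1:ℝ) ^ 2 * (d2:ℝ) ^ 2))) else 0 := by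
    rw [← sum_filter, ← mul_sum, ← sum_mul, hsv, mterm]
    ring
  rw [cset_card m X hX.le q d1 d2 (Nat.pos_of_ne_zero hq), e1, Nat.cast_sum, ← sum_sub_distrib]
  have hterm : ∀ h ∈ Icc (-(K:ℤ)) K, |(((hset m X q d1 d2 h).filter (fun n => Nat.Coprime n q)).card : ℝ) - (if (G:ℤ) ∣ h then (q.totient:ℝ) / q * (jv m X (q * h) * (G / ((d1:ℝ) ^ 2 * (d2:ℝ) ^ 2))) else 0)| ≤ q.divisors.card := by
    intro h _
    split_ifs with hd
    · exact hset_count m hm X hX q d1 d2 hq hd1 hd2 c1 c2 h hd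
    · have : hset m X q d1 d2 h = ∅ := by
        refine eq_empty_of_forall_notMem fun n hn => hd ?_
        simp only [hset, mem_filter, mem_Icc] at hn
        obtain ⟨_, _, hn4, hn5⟩ := hn
        have g1 : (G:ℤ) ∣ (d2:ℤ) ^ 2 := by exact_mod_cast (Nat.gcd_dvd_right (m.natAbs * d1 ^ 2) (d2 ^ 2) : G ∣ d2 ^ 2)
        have g2 : (G:ℤ) ∣ m * (d1:ℤ) ^ 2 := by
          rw [← Int.natAbs_dvd_natAbs, Int.natAbs_mul, Int.natAbs_pow, Int.natAbs_natCast, Int.natAbs_natCast]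
          exact Nat.gcd_dvd_left _ _
        have g3 : (G:ℤ) ∣ q * h := by
          have := g1.trans hn5
          exact (dvd_add_right (g2.trans (mul_dvd_mul_left _ hn4))).1 this
        exact (Nat.isCoprime_iff_coprime.2 hGc).dvd_of_dvd_mul_left g3
      rw [this]; simp
  refine (abs_sum_le_sum_abs _ _).trans ((sum_le_sum hterm).trans ?_)
  rw [sum_const, nsmul_eq_mul]
  refine mul_le_mul_of_nonneg_right ?_ (by positivity)
  rw [Int.card_Icc]
  have hKle : (K:ℝ) ≤ (|(m:ℝ)| + 1) * (X / q) := Nat.floor_le (by positivity)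
  have : ((K:ℤ) + 1 - -(K:ℤ)).toNat = 2 * K + 1 := by omega
  rw [this]; push_cast
  nlinarith [abs_nonneg (m:ℝ)]
end

section
open Finset

lemma spaced_card {ι : Type*} (V : Finset ι) (ρ : ι → ℝ) (R δ : ℝ) (hδ : 0 < δ) (h0 : ∀ v ∈ V, 0 ≤ ρ v) (h1 : ∀ v ∈ V, ρ v ≤ R)
    (hR : 0 ≤ R) (hs : ∀ v ∈ V, ∀ w ∈ V, v ≠ w → δ ≤ |ρ v - ρ w|) : (V.card : ℝ) ≤ 1 + R / δ := by
  have : V.card ≤ (Finset.range (⌊R / δ⌋₊ + 1)).card := by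
    refine card_le_card_of_injOn (fun v => ⌊ρ v / δ⌋₊) ?_ ?_
    · intro v hv
      have := h1 v hv
      rw [mem_coe, mem_range]
      exact Nat.lt_succ_of_le (Nat.floor_le_floor (by gcongr))
    · intro v hv w hw hvw
      by_contra hne
      have h2 := hs v hv w hw hne
      have hvw' : ⌊ρ v / δ⌋₊ = ⌊ρ w / δ⌋₊ := hvw
      have a1 := Nat.floor_le (div_nonneg (h0 v hv) hδ.le)
      have a2 := Nat.lt_floor_add_one (ρ v / δ)
      have a3 := Nat.floor_le (div_nonneg (h0 w hw) hδ.le)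
      have a4 := Nat.lt_floor_add_one (ρ w / δ)
      rw [hvw'] at a1 a2
      have h3 : |ρ v / δ - ρ w / δ| < 1 := by rw [abs_lt]; constructor <;> linarith
      rw [← sub_div, abs_div, abs_of_pos hδ, div_lt_one hδ] at h3
      linarith
  rw [card_range] at this
  have h2 : (V.card : ℝ) ≤ ⌊R / δ⌋₊ + 1 := by exact_mod_cast this
  linarith [Nat.floor_le (div_nonneg hR hδ.le)]

lemma ratio_card (V : Finset (ℕ × ℕ)) (q : ℕ) (hq : q ≠ 0) (A1 A2 : ℝ) (h1 : 0 < A1) (h2 : 0 < A2)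
    (hV : ∀ v ∈ V, 0 < v.1 ∧ (v.1:ℝ) ≤ A1 ∧ 0 < v.2 ∧ (v.2:ℝ) ≤ A2)
    (hd : ∀ v ∈ V, ∀ w ∈ V, v ≠ w → (q:ℤ) ≤ 2 * |(v.2:ℤ) * w.1 - v.1 * w.2|) :
    (V.card : ℝ) ≤ 2 * (1 + 2 * A1 * A2 / q) := by
  have hq' : (0:ℝ) < q := by exact_mod_cast Nat.pos_of_ne_zero hq
  have hd' : ∀ v ∈ V, ∀ w ∈ V, v ≠ w → (q:ℝ) ≤ 2 * |(v.2:ℝ) * w.1 - v.1 * w.2| := by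
    intro v hv w hw hne; exact_mod_cast hd v hv w hw hne
  have b1 : (((V.filter (fun v => (v.2:ℝ) / v.1 ≤ A2 / A1)).card : ℕ) : ℝ) ≤ 1 + (A2 / A1) / (q / (2 * A1 ^ 2)) := by
    refine spaced_card _ (fun v => (v.2:ℝ) / v.1) _ _ (by positivity) (fun v _ => by positivity) (fun v hv => (mem_filter.1 hv).2) (by positivity) ?_
    intro v hv w hw hne
    have hv := (mem_filter.1 hv).1
    have hw := (mem_filter.1 hw).1
    obtain ⟨v1, v2, v3, v4⟩ := hV v hv
    obtain ⟨w1, w2, w3, w4⟩ := hV w hw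
    have h := hd' v hv w hw hne
    have v1' : (0:ℝ) < v.1 := by exact_mod_cast v1
    have w1' : (0:ℝ) < w.1 := by exact_mod_cast w1
    show _ ≤ |(v.2:ℝ) / v.1 - w.2 / w.1|
    rw [div_sub_div _ _ v1'.ne' w1'.ne', abs_div, abs_of_pos (mul_pos v1' w1'), ← div_div]
    have hle : (v.1:ℝ) * w.1 ≤ A1 ^ 2 := by rw [sq]; gcongr
    refine div_le_div₀ (abs_nonneg _) (by linarith) (mul_pos v1' w1') hle
  have b2 : (((V.filter (fun v => ¬ (v.2:ℝ) / v.1 ≤ A2 / A1)).card : ℕ) : ℝ) ≤ 1 + (A1 / A2) / (q / (2 * A2 ^ 2)) := by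
    refine spaced_card _ (fun v => (v.1:ℝ) / v.2) _ _ (by positivity) (fun v _ => by positivity) (fun v hv => ?_) (by positivity) ?_
    · obtain ⟨hv, h⟩ := mem_filter.1 hv
      obtain ⟨v1, v2, v3, v4⟩ := hV v hv
      have v1' : (0:ℝ) < v.1 := by exact_mod_cast v1
      have v3' : (0:ℝ) < v.2 := by exact_mod_cast v3
      push Not at h
      rw [div_lt_div_iff₀ h1 v1'] at h
      show (v.1:ℝ) / v.2 ≤ _
      rw [div_le_div_iff₀ v3' h2]; linarith
    intro v hv w hw hne
    have hv := (mem_filter.1 hv).1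
    have hw := (mem_filter.1 hw).1
    obtain ⟨v1, v2, v3, v4⟩ := hV v hv
    obtain ⟨w1, w2, w3, w4⟩ := hV w hw
    have h := hd' v hv w hw hne
    have v1' : (0:ℝ) < v.2 := by exact_mod_cast v3
    have w1' : (0:ℝ) < w.2 := by exact_mod_cast w3
    show _ ≤ |(v.1:ℝ) / v.2 - w.1 / w.2|
    rw [div_sub_div _ _ v1'.ne' w1'.ne', abs_div, abs_of_pos (mul_pos v1' w1'), ← div_div, abs_sub_comm]
    have hle : (v.2:ℝ) * w.2 ≤ A2 ^ 2 := by rw [sq]; gcongr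
    refine div_le_div₀ (abs_nonneg _) (by linarith) (mul_pos v1' w1') hle
  have e1 : (A2 / A1) / (q / (2 * A1 ^ 2)) = 2 * A1 * A2 / q := by field_simp
  have e2 : (A1 / A2) / (q / (2 * A2 ^ 2)) = 2 * A1 * A2 / q := by field_simp
  have hc := card_filter_add_card_filter_not (s := V) (fun v : ℕ × ℕ => (v.2:ℝ) / v.1 ≤ A2 / A1)
  have hc' : (V.card : ℝ) = ((V.filter (fun v => (v.2:ℝ) / v.1 ≤ A2 / A1)).card : ℝ) + ((V.filter (fun v => ¬ (v.2:ℝ) / v.1 ≤ A2 / A1)).card : ℝ) := by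
    exact_mod_cast hc.symm
  rw [e1] at b1; rw [e2] at b2
  linarith

lemma det_ne {v w : ℕ × ℕ} (hv : Nat.Coprime v.1 v.2) (hw : Nat.Coprime w.1 w.2) (hne : v ≠ w) : (v.2:ℤ) * w.1 - v.1 * w.2 ≠ 0 := by
  intro h
  have h' : v.2 * w.1 = v.1 * w.2 := by
    have : (v.2:ℤ) * w.1 = v.1 * w.2 := by linarith
    exact_mod_cast this
  apply hne
  have a1 : v.1 ∣ w.1 := hv.dvd_of_dvd_mul_left (Dvd.intro _ h'.symm)
  have a2 : w.1 ∣ v.1 := hw.dvd_of_dvd_mul_right (Dvd.intro_left _ h')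
  have b1 : v.2 ∣ w.2 := hv.symm.dvd_of_dvd_mul_left (Dvd.intro _ h')
  have b2 : w.2 ∣ v.2 := hw.symm.dvd_of_dvd_mul_right (Dvd.intro_left _ h'.symm)
  exact Prod.ext (Nat.dvd_antisymm a1 a2) (Nat.dvd_antisymm b1 b2)

lemma W_card (m : ℤ) (q : ℕ) (hq : q ≠ 0) (k1 k2 : ℕ) (hk2 : Nat.Coprime k2 q) (A1 A2 : ℝ) (h1 : 0 < A1) (h2 : 0 < A2) (W : Finset (ℕ × ℕ))
    (hW : ∀ v ∈ W, 0 < v.1 ∧ (v.1:ℝ) ≤ A1 ∧ 0 < v.2 ∧ (v.2:ℝ) ≤ A2)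
    (hW2 : ∀ v ∈ W, Nat.Coprime v.1 v.2 ∧ Nat.Coprime v.1 q ∧ Nat.Coprime v.2 q ∧ (q:ℤ) ∣ (v.2:ℤ) ^ 2 * k2 - m * ((v.1:ℤ) ^ 2 * k1)) :
    (W.card : ℝ) ≤ q.divisors.card * (2 * (1 + 2 * A1 * A2 / q)) := by
  rcases W.eq_empty_or_nonempty with rfl | ⟨u, hu⟩
  · simp; positivity
  obtain ⟨u1, u2, u3, u4⟩ := hW2 u hu
  set a := u.1
  set b := u.2
  have hAB : ∀ v ∈ W, (q:ℤ) ∣ ((v.2:ℤ) * a - b * v.1) * (v.2 * a + b * v.1) := by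
    intro v hv
    obtain ⟨_, _, _, v4⟩ := hW2 v hv
    have : (q:ℤ) ∣ k2 * (((v.2:ℤ) * a - b * v.1) * (v.2 * a + b * v.1)) := by
      have e : (k2:ℤ) * (((v.2:ℤ) * a - b * v.1) * (v.2 * a + b * v.1)) =
        ((v.2:ℤ) ^ 2 * k2 - m * ((v.1:ℤ) ^ 2 * k1)) * a ^ 2 - ((b:ℤ) ^ 2 * k2 - m * ((a:ℤ) ^ 2 * k1)) * v.1 ^ 2 := by ring
      rw [e]
      exact dvd_sub (v4.mul_right _) (u4.mul_right _)
    exact (Nat.isCoprime_iff_coprime.2 hk2.symm).dvd_of_dvd_mul_left this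
  rw [card_eq_sum_card_fiberwise (f := fun v : ℕ × ℕ => Int.gcd ((v.2:ℤ) * a - b * v.1) q) (t := q.divisors)]
  · rw [Nat.cast_sum]
    refine (sum_le_card_nsmul _ _ (2 * (1 + 2 * A1 * A2 / q)) fun d hd => ?_).trans (by rw [nsmul_eq_mul])
    refine ratio_card _ q hq A1 A2 h1 h2 (fun v hv => hW v (mem_filter.1 hv).1) ?_
    intro v hv w hw hne
    obtain ⟨hv, lv⟩ := mem_filter.1 hv
    obtain ⟨hw, lw⟩ := mem_filter.1 hw
    have hdet := det_ne (hW2 v hv).1 (hW2 w hw).1 hne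
    have hd0 : d ≠ 0 := (Nat.pos_of_mem_divisors hd).ne'
    obtain ⟨e, he⟩ := Nat.dvd_of_mem_divisors hd
    have key : ∀ v ∈ W, Int.gcd ((v.2:ℤ) * a - b * v.1) q = d → (d:ℤ) ∣ ((v.2:ℤ) * a - b * v.1) ∧ (e:ℤ) ∣ (v.2 * a + b * v.1) := by
      intro v hv hl
      have c1 : (d:ℤ) ∣ ((v.2:ℤ) * a - b * v.1) := by rw [← hl]; exact Int.gcd_dvd_left ..
      refine ⟨c1, ?_⟩
      obtain ⟨x, hx⟩ := c1
      have hq2 : (q:ℤ) = d * e := by exact_mod_cast he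
      have h3 := hAB v hv
      rw [hx, hq2, mul_assoc, mul_dvd_mul_iff_left (by exact_mod_cast hd0)] at h3
      have h4 : IsCoprime (e:ℤ) x := by
        rw [hx, hq2, Int.gcd_mul_left, Int.natAbs_natCast] at hl
        rw [Int.isCoprime_iff_gcd_eq_one, Int.gcd_comm]
        exact Nat.eq_of_mul_eq_mul_left (Nat.pos_of_ne_zero hd0) (by linarith)
      exact h4.dvd_of_dvd_mul_left h3
    obtain ⟨x1, x2⟩ := key v hv lv
    obtain ⟨y1, y2⟩ := key w hw lw
    have hq2 : (q:ℤ) = d * e := by exact_mod_cast he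
    have hdv : (q:ℤ) ∣ (a * b : ℤ) * (2 * ((v.2:ℤ) * w.1 - v.1 * w.2)) := by
      have e1 : (a * b : ℤ) * (2 * ((v.2:ℤ) * w.1 - v.1 * w.2)) = ((v.2:ℤ) * a - b * v.1) * (w.2 * a + b * w.1) - ((w.2:ℤ) * a - b * w.1) * (v.2 * a + b * v.1) := by ring
      rw [e1, hq2]
      exact dvd_sub (mul_dvd_mul x1 y2) (mul_dvd_mul y1 x2)
    have hcop : IsCoprime (q:ℤ) ((a:ℤ) * b) := (Nat.isCoprime_iff_coprime.2 u2.symm).mul_right (Nat.isCoprime_iff_coprime.2 u3.symm)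
    have h5 := hcop.dvd_of_dvd_mul_left hdv
    have h6 := Int.le_of_dvd (abs_pos.2 (mul_ne_zero two_ne_zero hdet)) ((dvd_abs _ _).2 h5)
    rwa [abs_mul, abs_two] at h6
  · intro v hv
    rw [mem_coe, Nat.mem_divisors]
    exact ⟨by exact_mod_cast Int.gcd_dvd_right ((v.2:ℤ) * a - b * v.1) q, hq⟩
end

section
open Finset

lemma rk1 {g κ P η : ℝ} (hg : 1 ≤ g) (hκ : 1 ≤ κ) (hP : 0 < P) (hη : 0 < η) (h : g ^ 2 * κ < P ^ 2) :
    1 ≤ P ^ (2 + 2 * η) * (1 / (g ^ (1 + η) * κ ^ (1 + η))) := by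
  have e : P ^ (2 + 2 * η) = (P ^ 2) ^ (1 + η) := by
    rw [← Real.rpow_natCast, ← Real.rpow_mul hP.le]; congr 1; push_cast; ring
  rw [mul_one_div, le_div_iff₀ (by positivity), one_mul, ← Real.mul_rpow (by linarith) (by linarith), e]
  refine Real.rpow_le_rpow (by positivity) ?_ (by linarith)
  refine le_trans ?_ h.le
  gcongr
  nlinarith

lemma rk2 {g κ P η : ℝ} (hg : 1 ≤ g) (hκ : 1 ≤ κ) (hP : 0 < P) (hη : 0 < η) (hη1 : η ≤ 1) (h : g ^ 2 * κ < P ^ 2) :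
    1 / (g ^ 2 * Real.sqrt κ) ≤ P ^ (1 + 2 * η) * (1 / (g ^ (1 + η) * κ ^ (1 + η))) := by
  have e : P ^ (1 + 2 * η) = (P ^ 2) ^ (1/2 + η) := by
    rw [← Real.rpow_natCast, ← Real.rpow_mul hP.le]; congr 1; push_cast; ring
  have h1 : κ ^ (1/2 + η) ≤ P ^ (1 + 2 * η) := by
    rw [e]
    refine Real.rpow_le_rpow (by positivity) ?_ (by linarith)
    have : 1 ≤ g ^ 2 := by nlinarith
    nlinarith
  have h2 : g ^ (1 + η) ≤ g ^ 2 := by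
    rw [← Real.rpow_natCast]
    exact Real.rpow_le_rpow_of_exponent_le hg (by push_cast; linarith)
  have h3 : κ ^ (1 + η) = Real.sqrt κ * κ ^ (1/2 + η) := by
    rw [Real.sqrt_eq_rpow, ← Real.rpow_add (by linarith)]; congr 1; ring
  have hs : 0 < Real.sqrt κ := Real.sqrt_pos.2 (by linarith)
  have hg0 : 0 < g := by linarith
  rw [mul_one_div, div_le_div_iff₀ (by positivity) (by positivity), one_mul, h3]
  calc g ^ (1 + η) * (Real.sqrt κ * κ ^ (1/2 + η)) ≤ g ^ 2 * (Real.sqrt κ * P ^ (1 + 2 * η)) := by gcongr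
    _ = _ := by ring

noncomputable def Wset (m : ℤ) (X : ℝ) (q : ℕ) (t : ℕ × ℕ × ℕ) : Finset (ℕ × ℕ) :=
  (Icc 1 ⌊X⌋₊ ×ˢ Icc 1 ⌊X⌋₊).filter (fun v => (Nat.Coprime v.1 v.2 ∧ Nat.Coprime v.1 q ∧ Nat.Coprime v.2 q ∧ (q:ℤ) ∣ (v.2:ℤ) ^ 2 * t.2.2 - m * ((v.1:ℤ) ^ 2 * t.2.1)) ∧
    ((t.1:ℝ) ^ 2 * (v.1:ℝ) ^ 2 * t.2.1 ≤ X ∧ (t.1:ℝ) ^ 2 * (v.2:ℝ) ^ 2 * t.2.2 ≤ X))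

noncomputable def Iset (X y : ℝ) (q : ℕ) : Finset (ℕ × ℕ × ℕ) :=
  (Icc 1 ⌊X⌋₊ ×ˢ Icc 1 ⌊X⌋₊ ×ˢ Icc 1 ⌊X⌋₊).filter (fun t => Nat.Coprime t.2.2 q ∧ (t.1:ℝ) ^ 2 * ((t.2.1:ℝ) * t.2.2) < (X / y) ^ 2)

lemma T_inj (m : ℤ) (X y : ℝ) (q : ℕ) (hX : 0 < X) (hy : 0 < y) (hc : Int.gcd m q = 1) :
    ∑ d ∈ (Icc 1 ⌊X⌋₊ ×ˢ Icc 1 ⌊X⌋₊).filter (fun d : ℕ × ℕ => y < (Nat.lcm d.1 d.2 : ℕ)), (cset m X q d.1 d.2).card ≤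
      ∑ t ∈ Iset X y q, (Wset m X q t).card := by
  rw [← card_sigma, ← card_sigma]
  refine card_le_card_of_injOn (fun z : (_ : ℕ × ℕ) × (ℕ × ℕ) => (⟨(Nat.gcd z.1.1 z.1.2, z.2.1 / z.1.1 ^ 2, z.2.2 / z.1.2 ^ 2), (z.1.1 / Nat.gcd z.1.1 z.1.2, z.1.2 / Nat.gcd z.1.1 z.1.2)⟩ : (_ : ℕ × ℕ × ℕ) × (ℕ × ℕ))) ?_ ?_
  · rintro ⟨⟨d1, d2⟩, ⟨n1, n2⟩⟩ hz
    rw [mem_coe, mem_sigma] at hz ⊢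
    simp only [cset, mem_filter, mem_product, mem_Icc] at hz
    obtain ⟨⟨⟨⟨hd1, hd1'⟩, ⟨hd2, hd2'⟩⟩, hl⟩, ⟨⟨hn1, hn1'⟩, ⟨hn2, hn2'⟩⟩, ⟨c1, hdv⟩, ⟨k1, hk1⟩, ⟨k2, hk2⟩⟩ := hz
    have c2 := cop2 hc c1 hdv
    have hg : 0 < Nat.gcd d1 d2 := Nat.gcd_pos_of_pos_left _ hd1
    obtain ⟨g, e1, e2, hg', hcop, he1, he2⟩ := Nat.exists_coprime' hg
    have hgg : Nat.gcd d1 d2 = g := by rw [he1, he2, Nat.gcd_mul_right, hcop.gcd_eq_one, one_mul]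
    have hlcm : Nat.lcm d1 d2 = g * (e1 * e2) := by
      rw [he1, he2, Nat.lcm_mul_right, hcop.lcm_eq_mul]; ring
    rw [hlcm] at hl
    have hd1s : n1 / d1 ^ 2 = k1 := by rw [hk1]; exact Nat.mul_div_cancel_left _ (by positivity)
    have hd2s : n2 / d2 ^ 2 = k2 := by rw [hk2]; exact Nat.mul_div_cancel_left _ (by positivity)
    have h1e : d1 / g = e1 := by rw [he1]; exact Nat.mul_div_cancel _ hg'
    have h2e : d2 / g = e2 := by rw [he2]; exact Nat.mul_div_cancel _ hg'
    simp only [hgg, hd1s, hd2s, h1e, h2e, Iset, Wset, mem_filter, mem_product, mem_Icc]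
    have hk1p : 0 < k1 := Nat.pos_of_ne_zero (by rintro rfl; simp at hk1; omega)
    have hk2p : 0 < k2 := Nat.pos_of_ne_zero (by rintro rfl; simp at hk2; omega)
    have he1p : 0 < e1 := Nat.pos_of_ne_zero (by rintro rfl; simp at he1; omega)
    have he2p : 0 < e2 := Nat.pos_of_ne_zero (by rintro rfl; simp at he2; omega)
    have d1n : d1 ^ 2 ∣ n1 := Dvd.intro _ hk1.symm
    have d2n : d2 ^ 2 ∣ n2 := Dvd.intro _ hk2.symm
    have cd1 : Nat.Coprime d1 q := c1.coprime_dvd_left ((dvd_pow_self d1 two_ne_zero).trans d1n)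
    have cd2 : Nat.Coprime d2 q := c2.coprime_dvd_left ((dvd_pow_self d2 two_ne_zero).trans d2n)
    have cg : Nat.Coprime g q := cd1.coprime_dvd_left (Dvd.intro_left _ he1.symm)
    have hn1X : (n1:ℝ) ≤ X := (Nat.le_floor_iff hX.le).1 hn1'
    have hn2X : (n2:ℝ) ≤ X := (Nat.le_floor_iff hX.le).1 hn2'
    have E1 : (g:ℝ) ^ 2 * (e1:ℝ) ^ 2 * k1 = n1 := by rw [hk1, he1]; push_cast; ring
    have E2 : (g:ℝ) ^ 2 * (e2:ℝ) ^ 2 * k2 = n2 := by rw [hk2, he2]; push_cast; ring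
    have g1 : g ≤ d1 := by rw [he1]; exact Nat.le_mul_of_pos_left _ he1p
    have g2 : e1 ≤ d1 := by rw [he1]; exact Nat.le_mul_of_pos_right _ hg'
    have g3 : e2 ≤ d2 := by rw [he2]; exact Nat.le_mul_of_pos_right _ hg'
    have g4 : k1 ≤ n1 := by rw [hk1]; exact Nat.le_mul_of_pos_left _ (by positivity)
    have g5 : k2 ≤ n2 := by rw [hk2]; exact Nat.le_mul_of_pos_left _ (by positivity)
    refine ⟨⟨⟨⟨hg', by omega⟩, ⟨hk1p, by omega⟩, ⟨hk2p, by omega⟩⟩, c2.coprime_dvd_left (Dvd.intro_left _ hk2.symm), ?_⟩,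
      ⟨⟨he1p, by omega⟩, ⟨he2p, by omega⟩⟩, ⟨hcop, cd1.coprime_dvd_left (Dvd.intro _ he1.symm), cd2.coprime_dvd_left (Dvd.intro _ he2.symm), ?_⟩, by rw [E1]; exact hn1X, by rw [E2]; exact hn2X⟩
    · rw [div_pow, lt_div_iff₀ (by positivity)]
      have hl2 : y ^ 2 < ((g * (e1 * e2) : ℕ) : ℝ) ^ 2 := by gcongr
      push_cast at hl2
      have hp : (0:ℝ) < (g:ℝ) ^ 2 * ((k1:ℝ) * k2) := by positivity
      calc (g:ℝ) ^ 2 * ((k1:ℝ) * k2) * y ^ 2 < (g:ℝ) ^ 2 * ((k1:ℝ) * k2) * ((g:ℝ) * (e1 * e2)) ^ 2 := by gcongr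
        _ = ((g:ℝ) ^ 2 * (e1:ℝ) ^ 2 * k1) * ((g:ℝ) ^ 2 * (e2:ℝ) ^ 2 * k2) := by ring
        _ = n1 * n2 := by rw [E1, E2]
        _ ≤ X * X := by gcongr
        _ = X ^ 2 := by ring
    · have : (n2:ℤ) - m * n1 = (g:ℤ) ^ 2 * ((e2:ℤ) ^ 2 * k2 - m * ((e1:ℤ) ^ 2 * k1)) := by
        rw [hk2, hk1, he1, he2]; push_cast; ring
      rw [this] at hdv
      exact (Nat.isCoprime_iff_coprime.2 cg.symm).pow_right.dvd_of_dvd_mul_left hdv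
  · rintro ⟨⟨d1, d2⟩, ⟨n1, n2⟩⟩ hz ⟨⟨d1', d2'⟩, ⟨n1', n2'⟩⟩ hz' heq
    rw [mem_coe, mem_sigma] at hz hz'
    simp only [cset, mem_filter, mem_product, mem_Icc] at hz hz'
    obtain ⟨⟨⟨⟨hd1, _⟩, _⟩, _⟩, _, _, hk1, hk2⟩ := hz
    obtain ⟨⟨⟨⟨hd1', _⟩, _⟩, _⟩, _, _, hk1', hk2'⟩ := hz'
    simp only [Sigma.mk.injEq, Prod.mk.injEq, heq_eq_eq] at heq
    obtain ⟨⟨a1, a2, a3⟩, a4, a5⟩ := heq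
    have b1 : d1 = d1' := by
      rw [← Nat.div_mul_cancel (Nat.gcd_dvd_left d1 d2), a4, a1, Nat.div_mul_cancel (Nat.gcd_dvd_left d1' d2')]
    have b2 : d2 = d2' := by
      rw [← Nat.div_mul_cancel (Nat.gcd_dvd_right d1 d2), a5, a1, Nat.div_mul_cancel (Nat.gcd_dvd_right d1' d2')]
    subst b1 b2
    have b3 : n1 = n1' := by rw [← Nat.div_mul_cancel hk1, a2, Nat.div_mul_cancel hk1']
    have b4 : n2 = n2' := by rw [← Nat.div_mul_cancel hk2, a3, Nat.div_mul_cancel hk2']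
    rw [b3, b4]

lemma T_bound (η : ℝ) (hη : 0 < η) (hη1 : η ≤ 1) : ∃ C : ℝ, 0 < C ∧ ∀ (m : ℤ) (X y : ℝ) (q : ℕ), 0 < X → 0 < y → q ≠ 0 → Int.gcd m q = 1 →
    ∑ d ∈ (Icc 1 ⌊X⌋₊ ×ˢ Icc 1 ⌊X⌋₊).filter (fun d : ℕ × ℕ => y < (Nat.lcm d.1 d.2 : ℕ)), ((cset m X q d.1 d.2).card : ℝ) ≤
      C * q.divisors.card * ((X / y) ^ (2 + 2 * η) + X / q * (X / y) ^ (1 + 2 * η)) := by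
  have hs : Summable (fun n : ℕ => 1 / (n:ℝ) ^ (1 + η)) := Real.summable_one_div_nat_rpow.2 (by linarith)
  set f : ℕ → ℝ := fun n => 1 / (n:ℝ) ^ (1 + η) with hf
  have hf0 : ∀ n, 0 ≤ f n := fun n => by rw [hf]; positivity
  set S := ∑' n, f n with hS
  have hS0 : 0 ≤ S := tsum_nonneg hf0
  refine ⟨4 * S ^ 3 + 1, by positivity, ?_⟩
  intro m X y q hX hy hq hc
  have hP : 0 < X / y := by positivity
  set P := X / y with hPdef
  have hq' : (0:ℝ) < q := by exact_mod_cast Nat.pos_of_ne_zero hq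
  set B := P ^ (2 + 2 * η) + X / q * P ^ (1 + 2 * η) with hB
  have hB0 : 0 ≤ B := by positivity
  have hterm : ∀ t ∈ Iset X y q, ((Wset m X q t).card : ℝ) ≤ q.divisors.card * (4 * B) * (f t.1 * (f t.2.1 * f t.2.2)) := by
    intro t ht
    simp only [Iset, mem_filter, mem_product, mem_Icc] at ht
    obtain ⟨⟨⟨g0, _⟩, ⟨k10, _⟩, ⟨k20, _⟩⟩, hco, hlt⟩ := ht
    have g1 : (1:ℝ) ≤ t.1 := by exact_mod_cast g0
    have k1 : (1:ℝ) ≤ t.2.1 := by exact_mod_cast k10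
    have k2 : (1:ℝ) ≤ t.2.2 := by exact_mod_cast k20
    have hκ : (1:ℝ) ≤ (t.2.1:ℝ) * t.2.2 := by nlinarith
    have r1 := rk1 g1 hκ hP hη hlt
    have r2 := rk2 g1 hκ hP hη hη1 hlt
    have ef : f t.1 * (f t.2.1 * f t.2.2) = 1 / ((t.1:ℝ) ^ (1 + η) * ((t.2.1:ℝ) * t.2.2) ^ (1 + η)) := by
      have q1 : (0:ℝ) ≤ t.2.1 := by linarith
      have q2 : (0:ℝ) ≤ t.2.2 := by linarith
      rw [hf, Real.mul_rpow q1 q2]; simp only []; field_simp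
    rw [← ef] at r1 r2
    have p1 : 0 < X / ((t.1:ℝ) ^ 2 * t.2.1) := by positivity
    have p2 : 0 < X / ((t.1:ℝ) ^ 2 * t.2.2) := by positivity
    have hw := W_card m q hq t.2.1 t.2.2 hco (Real.sqrt (X / ((t.1:ℝ) ^ 2 * t.2.1))) (Real.sqrt (X / ((t.1:ℝ) ^ 2 * t.2.2)))
      (Real.sqrt_pos.2 p1) (Real.sqrt_pos.2 p2) (Wset m X q t) ?_ ?_
    · refine hw.trans ?_
      rw [mul_assoc (q.divisors.card : ℝ) (4 * B)]
      refine mul_le_mul_of_nonneg_left ?_ (by positivity)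
      have e1 : 2 * Real.sqrt (X / ((t.1:ℝ) ^ 2 * t.2.1)) * Real.sqrt (X / ((t.1:ℝ) ^ 2 * t.2.2)) / q = 2 * (X / q) * (1 / ((t.1:ℝ) ^ 2 * Real.sqrt ((t.2.1:ℝ) * t.2.2))) := by
        rw [mul_assoc, ← Real.sqrt_mul p1.le]
        have : X / ((t.1:ℝ) ^ 2 * t.2.1) * (X / ((t.1:ℝ) ^ 2 * t.2.2)) = (X / (t.1:ℝ) ^ 2) ^ 2 / ((t.2.1:ℝ) * t.2.2) := by
          field_simp
        rw [this, Real.sqrt_div (by positivity), Real.sqrt_sq (by positivity)]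
        have : Real.sqrt ((t.2.1:ℝ) * t.2.2) ≠ 0 := (Real.sqrt_pos.2 (by linarith)).ne'
        field_simp
      rw [e1]
      have h3 : X / q * (1 / ((t.1:ℝ) ^ 2 * Real.sqrt ((t.2.1:ℝ) * t.2.2))) ≤ X / q * (P ^ (1 + 2 * η) * (f t.1 * (f t.2.1 * f t.2.2))) := by gcongr
      have h4 : 0 ≤ P ^ (2 + 2 * η) * (f t.1 * (f t.2.1 * f t.2.2)) := by linarith
      rw [hB]
      nlinarith
    · intro v hv
      simp only [Wset, mem_filter, mem_product, mem_Icc] at hv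
      obtain ⟨⟨⟨v1, _⟩, ⟨v2, _⟩⟩, _, v3, v4⟩ := hv
      refine ⟨v1, Real.le_sqrt_of_sq_le ?_, v2, Real.le_sqrt_of_sq_le ?_⟩
      · rw [le_div_iff₀ (by positivity)]; linarith
      · rw [le_div_iff₀ (by positivity)]; linarith
    · intro v hv
      exact (mem_filter.1 hv).2.1
  have h1 : ∑ d ∈ (Icc 1 ⌊X⌋₊ ×ˢ Icc 1 ⌊X⌋₊).filter (fun d : ℕ × ℕ => y < (Nat.lcm d.1 d.2 : ℕ)), ((cset m X q d.1 d.2).card : ℝ) ≤ ∑ t ∈ Iset X y q, ((Wset m X q t).card : ℝ) := by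
    exact_mod_cast T_inj m X y q hX hy hc
  refine h1.trans ((sum_le_sum hterm).trans ?_)
  rw [← mul_sum]
  have h2 : ∑ t ∈ Iset X y q, f t.1 * (f t.2.1 * f t.2.2) ≤ S ^ 3 := by
    calc _ ≤ ∑ t ∈ Icc 1 ⌊X⌋₊ ×ˢ Icc 1 ⌊X⌋₊ ×ˢ Icc 1 ⌊X⌋₊, f t.1 * (f t.2.1 * f t.2.2) :=
          sum_le_sum_of_subset_of_nonneg (filter_subset _ _) fun t _ _ => mul_nonneg (hf0 _) (mul_nonneg (hf0 _) (hf0 _))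
      _ = (∑ n ∈ Icc 1 ⌊X⌋₊, f n) ^ 3 := by
          rw [sum_product]
          simp only [sum_product]
          simp_rw [← mul_sum, ← sum_mul]
          ring
      _ ≤ S ^ 3 := pow_le_pow_left₀ (sum_nonneg fun n _ => hf0 n) (hs.sum_le_tsum _ fun n _ => hf0 n) 3
  have h3 : 0 ≤ (q.divisors.card : ℝ) * (4 * B) := by positivity
  calc _ ≤ (q.divisors.card : ℝ) * (4 * B) * S ^ 3 := mul_le_mul_of_nonneg_left h2 h3
    _ ≤ _ := by
      have : 0 ≤ (q.divisors.card : ℝ) * B := by positivity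
      nlinarith
end

section
open Finset

lemma mterm_le (m : ℤ) (hm : m ≠ 0) (X : ℝ) (q d1 d2 : ℕ) (hq : q ≠ 0) (hqX : (q:ℝ) ≤ X) (hd1 : d1 ≠ 0) (hd2 : d2 ≠ 0) :
    |mterm m X q d1 d2| ≤ (2 * |(m:ℝ)| + 1) * X * (X / q) * (1 / ((Nat.lcm d1 d2 : ℕ) : ℝ) ^ (2:ℝ)) := by
  have hq' : (0:ℝ) < q := by exact_mod_cast Nat.pos_of_ne_zero hq
  have hX : 0 < X := by linarith
  have hH : 1 ≤ X / q := by rw [le_div_iff₀ hq']; linarith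
  have hM : m.natAbs ≠ 0 := Int.natAbs_ne_zero.2 hm
  have hGd := GG_div_le hM d1 d2
  have hGp : 0 < GG m.natAbs d1 d2 := GG_pos hd2
  unfold mterm
  have hMM : ((m.natAbs : ℕ) : ℝ) = |(m:ℝ)| := by rw [Nat.cast_natAbs]; push_cast; rfl
  rw [hMM] at hGd
  have hm1 : 1 ≤ |(m:ℝ)| := by exact_mod_cast Int.one_le_abs hm
  have hm1' : |(m:ℝ) - 1| ≤ |(m:ℝ)| + 1 := by
    have := abs_sub (m:ℝ) 1
    simpa using this
  have hlcm : 1 / ((d1:ℝ) ^ 2 * (d2:ℝ) ^ 2) ≤ 1 / ((Nat.lcm d1 d2 : ℕ) : ℝ) ^ (2:ℝ) := by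
    have h0 : 0 < Nat.lcm d1 d2 := Nat.lcm_pos (Nat.pos_of_ne_zero hd1) (Nat.pos_of_ne_zero hd2)
    have h1 : Nat.lcm d1 d2 ≤ d1 * d2 := Nat.le_of_dvd (by positivity) (Nat.lcm_dvd (dvd_mul_right _ _) (dvd_mul_left _ _))
    have h2 : ((Nat.lcm d1 d2 : ℕ) : ℝ) ≤ d1 * d2 := by exact_mod_cast h1
    have h3 : (0:ℝ) < (Nat.lcm d1 d2 : ℕ) := by exact_mod_cast h0
    rw [show (2:ℝ) = ((2:ℕ):ℝ) by norm_num, Real.rpow_natCast, ← mul_pow]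
    gcongr
  set G : ℝ := ((GG m.natAbs d1 d2 : ℕ) : ℝ) with hG
  have hG0 : 0 < G := by rw [hG]; exact_mod_cast hGp
  set l := 1 / ((Nat.lcm d1 d2 : ℕ) : ℝ) ^ (2:ℝ) with hl
  have hl0 : 0 ≤ l := by positivity
  have hd1' : (0:ℝ) < d1 := by exact_mod_cast Nat.pos_of_ne_zero hd1
  have hd2' : (0:ℝ) < d2 := by exact_mod_cast Nat.pos_of_ne_zero hd2
  have hqG : 0 < q * G := by positivity
  have hb : |bet (m * X / (q * G)) + bet (X / (q * G)) - bet ((m - 1) * X / (q * G))| ≤ 2 * (|(m:ℝ)| + 1) * (X / (q * G)) := by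
    have b0 : ∀ z : ℝ, |bet (z * X / (q * G))| ≤ |z| * (X / (q * G)) := by
      intro z
      rw [abs_of_nonneg (bet_nonneg _)]
      refine (bet_le_abs _).trans ?_
      rw [mul_div_assoc, abs_mul, abs_of_pos (show 0 < X / (q * G) by positivity)]
    have b1 := b0 m
    have b2 := b0 1
    have b3 := b0 (m - 1)
    rw [one_mul, abs_one] at b2
    have hz : 0 < X / (q * G) := by positivity
    rw [abs_le] at b1 b2 b3 ⊢
    constructor <;> nlinarith [b1.1, b1.2, b2.1, b2.2, b3.1, b3.2]
  set Bt := bet (m * X / (q * G)) + bet (X / (q * G)) - bet ((m - 1) * X / (q * G)) with hBt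
  have hφ := tot_le q
  have hφ0 : 0 ≤ (q.totient : ℝ) / q := by positivity
  rw [mul_assoc, abs_mul, abs_of_nonneg hφ0]
  refine (mul_le_of_le_one_left (abs_nonneg _) hφ).trans ?_
  have e : G / ((d1:ℝ) ^ 2 * (d2:ℝ) ^ 2) * (X ^ 2 / (q * G) + q * G / (2 * m) * Bt) = X * (X / q) * (1 / ((d1:ℝ) ^ 2 * (d2:ℝ) ^ 2)) + G / ((d1:ℝ) ^ 2 * (d2:ℝ) ^ 2) * (q * G / (2 * m) * Bt) := by
    field_simp
  rw [e]
  have t1 : |X * (X / q) * (1 / ((d1:ℝ) ^ 2 * (d2:ℝ) ^ 2))| ≤ X * (X / q) * l := by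
    rw [abs_of_nonneg (by positivity)]; gcongr
  have t2 : |q * G / (2 * m) * Bt| ≤ 2 * X := by
    rw [abs_mul, abs_div, abs_of_pos hqG, abs_mul, abs_two]
    calc q * G / (2 * |(m:ℝ)|) * |Bt| ≤ q * G / (2 * |(m:ℝ)|) * (2 * (|(m:ℝ)| + 1) * (X / (q * G))) := by gcongr
      _ = (|(m:ℝ)| + 1) / |(m:ℝ)| * X := by field_simp
      _ ≤ 2 * X := by
        gcongr
        rw [div_le_iff₀ (by linarith)]; linarith
  have t3 : |G / ((d1:ℝ) ^ 2 * (d2:ℝ) ^ 2) * (q * G / (2 * m) * Bt)| ≤ (|(m:ℝ)| * l) * (2 * X) := by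
    rw [abs_mul, abs_of_nonneg (show 0 ≤ G / ((d1:ℝ) ^ 2 * (d2:ℝ) ^ 2) by positivity)]
    exact mul_le_mul hGd t2 (abs_nonneg _) (by positivity)
  refine (abs_add_le _ _).trans ((add_le_add t1 t3).trans ?_)
  have h5 : X ≤ X * (X / q) := by nlinarith
  have h6 : 0 ≤ |(m:ℝ)| * l := by positivity
  nlinarith

lemma N_bound (m : ℤ) (hm : m ≠ 0) (η : ℝ) (hη : 0 < η) (hη1 : η ≤ 1) : ∃ C : ℝ, 0 < C ∧ ∀ (X y : ℝ) (q : ℕ), 0 < y → q ≠ 0 → (q:ℝ) ≤ X → Int.gcd m q = 1 →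
    Summable (fun x : ℕ × ℕ => ac q x.1 * ac q x.2 * mterm m X q x.1 x.2) ∧
    |NN m X q - ∑' x : ℕ × ℕ, ac q x.1 * ac q x.2 * mterm m X q x.1 x.2| ≤
      C * q.divisors.card * (X / q * y ^ (1 + η) + X * (X / q) * y ^ (η - 1) + (X / y) ^ (2 + 2 * η) + X / q * (X / y) ^ (1 + 2 * η)) := by
  obtain ⟨C1, hC1, hT⟩ := T_bound η hη hη1
  have hs := summable_lcm (1 + η) (by linarith)
  set S := ∑' x : ℕ × ℕ, 1 / ((Nat.lcm x.1 x.2 : ℕ) : ℝ) ^ (1 + η) with hS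
  have hS0 : 0 ≤ S := tsum_nonneg fun x => by positivity
  refine ⟨(2 * |(m:ℝ)| + 3) * S + C1, by positivity, ?_⟩
  intro X y q hy hq hqX hc
  have hq' : (0:ℝ) < q := by exact_mod_cast Nat.pos_of_ne_zero hq
  have hX : 0 < X := by linarith
  have hdq : (1:ℝ) ≤ q.divisors.card := by
    exact_mod_cast Finset.card_pos.2 ⟨1, Nat.one_mem_divisors.2 hq⟩
  set box := Icc 1 ⌊X⌋₊ ×ˢ Icc 1 ⌊X⌋₊ with hbox
  have hz : ∀ x : ℕ × ℕ, x ∉ box → ac q x.1 * ac q x.2 * ((cset m X q x.1 x.2).card : ℝ) = 0 := by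
    rintro ⟨d1, d2⟩ hx
    by_contra hne
    have n1 : ac q d1 ≠ 0 := fun h => hne (by simp [h])
    have n2 : ac q d2 ≠ 0 := fun h => hne (by simp [h])
    have n3 : (cset m X q d1 d2).Nonempty := by
      rw [nonempty_iff_ne_empty]; intro h; exact hne (by simp [h])
    obtain ⟨p, hp⟩ := n3
    simp only [cset, mem_filter, mem_product, mem_Icc] at hp
    obtain ⟨⟨⟨a1, a2⟩, ⟨a3, a4⟩⟩, _, a5, a6⟩ := hp
    have b1 := Nat.pos_of_ne_zero (ac_ne n1).1
    have b2 := Nat.pos_of_ne_zero (ac_ne n2).1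
    have b3 := Nat.le_of_dvd (by omega) a5
    have b4 := Nat.le_of_dvd (by omega) a6
    apply hx
    rw [hbox, mem_product, mem_Icc, mem_Icc]
    refine ⟨⟨b1, ?_⟩, ⟨b2, ?_⟩⟩ <;> simp only [] <;> nlinarith
  have hN : HasSum (fun x : ℕ × ℕ => ac q x.1 * ac q x.2 * ((cset m X q x.1 x.2).card : ℝ)) (NN m X q) := by
    rw [NN_eq m X q hc]
    exact hasSum_sum_of_ne_finset_zero hz
  have hac : ∀ x : ℕ × ℕ, |ac q x.1 * ac q x.2| ≤ 1 := by
    intro x; rw [abs_mul]; exact mul_le_one₀ (ac_abs_le _ _) (abs_nonneg _) (ac_abs_le _ _)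
  have hMs : Summable (fun x : ℕ × ℕ => ac q x.1 * ac q x.2 * mterm m X q x.1 x.2) := by
    refine Summable.of_norm_bounded ((summable_lcm 2 (by norm_num)).mul_left ((2 * |(m:ℝ)| + 1) * X * (X / q))) fun x => ?_
    by_cases h0 : ac q x.1 * ac q x.2 = 0
    · rw [h0]; simp; positivity
    rw [norm_mul, Real.norm_eq_abs, Real.norm_eq_abs]
    refine (mul_le_of_le_one_left (abs_nonneg _) (hac x)).trans ?_
    exact mterm_le m hm X q x.1 x.2 hq hqX (ac_ne (left_ne_zero_of_mul h0)).1 (ac_ne (right_ne_zero_of_mul h0)).1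
  refine ⟨hMs, ?_⟩
  set fb := box.filter (fun d : ℕ × ℕ => y < (Nat.lcm d.1 d.2 : ℕ)) with hfb
  set A := (2 * |(m:ℝ)| + 3) * q.divisors.card * (X / q * y ^ (1 + η) + X * (X / q) * y ^ (η - 1)) with hA
  have hA0 : 0 ≤ A := by positivity
  have hu : HasSum (fun x : ℕ × ℕ => if x ∈ fb then ((cset m X q x.1 x.2).card : ℝ) else 0) (∑ x ∈ fb, ((cset m X q x.1 x.2).card : ℝ)) := by
    have : HasSum (fun x : ℕ × ℕ => if x ∈ fb then ((cset m X q x.1 x.2).card : ℝ) else 0) (∑ x ∈ fb, if x ∈ fb then ((cset m X q x.1 x.2).card : ℝ) else 0) :=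
      hasSum_sum_of_ne_finset_zero (fun b hb => if_neg hb)
    rwa [sum_congr rfl (fun x hx => if_pos hx)] at this
  have hb : ∀ x : ℕ × ℕ, ‖ac q x.1 * ac q x.2 * ((cset m X q x.1 x.2).card : ℝ) - ac q x.1 * ac q x.2 * mterm m X q x.1 x.2‖ ≤
      A * (1 / ((Nat.lcm x.1 x.2 : ℕ) : ℝ) ^ (1 + η)) + (if x ∈ fb then ((cset m X q x.1 x.2).card : ℝ) else 0) := by
    intro x
    have hnn : (0:ℝ) ≤ (if x ∈ fb then ((cset m X q x.1 x.2).card : ℝ) else 0) := by positivity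
    have hx0 : 0 ≤ A * (1 / ((Nat.lcm x.1 x.2 : ℕ) : ℝ) ^ (1 + η)) := by positivity
    by_cases h0 : ac q x.1 * ac q x.2 = 0
    · rw [h0]; simp only [zero_mul, sub_zero, norm_zero]; linarith
    obtain ⟨d1, c1⟩ := ac_ne (left_ne_zero_of_mul h0)
    obtain ⟨d2, c2⟩ := ac_ne (right_ne_zero_of_mul h0)
    have hlp : (0:ℝ) < (Nat.lcm x.1 x.2 : ℕ) := by exact_mod_cast Nat.lcm_pos (Nat.pos_of_ne_zero d1) (Nat.pos_of_ne_zero d2)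
    rcases le_or_gt ((Nat.lcm x.1 x.2 : ℕ) : ℝ) y with hle | hgt
    · rw [← mul_sub, norm_mul, Real.norm_eq_abs, Real.norm_eq_abs]
      refine (mul_le_of_le_one_left (abs_nonneg _) (hac x)).trans ((cnt_main m hm X q x.1 x.2 hq hqX d1 d2 c1 c2).trans ?_)
      have h1 : ((Nat.lcm x.1 x.2 : ℕ) : ℝ) ^ (1 + η) ≤ y ^ (1 + η) := Real.rpow_le_rpow hlp.le hle (by linarith)
      have h2 : 1 ≤ y ^ (1 + η) * (1 / ((Nat.lcm x.1 x.2 : ℕ) : ℝ) ^ (1 + η)) := by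
        rw [mul_one_div, le_div_iff₀ (by positivity), one_mul]; exact h1
      have h3 : A * (1 / ((Nat.lcm x.1 x.2 : ℕ) : ℝ) ^ (1 + η)) = ((2 * |(m:ℝ)| + 3) * (X / q) * q.divisors.card) * (y ^ (1 + η) * (1 / ((Nat.lcm x.1 x.2 : ℕ) : ℝ) ^ (1 + η))) +
        ((2 * |(m:ℝ)| + 3) * q.divisors.card * (X * (X / q) * y ^ (η - 1))) * (1 / ((Nat.lcm x.1 x.2 : ℕ) : ℝ) ^ (1 + η)) := by rw [hA]; ring
      have h4 : 0 ≤ ((2 * |(m:ℝ)| + 3) * q.divisors.card * (X * (X / q) * y ^ (η - 1))) * (1 / ((Nat.lcm x.1 x.2 : ℕ) : ℝ) ^ (1 + η)) := by positivity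
      have h5 := le_mul_of_one_le_right (show 0 ≤ (2 * |(m:ℝ)| + 3) * (X / q) * q.divisors.card by positivity) h2
      linarith
    · have t1 : ‖ac q x.1 * ac q x.2 * ((cset m X q x.1 x.2).card : ℝ)‖ ≤ (if x ∈ fb then ((cset m X q x.1 x.2).card : ℝ) else 0) := by
        by_cases hxb : x ∈ box
        · rw [if_pos (mem_filter.2 ⟨hxb, hgt⟩), norm_mul, Real.norm_eq_abs, Real.norm_eq_abs, Nat.abs_cast]
          exact mul_le_of_le_one_left (by positivity) (hac x)
        · rw [hz x hxb, norm_zero]; exact hnn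
      have t2 : ‖ac q x.1 * ac q x.2 * mterm m X q x.1 x.2‖ ≤ A * (1 / ((Nat.lcm x.1 x.2 : ℕ) : ℝ) ^ (1 + η)) := by
        rw [norm_mul, Real.norm_eq_abs, Real.norm_eq_abs]
        refine (mul_le_of_le_one_left (abs_nonneg _) (hac x)).trans ((mterm_le m hm X q x.1 x.2 hq hqX d1 d2).trans ?_)
        have h1 : 1 / ((Nat.lcm x.1 x.2 : ℕ) : ℝ) ^ (2:ℝ) ≤ y ^ (η - 1) * (1 / ((Nat.lcm x.1 x.2 : ℕ) : ℝ) ^ (1 + η)) := by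
          have e : 1 / ((Nat.lcm x.1 x.2 : ℕ) : ℝ) ^ (2:ℝ) = ((Nat.lcm x.1 x.2 : ℕ) : ℝ) ^ (η - 1) * (1 / ((Nat.lcm x.1 x.2 : ℕ) : ℝ) ^ (1 + η)) := by
            rw [one_div, one_div, ← Real.rpow_neg hlp.le, ← Real.rpow_neg hlp.le, ← Real.rpow_add hlp]; congr 1; ring
          rw [e]
          refine mul_le_mul_of_nonneg_right ?_ (by positivity)
          exact Real.rpow_le_rpow_of_nonpos hy hgt.le (by linarith)
        have h2 : (2 * |(m:ℝ)| + 1) * X * (X / q) * (1 / ((Nat.lcm x.1 x.2 : ℕ) : ℝ) ^ (2:ℝ)) ≤ (2 * |(m:ℝ)| + 1) * X * (X / q) * (y ^ (η - 1) * (1 / ((Nat.lcm x.1 x.2 : ℕ) : ℝ) ^ (1 + η))) :=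
          mul_le_mul_of_nonneg_left h1 (by positivity)
        refine h2.trans ?_
        rw [← mul_assoc]
        refine mul_le_mul_of_nonneg_right ?_ (by positivity)
        have h3 : 0 ≤ X * (X / q) * y ^ (η - 1) := by positivity
        have h4 : 0 ≤ X / q * y ^ (1 + η) := by positivity
        have hm0 := abs_nonneg (m:ℝ)
        have h5 : (2 * |(m:ℝ)| + 1) ≤ (2 * |(m:ℝ)| + 3) * q.divisors.card := by nlinarith
        calc (2 * |(m:ℝ)| + 1) * X * (X / q) * y ^ (η - 1) = (2 * |(m:ℝ)| + 1) * (X * (X / q) * y ^ (η - 1)) := by ring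
          _ ≤ ((2 * |(m:ℝ)| + 3) * q.divisors.card) * (X / q * y ^ (1 + η) + X * (X / q) * y ^ (η - 1)) := by
            refine mul_le_mul h5 (by linarith) h3 (by positivity)
      refine (norm_sub_le _ _).trans ?_
      linarith
  have hfin := tsum_of_norm_bounded ((hs.hasSum.mul_left A).add hu) hb
  rw [(hN.sub hMs.hasSum).tsum_eq, Real.norm_eq_abs] at hfin
  have hTT := hT m X y q hX hy hq hc
  refine hfin.trans ?_
  rw [← hS]
  have p1 : 0 ≤ (q.divisors.card : ℝ) * (X / q * y ^ (1 + η) + X * (X / q) * y ^ (η - 1)) := by positivity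
  have p2 : 0 ≤ (q.divisors.card : ℝ) * ((X / y) ^ (2 + 2 * η) + X / q * (X / y) ^ (1 + 2 * η)) := by positivity
  have q1 : 0 ≤ C1 * ((q.divisors.card : ℝ) * (X / q * y ^ (1 + η) + X * (X / q) * y ^ (η - 1))) := by positivity
  have q2 : 0 ≤ (2 * |(m:ℝ)| + 3) * S * ((q.divisors.card : ℝ) * ((X / y) ^ (2 + 2 * η) + X / q * (X / y) ^ (1 + 2 * η))) := by positivity
  have e1 : A * S = (2 * |(m:ℝ)| + 3) * S * ((q.divisors.card : ℝ) * (X / q * y ^ (1 + η) + X * (X / q) * y ^ (η - 1))) := by rw [hA]; ring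
  rw [e1]
  linarith
end

section
open Finset

lemma Cq_bd : ∃ C : ℝ, 0 < C ∧ ∀ q : ℕ, q ≠ 0 → |Cq q| ≤ C := by
  refine ⟨∑' r : ℕ, 1 / (r:ℝ) ^ 2 + 1, by have : 0 ≤ ∑' r : ℕ, 1 / (r:ℝ) ^ 2 := tsum_nonneg (fun r => by positivity)
                                          linarith, fun q hq => ?_⟩
  rw [← tsum_ac q hq]
  have hs : Summable (fun r : ℕ => 1 / (r:ℝ) ^ 2) := Real.summable_one_div_nat_pow.mpr (by norm_num)
  have := tsum_of_norm_bounded hs.hasSum (f := fun r : ℕ => ac q r / (r:ℝ) ^ 2) (fun r => by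
    rw [Real.norm_eq_abs, abs_div, abs_of_nonneg (by positivity : (0:ℝ) ≤ (r:ℝ) ^ 2)]
    exact div_le_div_of_nonneg_right (ac_abs_le _ _) (by positivity))
  rw [Real.norm_eq_abs] at this
  linarith

lemma GammaAn_eq (m : ℤ) (hm : m ≠ 0) : GammaAn m = (Real.sqrt |(m:ℝ)| + 1 - Real.sqrt |(m:ℝ) - 1|) / m := by
  unfold GammaAn
  split_ifs with h
  · have h1 : (1:ℝ) ≤ m := by exact_mod_cast h
    rw [abs_of_nonneg (by linarith), abs_of_nonneg (by linarith)]
  · have h1 : (m:ℝ) < 0 := by exact_mod_cast lt_of_le_of_ne (not_lt.mp h) hm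
    rw [abs_of_neg h1, abs_of_neg (by linarith), div_neg, ← neg_div]
    congr 1
    rw [show -((m:ℝ) - 1) = 1 - m by ring]; ring

lemma main_id (m : ℤ) (hm : m ≠ 0) (X : ℝ) (hX : 0 ≤ X) (q : ℕ) (hq : q ≠ 0) :
    ∑' x : ℕ × ℕ, ac q x.1 * ac q x.2 * mterm m X q x.1 x.2 = q.totient * (Cq q * X / q) ^ 2 +
      q / (2 * m) * ((q.totient:ℝ) / q * Pm m.natAbs q (|(m:ℝ)| * (X / q)) + (q.totient:ℝ) / q * Pm m.natAbs q (X / q)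
        - (q.totient:ℝ) / q * Pm m.natAbs q (|(m:ℝ) - 1| * (X / q))) := by
  have hq' : (0:ℝ) < q := by exact_mod_cast Nat.pos_of_ne_zero hq
  have hm' : (m:ℝ) ≠ 0 := by exact_mod_cast hm
  have hM : m.natAbs ≠ 0 := by simpa using hm
  have hH : 0 ≤ X / q := by positivity
  set F := fun (Z : ℝ) (x : ℕ × ℕ) => ac q x.1 * ac q x.2 *
    ((GG m.natAbs x.1 x.2 : ℝ) ^ 2 / ((x.1:ℝ) ^ 2 * (x.2:ℝ) ^ 2)) * bet (Z / (GG m.natAbs x.1 x.2 : ℝ)) with hF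
  have hs : ∀ Z, 0 ≤ Z → HasSum (F Z) (Pm m.natAbs q Z) := fun Z hZ => (Pm_summable hM hZ).hasSum
  have h0 : HasSum (fun x : ℕ × ℕ => (ac q x.1 / (x.1:ℝ) ^ 2) * (ac q x.2 / (x.2:ℝ) ^ 2)) (Cq q * Cq q) := by
    have hn := (summable_ac_sq q).norm
    have h1 := summable_mul_of_summable_norm hn hn
    have h2 := tsum_mul_tsum_of_summable_norm hn hn
    rw [tsum_ac q hq] at h2
    rw [h2]; exact h1.hasSum
  have key := (h0.mul_left ((q.totient:ℝ) / q * (X ^ 2 / q))).add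
    ((((hs _ (mul_nonneg (abs_nonneg (m:ℝ)) hH)).add (hs _ hH)).sub (hs _ (mul_nonneg (abs_nonneg ((m:ℝ) - 1)) hH))).mul_left
      (q / (2 * m) * ((q.totient:ℝ) / q)))
  have hv : ∀ x : ℕ × ℕ, ac q x.1 * ac q x.2 * mterm m X q x.1 x.2 = (q.totient:ℝ) / q * (X ^ 2 / q) * ((ac q x.1 / (x.1:ℝ) ^ 2) * (ac q x.2 / (x.2:ℝ) ^ 2))
      + q / (2 * m) * ((q.totient:ℝ) / q) * (F (|(m:ℝ)| * (X / q)) x + F (X / q) x - F (|(m:ℝ) - 1| * (X / q)) x) := by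
    intro x
    by_cases h1 : ac q x.1 = 0
    · simp [hF, h1]
    by_cases h2 : ac q x.2 = 0
    · simp [hF, h2]
    have d1 : (x.1:ℝ) ≠ 0 := by exact_mod_cast (ac_ne h1).1
    have d2 : (x.2:ℝ) ≠ 0 := by exact_mod_cast (ac_ne h2).1
    have hG : (0:ℝ) < (GG m.natAbs x.1 x.2 : ℕ) := by exact_mod_cast GG_pos (ac_ne h2).1
    simp only [hF, mterm]
    have e : ∀ z : ℝ, bet (|z| * (X / q) / (GG m.natAbs x.1 x.2 : ℕ)) = bet (z * X / (q * (GG m.natAbs x.1 x.2 : ℕ))) := by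
      intro z
      rw [← bet_abs (z * X / _), abs_div, abs_mul, abs_of_nonneg hX, abs_of_pos (by positivity : (0:ℝ) < q * (GG m.natAbs x.1 x.2 : ℕ))]
      congr 1; field_simp
    have e1 := e 1
    rw [abs_one, one_mul, one_mul] at e1
    rw [e, e, e1]
    generalize bet (m * X / _) = b1
    generalize bet (X / _) = b2
    generalize bet (_ * X / _) = b3
    field_simp
  rw [tsum_congr hv, key.tsum_eq]
  field_simp
end

section
open Finset

lemma absorb : ∃ C : ℝ, 0 < C ∧ ∀ (X : ℝ) (q : ℕ), 2 ≤ X → 1 ≤ q → (q:ℝ) ≤ X → ∃ y : ℝ, 0 < y ∧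
    (q.divisors.card:ℝ) * (X/q*y^(1+(1/1000:ℝ)) + X*(X/q)*y^((1/1000:ℝ)-1) + (X/y)^(2+2*(1/1000:ℝ)) + X/q*(X/y)^(1+2*(1/1000:ℝ)))
      ≤ C * ((q.divisors.card : ℝ) * X ^ ((1 : ℝ)/3) * (q : ℝ) ^ ((2 : ℝ)/3)
            + X ^ ((23 : ℝ)/15) * (q : ℝ) ^ (-(13 : ℝ)/15) * Real.log X ^ 15) ∧
    (q.divisors.card:ℝ) * (X/q * X^(1/2+(1/1000:ℝ))) ≤ C * ((q.divisors.card : ℝ) * X ^ ((1 : ℝ)/3) * (q : ℝ) ^ ((2 : ℝ)/3)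
            + X ^ ((23 : ℝ)/15) * (q : ℝ) ^ (-(13 : ℝ)/15) * Real.log X ^ 15) := by
  obtain ⟨C1, hC1, hd⟩ := div_bound (1/1000) (by norm_num)
  have hl2 : 0 < Real.log 2 ^ 15 := pow_pos (Real.log_pos (by norm_num)) _
  refine ⟨4 * (1 + C1 / Real.log 2 ^ 15), by positivity, fun X q hX hq hqX => ?_⟩
  have hq' : (1:ℝ) ≤ q := by exact_mod_cast hq
  have hD := hd q (by omega)
  have hL : Real.log 2 ^ 15 ≤ Real.log X ^ 15 := pow_le_pow_left₀ (Real.log_nonneg (by norm_num)) (Real.log_le_log (by norm_num) hX) _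
  generalize Real.log X ^ 15 = L at hL ⊢
  have hD0 : (0:ℝ) ≤ (q.divisors.card:ℝ) := by positivity
  generalize (q.divisors.card:ℝ) = D at hD hD0 ⊢
  obtain ⟨u, rfl⟩ : ∃ u, X = Real.exp u := ⟨Real.log X, (Real.exp_log (by linarith)).symm⟩
  obtain ⟨w, hw⟩ : ∃ w, (q:ℝ) = Real.exp w := ⟨Real.log q, (Real.exp_log (by linarith)).symm⟩
  rw [hw] at hq' hqX hD ⊢
  rw [Real.exp_le_exp] at hqX
  have hw0 : 0 ≤ w := by rwa [Real.one_le_exp_iff] at hq'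
  refine ⟨Real.exp (2 / 3 * u - (u - w) / 6), Real.exp_pos _, ?_⟩
  simp only [← Real.exp_sub, ← Real.exp_mul, ← Real.exp_add] at hD ⊢
  have hB : D * Real.exp (2 / 3 * u + 5 / 6 * (u - w) + u / 500) ≤ (1 + C1 / Real.log 2 ^ 15) *
      (D * Real.exp (u * (1 / 3)) * Real.exp (w * (2 / 3)) + Real.exp (u * (23 / 15) + w * (-13 / 15)) * L) := by
    have p1 : 0 ≤ D * Real.exp (u * (1 / 3)) * Real.exp (w * (2 / 3)) := by positivity
    have p2 : 0 ≤ Real.exp (u * (23 / 15) + w * (-13 / 15)) * L := mul_nonneg (Real.exp_pos _).le (hl2.le.trans hL)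
    have p3 : 0 ≤ C1 / Real.log 2 ^ 15 := by positivity
    rcases le_total (u - w) (u / 5) with h | h
    · have : D * Real.exp (2 / 3 * u + 5 / 6 * (u - w) + u / 500) ≤ D * Real.exp (u * (1 / 3)) * Real.exp (w * (2 / 3)) := by
        rw [mul_assoc, ← Real.exp_add]
        exact mul_le_mul_of_nonneg_left (Real.exp_le_exp.mpr (by linarith)) hD0
      nlinarith [mul_nonneg p3 p1, mul_nonneg p3 p2]
    · have h1 : D * Real.exp (2 / 3 * u + 5 / 6 * (u - w) + u / 500) ≤ C1 * Real.exp (u * (23 / 15) + w * (-13 / 15)) := by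
        refine (mul_le_mul_of_nonneg_right hD (Real.exp_pos _).le).trans ?_
        rw [mul_assoc, ← Real.exp_add]
        exact mul_le_mul_of_nonneg_left (Real.exp_le_exp.mpr (by linarith)) (by linarith)
      have h2 : C1 * Real.exp (u * (23 / 15) + w * (-13 / 15)) ≤ C1 / Real.log 2 ^ 15 * (Real.exp (u * (23 / 15) + w * (-13 / 15)) * L) := by
        rw [div_mul_eq_mul_div, le_div_iff₀ hl2, mul_assoc]
        exact mul_le_mul_of_nonneg_left (mul_le_mul_of_nonneg_left hL (Real.exp_pos _).le) (by linarith)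
      nlinarith [mul_nonneg p3 p1, mul_nonneg p3 p2]
  have hE : ∀ a : ℝ, a ≤ 2 / 3 * u + 5 / 6 * (u - w) + u / 500 → D * Real.exp a ≤ (1 + C1 / Real.log 2 ^ 15) *
      (D * Real.exp (u * (1 / 3)) * Real.exp (w * (2 / 3)) + Real.exp (u * (23 / 15) + w * (-13 / 15)) * L) := fun a ha =>
    (mul_le_mul_of_nonneg_left (Real.exp_le_exp.mpr ha) hD0).trans hB
  have hP := (mul_nonneg hD0 (Real.exp_pos (2 / 3 * u + 5 / 6 * (u - w) + u / 500)).le).trans hB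
  rw [mul_assoc 4]
  constructor
  · rw [mul_add, mul_add, mul_add]
    have a1 := hE (u - w + (2 / 3 * u - (u - w) / 6) * (1 + 1 / 1000)) (by linarith)
    have a2 := hE (u + (u - w) + (2 / 3 * u - (u - w) / 6) * (1 / 1000 - 1)) (by linarith)
    have a3 := hE ((u - (2 / 3 * u - (u - w) / 6)) * (2 + 2 * (1 / 1000))) (by linarith)
    have a4 := hE (u - w + (u - (2 / 3 * u - (u - w) / 6)) * (1 + 2 * (1 / 1000))) (by linarith)
    linarith
  · have a1 := hE (u - w + u * (1 / 2 + 1 / 1000)) (by linarith)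
    linarith
end

section
open Finset

lemma core_id (m q Km sM s1 H : ℝ) : q / (2 * m) * (Km * (sM * H) + Km * H - Km * (s1 * H)) = Km / 2 * ((sM + 1 - s1) / m) * (q * H) := by
  field_simp
theorem statement1 (m : ℤ) (hm : m ≠ 0) :
    ∃ A : ℝ, 0 < A ∧ ∀ (X : ℝ) (q : ℕ), 2 ≤ X → 1 ≤ q → (q : ℝ) ≤ X → Int.gcd m q = 1 →
      |M2corr m X q - Cmain / 2 * GammaAn m * GammaAr m *
          (∏ p ∈ q.primeFactors, (1 + 2 * ((p : ℝ))⁻¹)⁻¹) *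
          X ^ ((1 : ℝ)/2) * (q : ℝ) ^ ((1 : ℝ)/2)|
        ≤ A * ((q.divisors.card : ℝ) * X ^ ((1 : ℝ)/3) * (q : ℝ) ^ ((2 : ℝ)/3)
            + X ^ ((23 : ℝ)/15) * (q : ℝ) ^ (-(13 : ℝ)/15) * Real.log X ^ 15) := by
  obtain ⟨C1, hC1, h1⟩ := Pm_asymp m hm
  obtain ⟨C2, hC2, h2⟩ := QQ_asymp (1/1000) (by norm_num) (by norm_num)
  obtain ⟨C3, hC3, h3⟩ := N_bound m hm (1/1000) (by norm_num) (by norm_num)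
  obtain ⟨C4, hC4, h4⟩ := Cq_bd
  obtain ⟨C5, hC5, h5⟩ := absorb
  have hm' : (m:ℝ) ≠ 0 := by exact_mod_cast hm
  have hma : 0 < |(m:ℝ)| := abs_pos.mpr hm'
  set B := |(m:ℝ)| ^ ((1:ℝ)/3) + 1 + |(m:ℝ) - 1| ^ ((1:ℝ)/3) with hB
  have hB0 : 0 < B := by positivity
  refine ⟨C3 * C5 + 2 * C4 * C2 * C5 + C1 * B / (2 * |(m:ℝ)|), by positivity, fun X q hX hq hqX hc => ?_⟩
  have hq0 : q ≠ 0 := by omega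
  have hq' : (0:ℝ) < q := by exact_mod_cast hq
  have hX0 : 0 < X := by linarith
  obtain ⟨y, hy, hy1, hy2⟩ := h5 X q hX hq hqX
  obtain ⟨-, hN⟩ := h3 X y q hy hq0 hqX hc
  rw [main_id m hm X hX0.le q hq0] at hN
  have hQ := h2 q hq0 X (by linarith)
  have hcop : Nat.Coprime m.natAbs q := by simpa [Int.gcd] using hc
  have hH : 0 ≤ X / q := by positivity
  have e1 := h1 q hq0 hcop _ (mul_nonneg (abs_nonneg (m:ℝ)) hH)
  have e2 := h1 q hq0 hcop _ hH
  have e3 := h1 q hq0 hcop _ (mul_nonneg (abs_nonneg ((m:ℝ) - 1)) hH)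
  rw [Real.mul_rpow (abs_nonneg _) hH, Real.sqrt_mul (abs_nonneg _)] at e1 e3
  rw [M2_eq m hq0 hc X, GammaAn_eq m hm]
  have hqH : X ^ ((1:ℝ)/2) * (q:ℝ) ^ ((1:ℝ)/2) = q * Real.sqrt (X / q) := by
    rw [← Real.sqrt_eq_rpow, ← Real.sqrt_eq_rpow, Real.sqrt_div hX0.le]
    have := Real.mul_self_sqrt hq'.le
    have hs := Real.sqrt_pos.mpr hq'
    rw [mul_div_assoc', eq_div_iff hs.ne']
    linear_combination Real.sqrt X * this
  have hqH3 : q * (X / q) ^ ((1:ℝ)/3) = X ^ ((1:ℝ)/3) * (q:ℝ) ^ ((2:ℝ)/3) := by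
    rw [Real.div_rpow hX0.le hq'.le]
    have : (q:ℝ) = (q:ℝ) ^ ((1:ℝ)/3) * (q:ℝ) ^ ((2:ℝ)/3) := by
      rw [← Real.rpow_add hq']; norm_num
    have hs : 0 < (q:ℝ) ^ ((1:ℝ)/3) := by positivity
    rw [mul_div_assoc', div_eq_iff hs.ne']
    linear_combination X ^ ((1:ℝ)/3) * this
  have hR0 : 0 ≤ X ^ ((23 : ℝ)/15) * (q : ℝ) ^ (-(13 : ℝ)/15) * Real.log X ^ 15 := by
    have := Real.log_nonneg (by linarith : 1 ≤ X)
    positivity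
  rw [mul_assoc _ (X ^ ((1:ℝ)/2)), hqH]
  rw [mul_assoc _ (X ^ ((1:ℝ)/3)), ← hqH3] at hy1 hy2 ⊢
  have hc4 := h4 q hq0
  generalize X ^ ((23 : ℝ)/15) * (q : ℝ) ^ (-(13 : ℝ)/15) * Real.log X ^ 15 = R at *
  set κ := Cmain * GammaAr m * (∏ p ∈ q.primeFactors, (1 + 2 * (p:ℝ)⁻¹)⁻¹) with hκ
  set W := (q.totient:ℝ) / q with hW
  set D := (q.divisors.card:ℝ) with hD
  have hD0 : 0 ≤ D := by positivity
  set H3 := (X / q) ^ ((1:ℝ)/3) with hH3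
  have hH30 : 0 ≤ H3 := by positivity
  set P1 := W * Pm m.natAbs q (|(m:ℝ)| * (X / q))
  set P2 := W * Pm m.natAbs q (X / q)
  set P3 := W * Pm m.natAbs q (|(m:ℝ) - 1| * (X / q))
  set s := Real.sqrt (X / q)
  set sM := Real.sqrt |(m:ℝ)|
  set s1 := Real.sqrt |(m:ℝ) - 1|
  have hφ : (q.totient:ℝ) * (Cq q * X / q) ^ 2 = Cq q * X / q * (W * X * Cq q) := by
    rw [hW]; field_simp
  have hid : NN m X q - 2 * (Cq q * X / q) * QQ X q + q.totient * (Cq q * X / q) ^ 2 -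
      Cmain / 2 * ((sM + 1 - s1) / m) * GammaAr m * (∏ p ∈ q.primeFactors, (1 + 2 * (p:ℝ)⁻¹)⁻¹) * (q * s) =
      (NN m X q - (q.totient * (Cq q * X / q) ^ 2 + q / (2 * m) * (P1 + P2 - P3)))
      - 2 * (Cq q * X / q) * (QQ X q - W * X * Cq q)
      + q / (2 * m) * ((P1 - κ * (sM * s)) + (P2 - κ * s) - (P3 - κ * (s1 * s))) := by
    have := core_id m q κ sM s1 s
    rw [hφ]
    linear_combination this
  rw [hid]
  have t1 : |NN m X q - (q.totient * (Cq q * X / q) ^ 2 + q / (2 * m) * (P1 + P2 - P3))| ≤ C3 * (C5 * (D * (q * H3) + R)) := by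
    refine hN.trans ?_
    rw [mul_assoc]
    exact mul_le_mul_of_nonneg_left hy1 hC3.le
  have t2 : |2 * (Cq q * X / q) * (QQ X q - W * X * Cq q)| ≤ 2 * C4 * C2 * (C5 * (D * (q * H3) + R)) := by
    rw [abs_mul]
    have : |2 * (Cq q * X / q)| ≤ 2 * C4 * (X / q) := by
      rw [mul_div_assoc, abs_mul, abs_mul, abs_two, abs_of_nonneg hH, ← mul_assoc]
      exact mul_le_mul_of_nonneg_right (by linarith) hH
    refine (mul_le_mul this hQ (abs_nonneg _) (by positivity)).trans ?_
    rw [show 2 * C4 * (X / q) * (C2 * D * X ^ (1/2 + (1/1000:ℝ))) = 2 * C4 * C2 * (D * (X / q * X ^ (1/2 + (1/1000:ℝ)))) by ring]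
    exact mul_le_mul_of_nonneg_left hy2 (by positivity)
  have t3 : |q / (2 * m) * ((P1 - κ * (sM * s)) + (P2 - κ * s) - (P3 - κ * (s1 * s)))| ≤ C1 * B / (2 * |(m:ℝ)|) * (D * (q * H3)) := by
    rw [abs_mul, abs_div, abs_mul, abs_two, abs_of_pos hq']
    have : |(P1 - κ * (sM * s)) + (P2 - κ * s) - (P3 - κ * (s1 * s))| ≤ C1 * D * B * H3 := by
      refine (abs_sub _ _).trans ?_
      have := abs_add_le (P1 - κ * (sM * s)) (P2 - κ * s)
      have e : C1 * D * B * H3 = C1 * D * (|(m:ℝ)| ^ ((1:ℝ)/3) * H3) + C1 * D * H3 + C1 * D * (|(m:ℝ) - 1| ^ ((1:ℝ)/3) * H3) := by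
        rw [hB]; ring
      rw [e]; linarith
    refine (mul_le_mul_of_nonneg_left this (by positivity)).trans (le_of_eq ?_)
    field_simp
  have t4 : C1 * B / (2 * |(m:ℝ)|) * (D * (q * H3)) ≤ C1 * B / (2 * |(m:ℝ)|) * (D * (q * H3) + R) :=
    mul_le_mul_of_nonneg_left (by linarith) (by positivity)
  refine (abs_add_le _ _).trans ?_
  refine (add_le_add_left (abs_sub _ _) _).trans ?_
  refine (add_le_add (add_le_add t1 t2) (t3.trans t4)).trans (le_of_eq ?_)
  ring
end
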